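/- Let n be a sufficiently large integer with n ≡ 0 (mod 4). Let H be a balanced (1,4)-partite 5-graph with partition classes X and [n] (so |X| = n/4, and every edge of H contains exactly one vertex of X and exactly four vertices of [n]). Suppose that for every x ∈ X, the 4-graph N_H(x) on [n] satisfies δ_1(N_H(x)) > binom(n-1,3) - binom(3n/4,3). Then H has a perfect matching. -/

import Mathlib

set_option maxHeartbeats 1000000

open Finset

/-- two single variables exceed the threshold -/
lemma two_singles_bound {a b : ℝ} (ha : 0 ≤ a) (hb : 0 ≤ b)
    (h1 : 2 * a + b ≤ 1001 / 1000) (h2 : a + 2 * b ≤ 1001 / 1000) :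
    a + b - a * b ≤ 57 / 100 := by
  nlinarith [mul_nonneg (sub_nonneg.2 h1) (sub_nonneg.2 h2)]

lemma one_single_pair_bound {a b c k : ℝ} (ha : 0 ≤ a) (hb : 0 ≤ b) (hc : 0 ≤ c) (hb1 : b ≤ 1)
    (hc1 : c ≤ 1) (hk : 1 / 2 ≤ k) (hk1 : k ≤ 1)
    (h1 : 2 * a + (k * b + (1 - k) * c) ≤ 1001 / 1000)
    (h2 : a + (2 * k * b + (1 - k) * c) ≤ 1001 / 1000) :
    a + (1 - a) * (b * c) ≤ 57 / 100 := by
  have ht : b * c ≤ k * b + (1 - k) * c := by nlinarith [mul_nonneg hb (sub_nonneg.2 hc1), mul_nonneg hc (sub_nonneg.2 hb1), mul_nonneg (mul_nonneg hb (sub_nonneg.2 hc1)) (by linarith : 0 ≤ k), mul_nonneg (mul_nonneg hc (sub_nonneg.2 hb1)) (by linarith : 0 ≤ 1 - k)]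
  have ht0 : 0 ≤ b * c := mul_nonneg hb hc
  generalize htt : b * c = t at *
  have ha1 : a ≤ 501 / 1000 := by linarith
  rcases le_total t (1 / 2) with h | h
  · have h3 : a + 2 * t ≤ 1001 / 1000 := by
      have : 2 * t ≤ 2 * k * b + (1 - k) * c := by
        have e1 : 0 ≤ b + c / 2 - 2 * t := by
          have : (2 * t) ^ 2 ≤ (b + c / 2) ^ 2 := by nlinarith [sq_nonneg (b - c / 2)]
          linarith [le_abs_self (2 * t), abs_le_of_sq_le_sq this (by positivity)]
        have e2 : 0 ≤ 2 * b - 2 * t := by nlinarith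
        -- linear in k
        nlinarith [mul_nonneg e1 (by linarith : 0 ≤ 2 - 2 * k), mul_nonneg e2 (by linarith : 0 ≤ 2 * k - 1)]
      linarith
    rcases le_total a (1 / 3) with h4 | h4
    · nlinarith
    · nlinarith
  · have e1 : 1 ≤ b + c / 2 := by nlinarith [sq_nonneg (b - c / 2)]
    have e2 : 1 ≤ 2 * b := by nlinarith
    have e3 : 1 ≤ 2 * k * b + (1 - k) * c := by
      nlinarith [mul_nonneg (sub_nonneg.2 e1) (by linarith : 0 ≤ 2 - 2 * k), mul_nonneg (sub_nonneg.2 e2) (by linarith : 0 ≤ 2 * k - 1)]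
    have h5 : (2 * t) ≤ 1004 / 1000 := by
      have e4 : (2 * t) ≤ (b + c / 2) ^ 2 := by nlinarith [sq_nonneg (b - c / 2)]
      have e5 : 2 * t ≤ 2 * b := by nlinarith
      by_contra hcon
      push Not at hcon
      have e6 : 1001 / 1000 < b + c / 2 := by nlinarith
      have e7 : 1001 / 1000 < 2 * b := by linarith
      nlinarith [mul_nonneg (sub_nonneg.2 e6.le) (by linarith : 0 ≤ 2 - 2 * k), mul_nonneg (sub_nonneg.2 e7.le) (by linarith : 0 ≤ 2 * k - 1)]
    nlinarith

lemma star_bound {a b c k : ℝ} (ha : 0 ≤ a) (hb : 0 ≤ b) (hc : 0 ≤ c) (hb1 : b ≤ 1)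
    (hc1 : c ≤ 1) (hk : 1 / 2 ≤ k) (hk1 : k ≤ 1)
    (h1 : 2 * (k * a) + (1 - k) * (b + c) ≤ 1001 / 1000) :
    a * (b + c - b * c) ≤ 57 / 100 := by
  have e1 : b + c - b * c ≤ 1 := by nlinarith [mul_nonneg (sub_nonneg.2 hb1) (sub_nonneg.2 hc1)]
  have e2 : b + c - b * c ≤ b + c := by nlinarith
  have e0 : 0 ≤ b + c - b * c := by nlinarith
  generalize b + c - b * c = z at *
  generalize b + c = s at *
  have h1' : 2 * (k * a) + (1 - k) * z ≤ 1001 / 1000 := by nlinarith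
  clear h1
  rcases le_total (2 * a) 1 with h | h
  · nlinarith
  · have : a + z / 2 ≤ 1001 / 1000 := by nlinarith
    nlinarith [sq_nonneg (a - z / 2)]

lemma triple_bound {a b c k l j : ℝ} (ha : 0 ≤ a) (hb : 0 ≤ b) (hc : 0 ≤ c)
    (hb1 : b ≤ 1) (hc1 : c ≤ 1) (hl : 0 ≤ l) (hj : 0 ≤ j) (hkl : l ≤ k) (hlj : j ≤ l)
    (hs : 1 ≤ k + l + j) (h1 : 2 * (k * a) + l * b + j * c ≤ 1001 / 1000) :
    a * b * c ≤ 57 / 100 := by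
  by_contra hcon
  push Not at hcon
  have h2 : 2 * (b * c) ≤ b + c := by nlinarith
  have h3 : (301 : ℝ) / 100 ≤ 2 * a + 2 * (b * c) := by
    have := mul_nonneg hb hc
    have h4 : 57 / 100 < a * (b * c) := by linarith
    nlinarith [sq_nonneg (a - b * c)]
  have h5 : l * (1 - b) ≤ k * (1 - b) := by nlinarith
  have h6 : j * (1 - c) ≤ k * (1 - c) := by nlinarith
  nlinarith

lemma triangle_bound {a b c k : ℝ} (ha : 0 ≤ a) (hb : 0 ≤ b) (hc : 0 ≤ c)
    (hc1 : c ≤ 1) (hk : k ≤ 1 / 2)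
    (h1 : 2 * (k * c) + (1 - k) * (a + b) ≤ 1001 / 1000)
    (h2 : k * c + (1 - k) * (2 * a + b) ≤ 1001 / 1000)
    (h3 : k * c + (1 - k) * (a + 2 * b) ≤ 1001 / 1000) :
    c * (a + b - a * b) + (1 - c) * (a * b) ≤ 57 / 100 := by
  have f2 : 2 * a + b ≤ 2 - c + 2 / 1000 := by nlinarith
  have f3 : a + 2 * b ≤ 2 - c + 2 / 1000 := by nlinarith
  rcases le_total c (1 / 2) with h | h
  · have f1 : a + b ≤ 2 - 2 * c + 2 / 1000 := by nlinarith
    have : a * b ≤ (a + b) ^ 2 / 4 := by nlinarith [sq_nonneg (a - b)]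
    have hs : a + b ≤ (4 - 2 * c + 4 / 1000) / 3 := by linarith
    have hab : 0 ≤ a + b := by linarith
    have e1 : c * (a + b - a * b) + (1 - c) * (a * b) ≤ c * (a + b) + (1 - 2 * c) * ((a + b) ^ 2 / 4) := by
      nlinarith
    refine e1.trans ?_
    generalize a + b = s at *
    have e2 : s ^ 2 ≤ ((4 - 2 * c + 4 / 1000) / 3) ^ 2 := by gcongr
    have e3 : c * s + (1 - 2 * c) * (s ^ 2 / 4) ≤ c * ((4 - 2 * c + 4 / 1000) / 3) + (1 - 2 * c) * (((4 - 2 * c + 4 / 1000) / 3) ^ 2 / 4) := by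
      have : 0 ≤ 1 - 2 * c := by linarith
      gcongr
    refine e3.trans ?_
    nlinarith [mul_nonneg hc (sub_nonneg.2 h), mul_nonneg (mul_nonneg hc hc) (sub_nonneg.2 h)]
  · have f1 : a + b ≤ 1 + 2 / 1000 := by nlinarith
    have hs : a + b ≤ (4 - 2 * c + 4 / 1000) / 3 := by linarith
    by_cases hcs : c * (a + b) ≤ 57 / 100
    · nlinarith [mul_nonneg ha hb]
    push Not at hcs
    have hM : (2 - c + 2 / 1000 - (a + b)) * (a + b) - (2 - c + 2 / 1000 - (a + b)) ^ 2 ≤ a * b := by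
      nlinarith [mul_nonneg (sub_nonneg.2 f2) (sub_nonneg.2 f3)]
    have e1 : c * (a + b - a * b) + (1 - c) * (a * b) ≤ c * (a + b) - (2 * c - 1) * ((2 - c + 2 / 1000 - (a + b)) * (a + b) - (2 - c + 2 / 1000 - (a + b)) ^ 2) := by
      nlinarith
    refine e1.trans ?_
    generalize a + b = s at *
    obtain ⟨t, rfl⟩ : ∃ t, s = 2 * (2 - c + 2 / 1000) / 3 - t := ⟨2 * (2 - c + 2 / 1000) / 3 - s, by ring⟩
    have ht : 0 ≤ t := by linarith
    have ht1 : t ≤ 11 / 100 := by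
      by_contra hcon
      push Not at hcon
      clear hM e1 h1 h2 h3 f1 f2 f3
      nlinarith [mul_le_mul_of_nonneg_left hcon.le hc, sq_nonneg (c - 23 / 25)]
    have ht2 : -c + (2 * c - 1) * (2 - c + 2 / 1000) / 3 + 2 * (2 * c - 1) * t ≤ 0 := by
      nlinarith
    have e2 : 2 * c * (2 - c + 2 / 1000) / 3 - (2 * c - 1) * (2 - c + 2 / 1000) ^ 2 / 9 ≤ 57 / 100 := by
      nlinarith [mul_nonneg (sub_nonneg.2 hc1) (sub_nonneg.2 h), sq_nonneg (1 - c)]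
    nlinarith [mul_nonneg ht (neg_nonneg.2 ht2)]

lemma all_singles_bound {p q r : ℝ} (hp : 0 ≤ p) (hq : 0 ≤ q) (hr : 0 ≤ r)
    (h1 : 2 * p + q + r ≤ 1) (h2 : p + 2 * q + r ≤ 1) (h3 : p + q + 2 * r ≤ 1) :
    27 / 64 + (3 / 4 - (p + q + r)) / 20 ≤ (1 - p) * (1 - q) * (1 - r) := by
  obtain ⟨s, hs⟩ : ∃ s, s = p + q + r := ⟨_, rfl⟩
  have a1 : 0 ≤ 1 - s - p := by linarith
  have a2 : 0 ≤ 1 - s - q := by linarith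
  have a3 : 0 ≤ 1 - s - r := by linarith
  have hs1 : s ≤ 3 / 4 := by linarith
  have hs0 : 0 ≤ s := by linarith
  have hpq := mul_nonneg hp hq
  have hpr := mul_nonneg hp hr
  have hqr := mul_nonneg hq hr
  rw [← hs]
  rcases le_total s (3 / 5) with h | h
  · have e1 : 1 - s + (p * q + p * r + q * r) * (2 / 3) ≤ (1 - p) * (1 - q) * (1 - r) := by
      have : p * q * r ≤ (p * q + p * r + q * r) / 3 := by nlinarith
      nlinarith
    have e2 : s * (2 * s - 1) ≤ 2 * (p * q + p * r + q * r) := by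
      subst hs
      nlinarith [mul_nonneg hp a1, mul_nonneg hq a2, mul_nonneg hr a3]
    nlinarith
  · have e1 : s ^ 2 * (3 - 3 * s) ≤ (1 - p) * (1 - q) * (1 - r) := by
      obtain ⟨x, hx⟩ : ∃ x, x = 1 - s - p := ⟨_, rfl⟩
      obtain ⟨y, hy⟩ : ∃ x, x = 1 - s - q := ⟨_, rfl⟩
      obtain ⟨z, hz⟩ : ∃ x, x = 1 - s - r := ⟨_, rfl⟩
      rw [← hx] at a1
      rw [← hy] at a2
      rw [← hz] at a3
      have e : (1 - p) * (1 - q) * (1 - r) = (s + x) * (s + y) * (s + z) := by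
        rw [hx, hy, hz]; ring
      have e' : 3 - 3 * s = s + (x + y + z) := by linarith
      rw [e, e']
      have := mul_nonneg a1 a2
      have := mul_nonneg a1 a3
      have := mul_nonneg a2 a3
      have : (s + x) * (s + y) * (s + z) - s ^ 2 * (s + (x + y + z)) = s * (x * y + x * z + y * z) + x * y * z := by ring
      have : 0 ≤ s * (x * y + x * z + y * z) + x * y * z := by positivity
      linarith
    have e2 : 27 / 64 + (3 / 4 - s) / 20 ≤ s ^ 2 * (3 - 3 * s) := by
      nlinarith [mul_nonneg (sub_nonneg.2 h) (sub_nonneg.2 hs1), mul_nonneg (mul_nonneg (sub_nonneg.2 h) (sub_nonneg.2 hs1)) hs0]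
    linarith

/-- The probability that `k₁ ξ₁ + k₂ ξ₂ + k₃ ξ₃ ≥ 1` for independent Bernoulli variables `ξᵢ` of
parameters `pᵢ`. -/
noncomputable def bernTail (k l j p q r : ℝ) : ℝ :=
  p * (1 - q) * (1 - r) * (if 1 ≤ k then 1 else 0) +
  (1 - p) * q * (1 - r) * (if 1 ≤ l then 1 else 0) +
  (1 - p) * (1 - q) * r * (if 1 ≤ j then 1 else 0) +
  p * q * (1 - r) * (if 1 ≤ k + l then 1 else 0) +
  p * (1 - q) * r * (if 1 ≤ k + j then 1 else 0) +
  (1 - p) * q * r * (if 1 ≤ l + j then 1 else 0) +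
  p * q * r * (if 1 ≤ k + l + j then 1 else 0)

lemma bernTail_swap_left (k l j p q r : ℝ) : bernTail k l j p q r = bernTail l k j q p r := by
  unfold bernTail
  rw [add_comm l k]
  ring

lemma bernTail_swap_right (k l j p q r : ℝ) : bernTail k l j p q r = bernTail k j l p r q := by
  unfold bernTail
  rw [add_comm j l, add_right_comm k j l]
  ring

lemma bernTail_le_of_sorted {k l j p q r : ℝ} (hp : 0 ≤ p) (hq : 0 ≤ q) (hr : 0 ≤ r)
    (hq1 : q ≤ 1) (hr1 : r ≤ 1) (hkl : l ≤ k) (hlj : j ≤ l) (hj : 0 ≤ j) (hj1 : j < 1)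
    (h1 : 2 * (k * p) + l * q + j * r ≤ 1001 / 1000)
    (h2 : k * p + 2 * (l * q) + j * r ≤ 1001 / 1000)
    (h3 : k * p + l * q + 2 * (j * r) ≤ 1001 / 1000) :
    bernTail k l j p q r ≤ 57 / 100 := by
  have hjr := mul_nonneg hj hr
  have hlq := mul_nonneg (hj.trans hlj) hq
  have hkp := mul_nonneg (hj.trans (hlj.trans hkl)) hp
  unfold bernTail
  rw [if_neg (by linarith : ¬ 1 ≤ j)]
  rcases le_or_gt 1 k with hk1 | hk1
  · rw [if_pos hk1, if_pos (by linarith : 1 ≤ k + l), if_pos (by linarith : 1 ≤ k + j),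
      if_pos (by linarith : 1 ≤ k + l + j)]
    have hpk : p ≤ k * p := by nlinarith
    rcases le_or_gt 1 l with hl1 | hl1
    · rw [if_pos hl1, if_pos (by linarith : 1 ≤ l + j)]
      have hql : q ≤ l * q := by nlinarith
      have := two_singles_bound hp hq (by linarith) (by linarith)
      linarith
    · rw [if_neg (by linarith : ¬ 1 ≤ l)]
      have key : p + (1 - p) * (q * r) * (if 1 ≤ l + j then 1 else 0) ≤ 57 / 100 := by
        split_ifs with h
        · have hjr' : (1 - l) * r ≤ j * r := by nlinarith
          have := one_single_pair_bound (k := l) hp hq hr hq1 hr1 (by linarith) hl1.le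
            (by linarith) (by linarith)
          linarith
        · linarith
      linarith
  · rw [if_neg (by linarith : ¬ 1 ≤ k), if_neg (by linarith : ¬ 1 ≤ l)]
    by_cases h23 : 1 ≤ l + j
    · rw [if_pos h23, if_pos (by linarith : 1 ≤ k + l), if_pos (by linarith : 1 ≤ k + j),
        if_pos (by linarith : 1 ≤ k + l + j)]
      have e1 : (1 - l) * r ≤ j * r := by nlinarith
      have e2 : l * p ≤ k * p := by nlinarith
      have := triangle_bound (a := p) (b := q) (c := r) (k := 1 - l) hp hq hr hr1 (by linarith)
        (by linarith) (by linarith) (by linarith)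
      linarith
    rw [if_neg h23]
    by_cases h13 : 1 ≤ k + j
    · rw [if_pos h13, if_pos (by linarith : 1 ≤ k + l), if_pos (by linarith : 1 ≤ k + l + j)]
      have e1 : (1 - k) * r ≤ j * r := by nlinarith
      have e2 : (1 - k) * q ≤ l * q := by nlinarith
      have := star_bound (a := p) (b := q) (c := r) (k := k) hp hq hr hq1 hr1 (by linarith)
        (by linarith) (by linarith)
      linarith
    rw [if_neg h13]
    by_cases h12 : 1 ≤ k + l
    · rw [if_pos h12, if_pos (by linarith : 1 ≤ k + l + j)]
      have e2 : (1 - k) * q ≤ l * q := by nlinarith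
      have := star_bound (a := p) (b := q) (c := 0) (k := k) hp hq le_rfl hq1 zero_le_one
        (by linarith) (by linarith) (by linarith)
      linarith
    rw [if_neg h12]
    split_ifs with h
    · have := triple_bound (a := p) (b := q) (c := r) hp hq hr hq1 hr1 (by linarith) hj hkl hlj h
        (by linarith)
      linarith
    · linarith

lemma bernTail_le {k l j p q r : ℝ} (hp : 0 ≤ p) (hq : 0 ≤ q) (hr : 0 ≤ r) (hp1 : p ≤ 1)
    (hq1 : q ≤ 1) (hr1 : r ≤ 1) (hk : 0 ≤ k) (hl : 0 ≤ l) (hj : 0 ≤ j)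
    (hlt : k < 1 ∨ l < 1 ∨ j < 1)
    (h1 : 2 * (k * p) + l * q + j * r ≤ 1001 / 1000)
    (h2 : k * p + 2 * (l * q) + j * r ≤ 1001 / 1000)
    (h3 : k * p + l * q + 2 * (j * r) ≤ 1001 / 1000) :
    bernTail k l j p q r ≤ 57 / 100 := by
  rcases le_total l k with a | a <;> rcases le_total j l with b | b <;> rcases le_total j k with c | c
  · exact bernTail_le_of_sorted hp hq hr hq1 hr1 a b hj (by grind) h1 h2 h3
  · exact bernTail_le_of_sorted hp hq hr hq1 hr1 a b hj (by grind) h1 h2 h3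
  · rw [bernTail_swap_right]
    exact bernTail_le_of_sorted hp hr hq hr1 hq1 c b hl (by grind) (by linarith) (by linarith)
      (by linarith)
  · rw [bernTail_swap_right, bernTail_swap_left]
    exact bernTail_le_of_sorted hr hp hq hp1 hq1 c a hl (by grind) (by linarith) (by linarith)
      (by linarith)
  · rw [bernTail_swap_left]
    exact bernTail_le_of_sorted hq hp hr hp1 hr1 a c hj (by grind) (by linarith) (by linarith)
      (by linarith)
  · rw [bernTail_swap_left, bernTail_swap_right]
    exact bernTail_le_of_sorted hq hr hp hr1 hp1 b c hk (by grind) (by linarith) (by linarith)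
      (by linarith)
  · rw [bernTail_swap_left, bernTail_swap_right, bernTail_swap_left]
    exact bernTail_le_of_sorted hr hq hp hq1 hp1 b a hk (by grind) (by linarith) (by linarith)
      (by linarith)
  · rw [bernTail_swap_left, bernTail_swap_right, bernTail_swap_left]
    exact bernTail_le_of_sorted hr hq hp hq1 hp1 b a hk (by grind) (by linarith) (by linarith)
      (by linarith)

lemma bernTail_of_one_le {k l j p q r : ℝ} (hk : 1 ≤ k) (hl : 1 ≤ l) (hj : 1 ≤ j) :
    bernTail k l j p q r = 1 - (1 - p) * (1 - q) * (1 - r) := by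
  unfold bernTail
  rw [if_pos hk, if_pos hl, if_pos hj, if_pos (by linarith), if_pos (by linarith),
    if_pos (by linarith), if_pos (by linarith)]
  ring

lemma all_singles_stability {g p q r : ℝ} (hg : 0 ≤ g) (hg1 : g ≤ 1 / 10000)
    (hp : 0 ≤ p) (hq : 0 ≤ q) (hr : 0 ≤ r)
    (h1 : 2 * p + q + r ≤ 1 + 5 * g) (h2 : p + 2 * q + r ≤ 1 + 5 * g)
    (h3 : p + q + 2 * r ≤ 1 + 5 * g)
    (h : 37 / 64 - g ≤ 1 - (1 - p) * (1 - q) * (1 - r)) : 3 / 4 - 120 * g ≤ p + q + r := by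
  obtain ⟨L, hL⟩ : ∃ L, L = (1 + 5 * g)⁻¹ := ⟨_, rfl⟩
  have hL0 : 0 < L := by rw [hL]; positivity
  have hLg : L * (1 + 5 * g) = 1 := by rw [hL]; field_simp
  have hL1 : L ≤ 1 := by nlinarith
  have hL2 : 1 - 5 * g ≤ L := by nlinarith
  have key := all_singles_bound (p := L * p) (q := L * q) (r := L * r) (by positivity)
    (by positivity) (by positivity) (by nlinarith) (by nlinarith) (by nlinarith)
  have e1 : L * p ≤ p := by nlinarith
  have e2 : L * q ≤ q := by nlinarith
  have e3 : L * r ≤ r := by nlinarith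
  have f1 : (1 - L) * (p + q + r) ≤ 5 * g := by
    have : (1 - L) * (p + q + r) ≤ 5 * g * (p + q + r) := by gcongr; linarith
    nlinarith
  have key2 : (1 - L * p) * (1 - L * q) * (1 - L * r) ≤
      (1 - p) * (1 - q) * (1 - r) + (1 - L) * (p + q + r) := by
    have a1 : 0 ≤ L * p := by positivity
    have a2 : 0 ≤ L * q := by positivity
    have a3 : 0 ≤ L * r := by positivity
    have hp1 : p ≤ 1 := by linarith
    have hq1 : q ≤ 1 := by linarith
    have hr1 : r ≤ 1 := by linarith
    have lip : ∀ x y c : ℝ, y ≤ x → c ≤ 1 → (1 - y) * c ≤ (1 - x) * c + (x - y) := by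
      intro x y c hxy hc
      nlinarith [mul_nonneg (sub_nonneg.2 hxy) (sub_nonneg.2 hc)]
    have b1 := lip _ _ _ e1 (mul_le_one₀ (by linarith : 1 - L * q ≤ 1)
      (by linarith : 0 ≤ 1 - L * r) (by linarith))
    have b2 := lip _ _ _ e2 (mul_le_one₀ (by linarith : 1 - p ≤ 1)
      (by linarith : 0 ≤ 1 - L * r) (by linarith))
    have b3 := lip _ _ _ e3 (mul_le_one₀ (by linarith : 1 - p ≤ 1)
      (by linarith : 0 ≤ 1 - q) (by linarith))
    linarith
  linarith

/-- The expectation of `h` under the distribution with mass `1 - p` at `a` and `p` at `b`. -/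
def twoPt (p a b : ℝ) (h : ℝ → ℝ) : ℝ := (1 - p) * h a + p * h b

lemma twoPt_stability {g m a₁ a₂ a₃ b₁ b₂ b₃ p₁ p₂ p₃ : ℝ} (hg : 0 ≤ g) (hg1 : g ≤ 1 / 10000)
    (hm : m ≤ (1 + g) / 4)
    (ha₁ : 0 ≤ a₁) (ha₂ : 0 ≤ a₂) (ha₃ : 0 ≤ a₃) (ham₁ : a₁ ≤ m) (ham₂ : a₂ ≤ m) (ham₃ : a₃ ≤ m)
    (hb₁ : m ≤ b₁) (hb₂ : m ≤ b₂) (hb₃ : m ≤ b₃)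
    (hp₁ : 0 ≤ p₁) (hp₂ : 0 ≤ p₂) (hp₃ : 0 ≤ p₃) (hq₁ : p₁ ≤ 1) (hq₂ : p₂ ≤ 1) (hq₃ : p₃ ≤ 1)
    (e₁ : (1 - p₁) * a₁ + p₁ * b₁ = m) (e₂ : (1 - p₂) * a₂ + p₂ * b₂ = m)
    (e₃ : (1 - p₃) * a₃ + p₃ * b₃ = m)
    (h : 37 / 64 - g ≤ twoPt p₁ a₁ b₁ fun x => twoPt p₂ a₂ b₂ fun y => twoPt p₃ a₃ b₃ fun z =>
      if 1 ≤ x + y + z then 1 else 0) :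
    p₁ ≤ 1 / 4 + 125 * g ∧ p₂ ≤ 1 / 4 + 125 * g ∧ a₁ + a₂ ≤ 500 * g := by
  obtain ⟨d, hd⟩ : ∃ d, d = 1 - (a₁ + a₂ + a₃) := ⟨_, rfl⟩
  have hd0 : 0 < d := by rw [hd]; linarith
  have hite : ∀ x y : ℝ, (1 ≤ x ↔ 1 ≤ y / d) →
      (if 1 ≤ x then (1 : ℝ) else 0) = if 1 ≤ y / d then 1 else 0 := fun x y hxy => by simp only [hxy]
  have hP : (twoPt p₁ a₁ b₁ fun x => twoPt p₂ a₂ b₂ fun y => twoPt p₃ a₃ b₃ fun z =>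
      if 1 ≤ x + y + z then (1 : ℝ) else 0) =
      bernTail ((b₁ - a₁) / d) ((b₂ - a₂) / d) ((b₃ - a₃) / d) p₁ p₂ p₃ := by
    simp only [twoPt, bernTail, ← add_div]
    rw [if_neg (by linarith : ¬ 1 ≤ a₁ + a₂ + a₃)]
    rw [hite (b₁ + a₂ + a₃) (b₁ - a₁), hite (a₁ + b₂ + a₃) (b₂ - a₂),
      hite (a₁ + a₂ + b₃) (b₃ - a₃), hite (b₁ + b₂ + a₃) (b₁ - a₁ + (b₂ - a₂)),
      hite (b₁ + a₂ + b₃) (b₁ - a₁ + (b₃ - a₃)), hite (a₁ + b₂ + b₃) (b₂ - a₂ + (b₃ - a₃)),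
      hite (b₁ + b₂ + b₃) (b₁ - a₁ + (b₂ - a₂) + (b₃ - a₃))]
    · ring
    all_goals
      rw [le_div_iff₀ hd0, hd]
      constructor <;> intro <;> linarith
  rw [hP] at h
  have r₁ : (b₁ - a₁) / d * p₁ = (m - a₁) / d := by rw [← e₁]; ring
  have r₂ : (b₂ - a₂) / d * p₂ = (m - a₂) / d := by rw [← e₂]; ring
  have r₃ : (b₃ - a₃) / d * p₃ = (m - a₃) / d := by rw [← e₃]; ring
  have hR : d * (1 - ((m - a₁) / d + (m - a₂) / d + (m - a₃) / d)) = 1 - 3 * m := by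
    field_simp; rw [hd]; ring
  have hr : ∀ a, 0 ≤ a → (m - a) / d + ((m - a₁) / d + (m - a₂) / d + (m - a₃) / d) ≤ 1 + 5 * g := by
    intro a ha
    have : (m - a) / d ≤ (1 + 5 * g) * (1 - ((m - a₁) / d + (m - a₂) / d + (m - a₃) / d)) := by
      rw [div_le_iff₀ hd0]
      have : (1 + 5 * g) * (1 - ((m - a₁) / d + (m - a₂) / d + (m - a₃) / d)) * d
        = (1 + 5 * g) * (1 - 3 * m) := by rw [← hR]; ring
      rw [this]
      nlinarith
    have h0 : 0 ≤ (m - a₁) / d + (m - a₂) / d + (m - a₃) / d := by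
      have := div_nonneg (sub_nonneg.2 ham₁) hd0.le
      have := div_nonneg (sub_nonneg.2 ham₂) hd0.le
      have := div_nonneg (sub_nonneg.2 ham₃) hd0.le
      linarith
    nlinarith
  have s₁ := hr a₁ ha₁
  have s₂ := hr a₂ ha₂
  have s₃ := hr a₃ ha₃
  rw [← r₁, ← r₂, ← r₃] at s₁ s₂ s₃ hR
  have k₁ : 0 ≤ (b₁ - a₁) / d := div_nonneg (by linarith) hd0.le
  have k₂ : 0 ≤ (b₂ - a₂) / d := div_nonneg (by linarith) hd0.le
  have k₃ : 0 ≤ (b₃ - a₃) / d := div_nonneg (by linarith) hd0.le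
  clear hP hr r₁ r₂ r₃ hite
  generalize (b₁ - a₁) / d = k at *
  generalize (b₂ - a₂) / d = l at *
  generalize (b₃ - a₃) / d = j at *
  by_cases hlt : k < 1 ∨ l < 1 ∨ j < 1
  · have := bernTail_le hp₁ hp₂ hp₃ hq₁ hq₂ hq₃ k₁ k₂ k₃ hlt (by linarith) (by linarith)
      (by linarith)
    linarith
  push Not at hlt
  obtain ⟨hk, hl, hj⟩ := hlt
  rw [bernTail_of_one_le hk hl hj] at h
  have t₁ : p₁ ≤ k * p₁ := le_mul_of_one_le_left hp₁ hk
  have t₂ : p₂ ≤ l * p₂ := le_mul_of_one_le_left hp₂ hl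
  have t₃ : p₃ ≤ j * p₃ := le_mul_of_one_le_left hp₃ hj
  have key := all_singles_stability hg hg1 hp₁ hp₂ hp₃ (by linarith) (by linarith) (by linarith) h
  refine ⟨by linarith, by linarith, ?_⟩
  have : d * (1 / 4 + 120 * g) ≥ 1 - 3 * m := by
    rw [← hR]
    gcongr
    linarith
  by_contra hcon
  push Not at hcon
  have : d * (1 / 4 + 120 * g) ≤ (1 - 500 * g) * (1 / 4 + 120 * g) := by
    gcongr
    linarith
  nlinarith

/-- Among all distributions of the values of `u` with the same mean, the expectation of `h` is
dominated by a two-point one. -/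
lemma exists_twoPt_le {V : Type*} [Fintype V] [Nonempty V] (u : V → ℝ) (h : ℝ → ℝ) (m : ℝ)
    (hm : ∑ v, u v = Fintype.card V * m) :
    ∃ (a b : V) (p : ℝ), u a ≤ m ∧ m ≤ u b ∧ 0 ≤ p ∧ p ≤ 1 ∧ (1 - p) * u a + p * u b = m ∧
      ∑ v, h (u v) ≤ Fintype.card V * twoPt p (u a) (u b) h := by
  classical
  have hn : (0 : ℝ) < Fintype.card V := by exact_mod_cast Fintype.card_pos
  obtain ⟨θ, hθ⟩ : ∃ θ, Fintype.card V * θ = ∑ v, h (u v) :=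
    ⟨(∑ v, h (u v)) / Fintype.card V, by field_simp⟩
  have hsum0 : ∑ v, (h (u v) - θ) = 0 := by
    rw [sum_sub_distrib, ← hθ]; simp
  have hsum1 : ∑ v, (u v - m) = 0 := by
    rw [sum_sub_distrib, hm]; simp
  by_contra hcon
  push Not at hcon
  have hlow : ∀ a b, u a ≤ m → m < u b →
      (u b - m) * (h (u a) - θ) + (m - u a) * (h (u b) - θ) < 0 := by
    intro a b hab hb
    have hba : 0 < u b - u a := by linarith
    have := hcon a b ((m - u a) / (u b - u a)) hab hb.le (div_nonneg (by linarith) hba.le)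
      ((div_le_one hba).2 (by linarith)) (by field_simp; ring)
    rw [← hθ] at this
    have := lt_of_mul_lt_mul_left this hn.le
    have h2 : twoPt ((m - u a) / (u b - u a)) (u a) (u b) h * (u b - u a) =
        (u b - m) * h (u a) + (m - u a) * h (u b) := by
      unfold twoPt; field_simp; ring
    nlinarith
  have heq : ∀ a, u a = m → h (u a) < θ := by
    intro a ha
    have := hcon a a 0 ha.le ha.ge le_rfl zero_le_one (by simp [ha])
    rw [← hθ] at this
    have := lt_of_mul_lt_mul_left this hn.le
    simpa [twoPt] using this
  have hA : ∑ v with u v ≤ m, (m - u v) = ∑ v with ¬ u v ≤ m, (u v - m) := by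
    rw [← sum_filter_add_sum_filter_not univ (fun v => u v ≤ m)] at hsum1
    have : ∑ v with u v ≤ m, (m - u v) = - ∑ v with u v ≤ m, (u v - m) := by
      rw [← sum_neg_distrib]; simp
    linarith
  by_cases hne : ∃ b, m < u b
  · obtain ⟨b₀, hb₀⟩ := hne
    have hS : 0 < ∑ v with ¬ u v ≤ m, (u v - m) := by
      apply sum_pos
      · intro i hi; simp at hi; linarith
      · exact ⟨b₀, by simpa using hb₀⟩
    have hneA : (univ.filter fun v => u v ≤ m).Nonempty := by
      by_contra hc
      rw [not_nonempty_iff_eq_empty] at hc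
      rw [hc] at hA; simp at hA; simp at hS; linarith
    have hneB : (univ.filter fun v => ¬ u v ≤ m).Nonempty := ⟨b₀, by simpa using hb₀⟩
    have : ∑ a with u a ≤ m, ∑ b with ¬ u b ≤ m,
        ((u b - m) * (h (u a) - θ) + (m - u a) * (h (u b) - θ)) < 0 := by
      apply sum_neg _ hneA
      intro a ha
      apply sum_neg _ hneB
      intro b hb
      simp at ha hb
      exact hlow a b ha hb
    simp only [sum_add_distrib, ← sum_mul, ← mul_sum] at this
    rw [hA, ← mul_add, sum_filter_add_sum_filter_not, hsum0] at this
    simp at this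
  · push Not at hne
    have hall : ∀ a, u a = m := by
      have h0 : ∑ v, (m - u v) = 0 := by
        rw [← neg_eq_zero, ← sum_neg_distrib]; simpa using hsum1
      rw [sum_eq_zero_iff_of_nonneg (fun i _ => by linarith [hne i])] at h0
      intro a; linarith [h0 a (mem_univ a)]
    have : ∑ v, (h (u v) - θ) < 0 :=
      sum_neg (fun a _ => by linarith [heq a (hall a)]) univ_nonempty
    linarith

/-- If three independent copies of a nonnegative variable of mean about `1/4` have sum at least `1`
with probability about `37/64`, the variable is close to the indicator of an event of probability
`1/4`. -/
lemma three_sum_stability {V : Type*} [Fintype V] [Nonempty V] {u : V → ℝ} (hu : ∀ v, 0 ≤ u v)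
    {g : ℝ} (hg : 0 ≤ g) (hg1 : g ≤ 1 / 10000)
    (hsum : ∑ v, u v ≤ Fintype.card V * ((1 + g) / 4))
    (hcount : (37 / 64 - g) * (Fintype.card V : ℝ) ^ 3 ≤
      ∑ b, ∑ c, ∑ d, if 1 ≤ u b + u c + u d then (1 : ℝ) else 0) :
    Fintype.card V * (1 / 4 - 550 * g) ≤ ∑ v, u v ∧
      (#{v | 1 / 16 ≤ u v} : ℝ) ≤ (1 / 4 + 10000 * g) * Fintype.card V := by
  classical
  have hn : (0 : ℝ) < Fintype.card V := by exact_mod_cast Fintype.card_pos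
  generalize hnn : (Fintype.card V : ℝ) = n at *
  obtain ⟨m, hm⟩ : ∃ m, ∑ v, u v = n * m := ⟨(∑ v, u v) / n, by field_simp⟩
  have hm1 : m ≤ (1 + g) / 4 := by rw [hm] at hsum; exact le_of_mul_le_mul_left hsum hn
  obtain ⟨a₁, b₁, p₁, ha₁, hb₁, hp₁, hq₁, e₁, h₁⟩ := exists_twoPt_le u
    (fun x => ∑ c, ∑ d, if 1 ≤ x + u c + u d then (1 : ℝ) else 0) m (by rw [hnn, hm])
  obtain ⟨a₂, b₂, p₂, ha₂, hb₂, hp₂, hq₂, e₂, h₂⟩ := exists_twoPt_le u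
    (fun y => twoPt p₁ (u a₁) (u b₁) fun x => ∑ d, if 1 ≤ x + y + u d then (1 : ℝ) else 0) m
    (by rw [hnn, hm])
  obtain ⟨a₃, b₃, p₃, ha₃, hb₃, hp₃, hq₃, e₃, h₃⟩ := exists_twoPt_le u
    (fun z => twoPt p₁ (u a₁) (u b₁) fun x => twoPt p₂ (u a₂) (u b₂) fun y =>
      if 1 ≤ x + y + z then (1 : ℝ) else 0) m (by rw [hnn, hm])
  rw [hnn] at h₁ h₂ h₃
  have c₂ : ∑ v, (twoPt p₁ (u a₁) (u b₁) fun x => ∑ d, if 1 ≤ x + u v + u d then (1 : ℝ) else 0) =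
      twoPt p₁ (u a₁) (u b₁) fun x => ∑ c, ∑ d, if 1 ≤ x + u c + u d then (1 : ℝ) else 0 := by
    simp only [twoPt, sum_add_distrib, ← mul_sum]
  have c₃ : ∑ v, (twoPt p₁ (u a₁) (u b₁) fun x => twoPt p₂ (u a₂) (u b₂) fun y =>
      if 1 ≤ x + y + u v then (1 : ℝ) else 0) =
      twoPt p₂ (u a₂) (u b₂) fun y => twoPt p₁ (u a₁) (u b₁) fun x => ∑ d,
      if 1 ≤ x + y + u d then (1 : ℝ) else 0 := by
    simp only [twoPt, sum_add_distrib, ← mul_sum]; ring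
  have hΦ : (37 / 64 - g) * n ≤ ∑ v, (twoPt p₁ (u a₁) (u b₁) fun x => twoPt p₂ (u a₂) (u b₂) fun y =>
      if 1 ≤ x + y + u v then (1 : ℝ) else 0) := by
    rw [c₃]
    rw [c₂] at h₂
    have : n ^ 2 * ((37 / 64 - g) * n) ≤ n ^ 2 * (twoPt p₂ (u a₂) (u b₂) fun y => twoPt p₁ (u a₁) (u b₁) fun x => ∑ d,
      if 1 ≤ x + y + u d then (1 : ℝ) else 0) := by
      calc _ = (37 / 64 - g) * n ^ 3 := by ring
        _ ≤ _ := hcount.trans h₁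
        _ ≤ n * _ := mul_le_mul_of_nonneg_left h₂ hn.le
        _ = _ := by ring
    exact le_of_mul_le_mul_left this (by positivity)
  have hP : 37 / 64 - g ≤ twoPt p₁ (u a₁) (u b₁) fun x => twoPt p₂ (u a₂) (u b₂) fun y =>
      twoPt p₃ (u a₃) (u b₃) fun z => if 1 ≤ x + y + z then 1 else 0 := by
    have : n * (37 / 64 - g) ≤ n * (twoPt p₁ (u a₁) (u b₁) fun x => twoPt p₂ (u a₂) (u b₂) fun y =>
      twoPt p₃ (u a₃) (u b₃) fun z => if 1 ≤ x + y + z then 1 else 0) := by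
      rw [mul_comm n (37 / 64 - g)]
      refine (hΦ.trans h₃).trans_eq ?_
      simp only [twoPt]; ring
    exact le_of_mul_le_mul_left this hn
  obtain ⟨l₁, l₂, l₃⟩ := twoPt_stability hg hg1 hm1 (hu _) (hu _) (hu _) ha₁ ha₂ ha₃ hb₁ hb₂ hb₃
    hp₁ hp₂ hp₃ hq₁ hq₂ hq₃ e₁ e₂ e₃ hP
  obtain ⟨ρ, hρ⟩ : ∃ ρ : ℝ, (#{v | 1 - 500 * g ≤ u v} : ℝ) = n * ρ :=
    ⟨_ / n, (mul_div_cancel₀ _ hn.ne').symm⟩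
  obtain ⟨σ, hσ⟩ : ∃ σ : ℝ, (#{v | 1 / 16 ≤ u v} : ℝ) = n * σ :=
    ⟨_ / n, (mul_div_cancel₀ _ hn.ne').symm⟩
  have hρ0 : 0 ≤ ρ := by
    have : 0 ≤ n * ρ := by rw [← hρ]; positivity
    exact nonneg_of_mul_nonneg_right this hn
  have hΦ2 : 37 / 64 - g ≤ 1 - (1 - p₁) * (1 - p₂) + (1 - p₁) * (1 - p₂) * ρ := by
    have : n * (37 / 64 - g) ≤ n * (1 - (1 - p₁) * (1 - p₂) + (1 - p₁) * (1 - p₂) * ρ) := by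
      calc _ = (37 / 64 - g) * n := by ring
        _ ≤ _ := hΦ
        _ ≤ ∑ v, (1 - (1 - p₁) * (1 - p₂) + (1 - p₁) * (1 - p₂) *
            if 1 - 500 * g ≤ u v then 1 else 0) := by
          apply sum_le_sum
          intro v _
          have i1 : ∀ x y : ℝ, (if 1 ≤ x + y + u v then (1 : ℝ) else 0) ≤ 1 := by
            intro x y; split_ifs <;> norm_num
          have i2 : (if 1 ≤ u a₁ + u a₂ + u v then (1 : ℝ) else 0) ≤
              if 1 - 500 * g ≤ u v then 1 else 0 := by
            split_ifs <;> linarith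
          simp only [twoPt]
          have j₁ : 0 ≤ 1 - p₁ := by linarith
          have j₂ : 0 ≤ 1 - p₂ := by linarith
          have t1 := mul_le_mul_of_nonneg_left i2 (mul_nonneg j₁ j₂)
          have t2 := mul_le_mul_of_nonneg_left (i1 (u a₁) (u b₂)) (mul_nonneg j₁ hp₂)
          have t3 := mul_le_mul_of_nonneg_left (i1 (u b₁) (u a₂)) (mul_nonneg hp₁ j₂)
          have t4 := mul_le_mul_of_nonneg_left (i1 (u b₁) (u b₂)) (mul_nonneg hp₁ hp₂)
          linarith
        _ = _ := by
          rw [sum_add_distrib, ← mul_sum, sum_boole, hρ]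
          simp [hnn]; ring
    exact le_of_mul_le_mul_left this hn
  have hρ1 : 1 / 4 - 300 * g ≤ ρ := by
    have hπ : (3 / 4 - 125 * g) ^ 2 ≤ (1 - p₁) * (1 - p₂) := by
      rw [sq]; exact mul_le_mul (by linarith) (by linarith) (by linarith) (by linarith)
    by_contra hcon
    push Not at hcon
    have : (3 / 4 - 125 * g) ^ 2 * (1 - ρ) ≤ (1 - p₁) * (1 - p₂) * (1 - ρ) := by
      apply mul_le_mul_of_nonneg_right hπ; linarith
    have h4 : (3 / 4 - 125 * g) ^ 2 * (3 / 4 + 300 * g) ≤ (3 / 4 - 125 * g) ^ 2 * (1 - ρ) :=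
      mul_le_mul_of_nonneg_left (by linarith) (sq_nonneg _)
    have h5 : 27 / 64 + 2 * g ≤ (3 / 4 - 125 * g) ^ 2 * (3 / 4 + 300 * g) := by
      nlinarith [mul_nonneg hg (sub_nonneg.2 hg1), mul_nonneg (mul_nonneg hg hg) hg]
    have h6 : 37 / 64 - g ≤ 37 / 64 - 2 * g := by linarith
    have h7 : g ≤ 0 := by linarith
    have h8 : g = 0 := le_antisymm h7 hg
    subst h8
    nlinarith
  have hA : n * (ρ * (1 - 500 * g)) ≤ n * m := by
    rw [← hm, ← mul_assoc, ← hρ, ← nsmul_eq_mul]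
    refine le_trans ?_ (sum_le_univ_sum_of_nonneg hu (s := {v | 1 - 500 * g ≤ u v}))
    apply card_nsmul_le_sum
    intro v hv; simpa using hv
  have hB : n * (ρ * (1 - 500 * g) + (σ - ρ) / 16) ≤ n * m := by
    have : n * (ρ * (1 - 500 * g) + (σ - ρ) / 16) =
      ∑ v, ((if 1 - 500 * g ≤ u v then (1 : ℝ) else 0) * (1 - 500 * g - 1 / 16) +
        (if 1 / 16 ≤ u v then (1 : ℝ) else 0) * (1 / 16)) := by
      rw [sum_add_distrib, ← sum_mul, ← sum_mul, sum_boole, sum_boole, hρ, hσ]; ring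
    rw [this, ← hm]
    apply sum_le_sum
    intro v _
    have := hu v
    split_ifs <;> linarith
  have hA' := le_of_mul_le_mul_left hA hn
  have hB' := le_of_mul_le_mul_left hB hn
  constructor
  · rw [hm]
    refine mul_le_mul_of_nonneg_left ?_ hn.le
    nlinarith
  · rw [hσ, mul_comm]
    refine mul_le_mul_of_nonneg_right ?_ hn.le
    nlinarith

lemma three_sum_stability_scaled {V : Type*} [Fintype V] [Nonempty V] {u : V → ℝ}
    (hu : ∀ v, 0 ≤ u v) {γ q : ℝ} (hγ : 0 ≤ γ) (hγ1 : γ ≤ 1 / 20000) (hq : 0 < q)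
    (hsum : 4 * ∑ v, u v ≤ Fintype.card V * q)
    (hcount : (37 / 64 - 2 * γ) * (Fintype.card V : ℝ) ^ 3 ≤
      ∑ b, ∑ c, ∑ d, if (1 - γ) * q ≤ u b + u c + u d then (1 : ℝ) else 0) :
    Fintype.card V * ((1 - 20000 * γ) * q) ≤ 4 * ∑ v, u v ∧
      (#{v | q / 16 ≤ u v} : ℝ) ≤ (1 / 4 + 20000 * γ) * Fintype.card V := by
  obtain ⟨s, hs⟩ : ∃ s, s = (1 - γ) * q := ⟨_, rfl⟩
  have hs0 : 0 < s := by rw [hs]; apply mul_pos _ hq; linarith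
  have hsq : s ≤ q := by rw [hs]; nlinarith
  have hn : (0 : ℝ) < Fintype.card V := by exact_mod_cast Fintype.card_pos
  have key := three_sum_stability (u := fun v => u v / s) (g := 2 * γ)
    (fun v => div_nonneg (hu v) hs0.le) (by linarith) (by linarith) (by
      rw [← sum_div, div_le_iff₀ hs0, hs]
      have : q ≤ (1 + 2 * γ) * ((1 - γ) * q) := by nlinarith
      nlinarith) (by
      refine hcount.trans_eq ?_
      rw [← hs]
      refine sum_congr rfl fun b _ => sum_congr rfl fun c _ => sum_congr rfl fun d _ => ?_
      rw [← add_div, ← add_div]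
      simp only [one_le_div hs0])
  rw [← sum_div] at key
  constructor
  · have := key.1
    rw [le_div_iff₀ hs0] at this
    have h2 : (1 - 20000 * γ) * q ≤ 4 * ((1 / 4 - 550 * (2 * γ)) * s) := by rw [hs]; nlinarith
    nlinarith
  · have h2 : (#{v | q / 16 ≤ u v} : ℝ) ≤ (#{v | 1 / 16 ≤ u v / s} : ℝ) := by
      norm_cast
      refine card_le_card fun v hv => ?_
      simp only [mem_filter, mem_univ, true_and, le_div_iff₀ hs0] at hv ⊢
      linarith
    linarith [key.2]

lemma nonneg_of_forall_lt_add_mul {a b v : ℝ} (h : ∀ s : ℝ, 0 ≤ s → v < a + s * b) : 0 ≤ b := by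
  by_contra hb
  push Not at hb
  have h0 := h 0 le_rfl
  have := h ((v - a) / b) (div_nonneg_of_nonpos (by linarith) hb.le)
  rw [div_mul_cancel₀ _ hb.ne] at this
  linarith

/-- Duality for the maximum of a capped fractional packing whose overload is penalised. -/
lemma capped_packing_duality {E P : Type*} [Fintype E] [Fintype P] (a : E → P → ℝ) (c : E → ℝ)
    (hc : ∀ e, 0 ≤ c e) (T : ℝ) :
    (∃ f : E → ℝ, (∀ e, 0 ≤ f e ∧ f e ≤ c e) ∧
      T ≤ ∑ e, f e - ∑ p, max (∑ e, f e * a e p - 1) 0) ∨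
    ∃ w : P → ℝ, (∀ p, 0 ≤ w p ∧ w p ≤ 1) ∧
      ∑ p, w p + ∑ e, c e * max (1 - ∑ p, a e p * w p) 0 < T := by
  classical
  by_contra hcon
  push Not at hcon
  obtain ⟨h1, h2⟩ := hcon
  let A : (E → ℝ) →ₗ[ℝ] (P → ℝ) × ℝ :=
    { toFun := fun f => (fun p => ∑ e, f e * a e p, ∑ e, f e)
      map_add' := fun f g => by
        ext <;> simp [add_mul, sum_add_distrib]
      map_smul' := fun r f => by
        ext <;> simp [mul_sum, mul_assoc] }
  let t : Set ((P → ℝ) × ℝ) := {z | T + ∑ p, max (z.1 p - 1) 0 ≤ z.2}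
  have hs1 : Convex ℝ (A '' Set.Icc 0 c) := (convex_Icc _ _).linear_image A
  have hs2 : IsCompact (A '' Set.Icc 0 c) :=
    isCompact_Icc.image (LinearMap.continuous_of_finiteDimensional A)
  have ht1 : Convex ℝ t := by
    intro x hx y hy α β hα hβ hαβ
    simp only [t, Set.mem_ofPred_eq] at hx hy ⊢
    have : ∑ p, max ((α • x + β • y).1 p - 1) 0 ≤
        α * ∑ p, max (x.1 p - 1) 0 + β * ∑ p, max (y.1 p - 1) 0 := by
      rw [mul_sum, mul_sum, ← sum_add_distrib]
      apply sum_le_sum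
      intro p _
      apply max_le
      · have e1 := mul_le_mul_of_nonneg_left (le_max_left (x.1 p - 1) 0) hα
        have e2 := mul_le_mul_of_nonneg_left (le_max_left (y.1 p - 1) 0) hβ
        simp only [Prod.fst_add, Prod.smul_fst, Pi.add_apply, Pi.smul_apply, smul_eq_mul]
        linarith
      · positivity
    have e1 := mul_le_mul_of_nonneg_left hx hα
    have e2 := mul_le_mul_of_nonneg_left hy hβ
    have e3 : α * T + β * T = T := by rw [← add_mul, hαβ, one_mul]
    simp only [Prod.snd_add, Prod.smul_snd, smul_eq_mul]
    linarith
  have ht2 : IsClosed t := by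
    apply isClosed_le <;> fun_prop
  have hdis : Disjoint (A '' Set.Icc 0 c) t := by
    rw [Set.disjoint_left]
    rintro _ ⟨f, hf, rfl⟩ hmem
    simp only [t, Set.mem_ofPred_eq] at hmem
    have := h1 f (fun e => ⟨hf.1 e, hf.2 e⟩)
    simp only [A, LinearMap.coe_mk, AddHom.coe_mk] at hmem
    linarith
  obtain ⟨φ, u, v, hu, huv, hv⟩ := geometric_hahn_banach_compact_closed hs1 hs2 ht1 ht2 hdis
  obtain ⟨κ, hκ⟩ : ∃ κ, κ = φ (0, 1) := ⟨_, rfl⟩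
  obtain ⟨y, hy⟩ : ∃ y : P → ℝ, y = fun p => φ (Pi.single p 1, 0) := ⟨_, rfl⟩
  have hφ : ∀ ℓ τ, φ (ℓ, τ) = ∑ p, ℓ p * y p + τ * κ := by
    intro ℓ τ
    have e : ((ℓ, τ) : (P → ℝ) × ℝ) = ∑ p, ℓ p • ((Pi.single p 1, 0) : (P → ℝ) × ℝ) + τ • (0, 1) := by
      ext q
      · simp [Prod.fst_sum, Finset.sum_apply, Pi.single_apply]
      · simp [Prod.snd_sum]
    rw [e, map_add, map_sum, map_smul, hκ, hy]
    simp only [map_smul, smul_eq_mul]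
  have hv' : ∀ (ℓ : P → ℝ) τ, T + ∑ p, max (ℓ p - 1) 0 ≤ τ → v < ∑ p, ℓ p * y p + τ * κ := by
    intro ℓ τ h
    rw [← hφ]; exact hv _ h
  have hu' : ∀ f : E → ℝ, (∀ e, 0 ≤ f e ∧ f e ≤ c e) →
      ∑ p, (∑ e, f e * a e p) * y p + (∑ e, f e) * κ < u := by
    intro f hf
    rw [← hφ]; exact hu _ ⟨f, ⟨fun e => (hf e).1, fun e => (hf e).2⟩, rfl⟩
  have hsq : ∀ (q : P) (s : ℝ), ∑ p, (1 + s * (Pi.single q 1 : P → ℝ) p) * y p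
      = ∑ p, y p + s * y q := by
    intro q s
    simp only [add_mul, one_mul, sum_add_distrib, mul_assoc, ← mul_sum]
    simp [Pi.single_apply]
  have hκ0 : 0 ≤ κ := by
    apply nonneg_of_forall_lt_add_mul (a := ∑ p, 1 * y p + T * κ) (v := v)
    intro s hs
    have := hv' (fun _ => 1) (T + s) (by simpa using hs)
    linarith
  have hyκ : ∀ q, 0 ≤ y q + κ := by
    intro q
    apply nonneg_of_forall_lt_add_mul (a := ∑ p, y p + T * κ) (v := v)
    intro s hs
    have := hv' (fun p => 1 + s * (Pi.single q 1 : P → ℝ) p) (T + s) (by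
      have : ∑ p, max (1 + s * (Pi.single q 1 : P → ℝ) p - 1) 0 = s := by
        rw [sum_eq_single q]
        · simp [hs]
        · intro b _ hb; simp [hb]
        · simp
      rw [this])
    rw [hsq] at this
    linarith
  have hy0 : ∀ q, 0 ≤ - y q := by
    intro q
    apply nonneg_of_forall_lt_add_mul (a := ∑ p, y p + T * κ) (v := v)
    intro s hs
    have := hv' (fun p => 1 + (-s) * (Pi.single q 1 : P → ℝ) p) T (by
      have : ∑ p, max (1 + (-s) * (Pi.single q 1 : P → ℝ) p - 1) 0 = 0 := by
        apply sum_eq_zero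
        intro p _
        apply max_eq_right
        by_cases hp : p = q
        · subst hp; simp [hs]
        · simp [hp]
      rw [this, add_zero])
    rw [hsq] at this
    linarith
  have hκ1 : 0 < κ := by
    rcases hκ0.eq_or_lt with h | h
    · have hy' : y = 0 := by
        funext q
        have := hyκ q; have := hy0 q
        simp only [Pi.zero_apply]; linarith
      have b1 := hu' (fun _ => 0) (fun e => ⟨le_rfl, hc e⟩)
      have b2 := hv' (fun _ => 1) T (by simp)
      simp [hy', ← h] at b1 b2
      linarith
    · exact h
  have hfin := h2 (fun p => - y p / κ) (fun p => ⟨div_nonneg (hy0 p) hκ0, by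
    rw [div_le_one hκ1]; linarith [hyκ p]⟩)
  have b2 := hv' (fun _ => 1) T (by simp)
  have b1 := hu' (fun e => if 0 ≤ 1 - ∑ p, a e p * (- y p / κ) then c e else 0) (fun e => by
    split_ifs
    · exact ⟨hc e, le_rfl⟩
    · exact ⟨le_rfl, hc e⟩)
  have e1 : ∑ p, (∑ e, (if 0 ≤ 1 - ∑ p, a e p * (- y p / κ) then c e else 0) * a e p) * y p +
      (∑ e, (if 0 ≤ 1 - ∑ p, a e p * (- y p / κ) then c e else 0)) * κ =
      κ * ∑ e, c e * max (1 - ∑ p, a e p * (- y p / κ)) 0 := by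
    simp only [sum_mul]
    rw [sum_comm, ← sum_add_distrib, mul_sum]
    apply sum_congr rfl
    intro e _
    have e2 : ∑ p, a e p * y p = - κ * ∑ p, a e p * (- y p / κ) := by
      rw [mul_sum]; apply sum_congr rfl; intro p _; field_simp
    split_ifs with h
    · rw [max_eq_left h]
      simp only [mul_assoc, ← mul_sum]
      rw [e2]; ring
    · rw [max_eq_right (by linarith)]; simp
  rw [e1] at b1
  have e3 : ∑ p, - y p / κ = - (∑ p, y p) / κ := by rw [← sum_div, sum_neg_distrib]
  rw [e3] at hfin
  have e4 := mul_le_mul_of_nonneg_left hfin hκ0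
  have e5 : κ * (-(∑ p, y p) / κ) = -∑ p, y p := by field_simp
  simp only [one_mul] at b2
  rw [mul_add, e5] at e4
  linarith

lemma sum_fin_cons {V M : Type*} [Fintype V] [AddCommMonoid M] {k : ℕ} (F : (Fin (k + 1) → V) → M) :
    ∑ w, F w = ∑ v, ∑ z : Fin k → V, F (Fin.cons v z) := by
  rw [← (Fin.consEquiv fun _ : Fin (k + 1) => V).sum_comp, Fintype.sum_prod_type]
  rfl

lemma sum_fin_three {V M : Type*} [Fintype V] [AddCommMonoid M] (F : (Fin 3 → V) → M) :
    ∑ w, F w = ∑ b, ∑ c, ∑ d, F ![b, c, d] := by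
  simp_rw [sum_fin_cons (V := V)]
  simp only [univ_unique, sum_singleton]
  refine sum_congr rfl fun b _ => sum_congr rfl fun c _ => sum_congr rfl fun d _ => ?_
  congr

/-- A quantile of order `τ`. -/
lemma exists_quantile {V : Type*} [Fintype V] [Nonempty V] (w : V → ℝ) {τ : ℝ} (h0 : 0 ≤ τ)
    (h1 : τ ≤ 1) : ∃ v₀, τ * Fintype.card V ≤ #{v | w v ≤ w v₀} ∧
      (#{v | w v < w v₀} : ℝ) ≤ τ * Fintype.card V := by
  classical
  obtain ⟨vm, -, hvm⟩ := exists_max_image univ w univ_nonempty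
  have hne : ({v | τ * Fintype.card V ≤ (#{z | w z ≤ w v} : ℝ)} : Finset V).Nonempty := by
    refine ⟨vm, ?_⟩
    have : ({z | w z ≤ w vm} : Finset V) = univ := by
      ext z; simpa using hvm z (mem_univ z)
    simp only [mem_filter, mem_univ, true_and, this, card_univ]
    exact mul_le_of_le_one_left (by positivity) h1
  obtain ⟨v₀, hv₀, hmin⟩ := exists_min_image _ w hne
  simp only [mem_filter, mem_univ, true_and] at hv₀ hmin
  refine ⟨v₀, hv₀, ?_⟩
  rcases ({v | w v < w v₀} : Finset V).eq_empty_or_nonempty with h | h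
  · rw [h]; simp; positivity
  · obtain ⟨v₁, hv₁, hmax⟩ := exists_max_image _ w h
    simp only [mem_filter, mem_univ, true_and] at hv₁ hmax
    have hlt : ¬ τ * Fintype.card V ≤ (#{z | w z ≤ w v₁} : ℝ) := fun hc =>
      absurd (hmin v₁ hc) (by linarith)
    have hsub : univ.filter (fun v => w v < w v₀) ⊆ univ.filter fun z => w z ≤ w v₁ := by
      intro z hz
      simp only [mem_filter, mem_univ, true_and] at hz ⊢
      exact hmax z hz
    have : (#{v | w v < w v₀} : ℝ) ≤ #{z | w z ≤ w v₁} := by exact_mod_cast card_le_card hsub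
    linarith

open Classical in
/-- If few triples of `u`-weight at least `(1 - γ) q` exist, the penalty of the link is large. -/
lemma penalty_ge {V : Type*} [Fintype V] {u : V → ℝ} {γ q τ : ℝ}
    (hγ : 0 ≤ γ) (hq : 0 ≤ q) (R : (Fin 4 → V) → Prop)
    (hdeg : ∀ v, (37 / 64 - γ) * (Fintype.card V : ℝ) ^ 3 ≤ #{z : Fin 3 → V | R (Fin.cons v z)})
    (hlow : τ * Fintype.card V ≤ #{v | u v = 0})
    (hcount : (#{z : Fin 3 → V | (1 - γ) * q ≤ ∑ i, u (z i)} : ℝ) ≤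
      (37 / 64 - 2 * γ) * (Fintype.card V : ℝ) ^ 3) :
    τ * γ ^ 2 * q * (Fintype.card V : ℝ) ^ 4 ≤
      ∑ w : Fin 4 → V, if R w then max (q - ∑ i, u (w i)) 0 else 0 := by
  have hn0 : (0 : ℝ) ≤ Fintype.card V := by positivity
  generalize (Fintype.card V : ℝ) = n at *
  have hterm : ∀ w : Fin 4 → V, 0 ≤ if R w then max (q - ∑ i, u (w i)) 0 else 0 := by
    intro w; split_ifs
    · exact le_max_right _ _
    · exact le_rfl
  have hv : ∀ v, u v = 0 → γ * n ^ 3 * (γ * q) ≤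
      ∑ z : Fin 3 → V, if R (Fin.cons v z) then
        max (q - ∑ i, u ((Fin.cons v z : Fin 4 → V) i)) 0 else 0 := by
    intro v huv
    have h1 : γ * n ^ 3 ≤ (#{z : Fin 3 → V | R (Fin.cons v z) ∧ ¬ (1 - γ) * q ≤ ∑ i, u (z i)} : ℝ) := by
      have h2 : (#{z : Fin 3 → V | R (Fin.cons v z)} : ℝ) ≤
          #{z : Fin 3 → V | R (Fin.cons v z) ∧ ¬ (1 - γ) * q ≤ ∑ i, u (z i)} +
          #{z : Fin 3 → V | (1 - γ) * q ≤ ∑ i, u (z i)} := by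
        norm_cast
        refine (card_le_card ?_).trans (card_union_le _ _)
        intro z hz
        simp only [mem_filter, mem_univ, true_and, mem_union] at hz ⊢
        tauto
      have := hdeg v
      linarith
    calc γ * n ^ 3 * (γ * q) ≤
        #{z : Fin 3 → V | R (Fin.cons v z) ∧ ¬ (1 - γ) * q ≤ ∑ i, u (z i)} * (γ * q) :=
          mul_le_mul_of_nonneg_right h1 (by positivity)
      _ = ∑ z with R (Fin.cons v z) ∧ ¬ (1 - γ) * q ≤ ∑ i, u (z i), γ * q := by simp
      _ ≤ ∑ z with R (Fin.cons v z) ∧ ¬ (1 - γ) * q ≤ ∑ i, u (z i), if R (Fin.cons v z) then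
        max (q - ∑ i, u ((Fin.cons v z : Fin 4 → V) i)) 0 else 0 := by
          apply sum_le_sum
          intro z hz
          simp only [mem_filter, mem_univ, true_and] at hz
          rw [if_pos hz.1]
          refine le_trans ?_ (le_max_left _ _)
          rw [Fin.sum_univ_succ]
          simp only [Fin.cons_zero, Fin.cons_succ, huv]
          linarith [hz.2]
      _ ≤ _ := sum_le_univ_sum_of_nonneg fun z => hterm _
  rw [sum_fin_cons]
  calc τ * γ ^ 2 * q * n ^ 4 = (τ * n) * (γ * n ^ 3 * (γ * q)) := by ring
    _ ≤ #{v | u v = 0} * (γ * n ^ 3 * (γ * q)) := by gcongr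
    _ = ∑ v with u v = 0, γ * n ^ 3 * (γ * q) := by simp
    _ ≤ ∑ v with u v = 0, ∑ z : Fin 3 → V, if R (Fin.cons v z) then
        max (q - ∑ i, u ((Fin.cons v z : Fin 4 → V) i)) 0 else 0 := by
      apply sum_le_sum
      intro v hv'
      simp only [mem_filter, mem_univ, true_and] at hv'
      exact hv v hv'
    _ ≤ _ := sum_le_univ_sum_of_nonneg fun v => sum_nonneg fun z _ => hterm _

open Classical in
lemma link_stability {V : Type*} [Fintype V] [Nonempty V] {u : V → ℝ} (hu : ∀ v, 0 ≤ u v)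
    {γ q τ c : ℝ} (hγ : 0 ≤ γ) (hγ1 : γ ≤ 1 / 20000) (hq : 0 < q) (hc : 0 ≤ c)
    (R : (Fin 4 → V) → Prop)
    (hdeg : ∀ v, (37 / 64 - γ) * (Fintype.card V : ℝ) ^ 3 ≤ #{z : Fin 3 → V | R (Fin.cons v z)})
    (hlow : τ * Fintype.card V ≤ #{v | u v = 0})
    (hcτ : 1 ≤ c * (τ * γ ^ 2 * (Fintype.card V : ℝ) ^ 4))
    (hpen : c * (∑ w : Fin 4 → V, if R w then max (q - ∑ i, u (w i)) 0 else 0) < q)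
    (hsum : 4 * ∑ v, u v ≤ Fintype.card V * q) :
    Fintype.card V * ((1 - 20000 * γ) * q) ≤ 4 * ∑ v, u v ∧
      (#{v | q / 16 ≤ u v} : ℝ) ≤ (1 / 4 + 20000 * γ) * Fintype.card V := by
  apply three_sum_stability_scaled hu hγ hγ1 hq hsum
  by_contra hcon
  push Not at hcon
  have e : (∑ b, ∑ c, ∑ d, if (1 - γ) * q ≤ u b + u c + u d then (1 : ℝ) else 0) =
      #{z : Fin 3 → V | (1 - γ) * q ≤ ∑ i, u (z i)} := by
    rw [← sum_boole, sum_fin_three]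
    simp [Fin.sum_univ_three]
  rw [e] at hcon
  have := mul_le_mul_of_nonneg_left (penalty_ge hγ hq.le R hdeg hlow hcon.le) hc
  nlinarith

open Classical in
/-- The number of edges `(x, w)` all of whose `V`-vertices avoid `W` (as ordered tuples). -/
noncomputable def edgesAvoiding {X V : Type*} [Fintype X] [Fintype V] (R : X → (Fin 4 → V) → Prop)
    (W : Finset V) : ℕ :=
  #{t : X × (Fin 4 → V) | R t.1 t.2 ∧ ∀ i, t.2 i ∉ W}

open Classical in
lemma edgesAvoiding_eq_sum {X V : Type*} [Fintype X] [Fintype V] (R : X → (Fin 4 → V) → Prop)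
    (W : Finset V) :
    edgesAvoiding R W = ∑ x, #{w : Fin 4 → V | R x w ∧ ∀ i, w i ∉ W} := by
  simp only [edgesAvoiding, card_filter, Fintype.sum_prod_type]

open Classical in
lemma card_fin_four_exists_mem {V : Type*} [Fintype V] (S : Finset V) :
    #{w : Fin 4 → V | ∃ i, w i ∈ S} ≤ 4 * (#S * Fintype.card V ^ 3) := by
  have h1 : ∀ i : Fin 4, #{w : Fin 4 → V | w i ∈ S} ≤ #S * Fintype.card V ^ 3 := by
    intro i
    have : ({w : Fin 4 → V | w i ∈ S} : Finset _) =
        (S ×ˢ (univ : Finset (Fin 3 → V))).image (Fin.insertNthEquiv (fun _ => V) i) := by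
      ext w
      simp only [mem_filter, mem_univ, true_and, mem_image, mem_product, and_true]
      constructor
      · intro h
        exact ⟨(Fin.insertNthEquiv (fun _ => V) i).symm w, by simpa using h,
          Equiv.apply_symm_apply _ _⟩
      · rintro ⟨z, hz, rfl⟩; simpa using hz
    rw [this]
    refine card_image_le.trans ?_
    simp [card_product]
  have : ({w : Fin 4 → V | ∃ i, w i ∈ S} : Finset _) =
      univ.biUnion fun i : Fin 4 => {w : Fin 4 → V | w i ∈ S} := by
    ext w; simp
  rw [this]
  refine card_biUnion_le.trans ((sum_le_sum fun i _ => h1 i).trans ?_)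
  simp

open Classical in
/-- Changing an almost-cover `W₀` of size about `N` to one of size exactly `N`. -/
lemma exists_edgesAvoiding_le {X V : Type*} [Fintype X] [Fintype V]
    (hVX : Fintype.card V = 4 * Fintype.card X) (R : X → (Fin 4 → V) → Prop) (W₀ : Finset V) {δ : ℝ}
    (hδ : 0 ≤ δ) (hW₀ : (#W₀ : ℝ) ≤ (1 / 4 + δ) * Fintype.card V) :
    ∃ W : Finset V, #W = Fintype.card X ∧
      (edgesAvoiding R W : ℝ) ≤ edgesAvoiding R W₀ + δ * (Fintype.card V : ℝ) ^ 5 := by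
  rcases le_total #W₀ (Fintype.card X) with h | h
  · obtain ⟨W, hW, hc⟩ := exists_superset_card_eq h (by omega)
    refine ⟨W, hc, ?_⟩
    have : edgesAvoiding R W ≤ edgesAvoiding R W₀ := by
      apply card_le_card
      intro t ht
      simp only [mem_filter, mem_univ, true_and] at ht ⊢
      exact ⟨ht.1, fun i hi => ht.2 i (hW hi)⟩
    have : (edgesAvoiding R W : ℝ) ≤ edgesAvoiding R W₀ := by exact_mod_cast this
    have : 0 ≤ δ * (Fintype.card V : ℝ) ^ 5 := by positivity
    linarith
  · obtain ⟨W, hW, hc⟩ := exists_subset_card_eq h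
    refine ⟨W, hc, ?_⟩
    have h1 : edgesAvoiding R W ≤ edgesAvoiding R W₀ +
        Fintype.card X * (4 * (#(W₀ \ W) * Fintype.card V ^ 3)) := by
      rw [edgesAvoiding_eq_sum, edgesAvoiding_eq_sum]
      have : ∀ x, #{w : Fin 4 → V | R x w ∧ ∀ i, w i ∉ W} ≤
          #{w : Fin 4 → V | R x w ∧ ∀ i, w i ∉ W₀} + 4 * (#(W₀ \ W) * Fintype.card V ^ 3) := by
        intro x
        refine le_trans ?_ (Nat.add_le_add_left (card_fin_four_exists_mem (W₀ \ W)) _)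
        refine (card_le_card ?_).trans (card_union_le _ _)
        intro w hw
        simp only [mem_filter, mem_univ, true_and, mem_union, mem_sdiff] at hw ⊢
        by_cases h : ∀ i, w i ∉ W₀
        · exact Or.inl ⟨hw.1, h⟩
        · push Not at h
          obtain ⟨i, hi⟩ := h
          exact Or.inr ⟨i, hi, hw.2 i⟩
      refine (sum_le_sum fun x _ => this x).trans ?_
      rw [sum_add_distrib]; simp
    have h2 : (#(W₀ \ W) : ℝ) ≤ δ * Fintype.card V := by
      rw [cast_card_sdiff hW, hc]
      have : (Fintype.card V : ℝ) = 4 * Fintype.card X := by exact_mod_cast hVX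
      linarith
    have h3 : (edgesAvoiding R W : ℝ) ≤ edgesAvoiding R W₀ +
        Fintype.card X * (4 * (#(W₀ \ W) * (Fintype.card V : ℝ) ^ 3)) := by exact_mod_cast h1
    have h4 : (Fintype.card V : ℝ) = 4 * Fintype.card X := by exact_mod_cast hVX
    refine h3.trans ?_
    have : (Fintype.card X : ℝ) * (4 * (#(W₀ \ W) * (Fintype.card V : ℝ) ^ 3)) ≤
        Fintype.card X * (4 * (δ * Fintype.card V * (Fintype.card V : ℝ) ^ 3)) := by gcongr
    have e : (Fintype.card X : ℝ) * (4 * (δ * Fintype.card V * (Fintype.card V : ℝ) ^ 3)) =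
        δ * (Fintype.card V : ℝ) ^ 5 := by rw [h4]; ring
    linarith

open Classical in
/-- A cheap fractional cover of the capped problem forces the extremal structure. -/
lemma exists_edgesAvoiding_le_of_dual (ε : ℝ) (hε : 0 < ε) : ∃ γ > (0 : ℝ), ∀ η : ℝ, 0 < η → η ≤ 1 → ∃ C > (0 : ℝ),
    ∀ (X V : Type) [Fintype X] [Fintype V] (R : X → (Fin 4 → V) → Prop) (y : X → ℝ) (w : V → ℝ),
    0 < Fintype.card X → Fintype.card V = 4 * Fintype.card X →
    (∀ x v, (37 / 64 - γ) * (Fintype.card V : ℝ) ^ 3 ≤ #{z : Fin 3 → V | R x (Fin.cons v z)}) →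
    (∀ v, 0 ≤ w v ∧ w v ≤ 1) →
    ∑ x, y x + ∑ v, w v + ∑ x, C / (Fintype.card X : ℝ) ^ 4 *
      (∑ e : Fin 4 → V, if R x e then max (1 - y x - ∑ i, w (e i)) 0 else 0) <
        (1 - η) * Fintype.card X →
    ∃ W : Finset V, #W = Fintype.card X ∧
      (edgesAvoiding R W : ℝ) ≤ ε * (Fintype.card V : ℝ) ^ 5 := by
  obtain ⟨γ, hγdef⟩ : ∃ γ : ℝ, γ = min (1 / 60000) (ε / 80000) := ⟨_, rfl⟩
  have hγ0 : 0 < γ := by rw [hγdef]; positivity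
  have hγ1 : γ ≤ 1 / 60000 := by rw [hγdef]; exact min_le_left _ _
  have hγ2 : γ ≤ ε / 80000 := by rw [hγdef]; exact min_le_right _ _
  refine ⟨γ, hγ0, fun η hη hη1 => ⟨1 / ε + 1 / (η * γ ^ 2), by positivity, ?_⟩⟩
  obtain ⟨C, hC⟩ : ∃ C, C = 1 / ε + 1 / (η * γ ^ 2) := ⟨_, rfl⟩
  rw [← hC]
  have hC1 : 1 ≤ C * ε := by
    rw [hC, add_mul, one_div_mul_cancel hε.ne']
    have : 0 ≤ 1 / (η * γ ^ 2) * ε := by positivity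
    linarith
  have hC2 : 1 ≤ C * (η * γ ^ 2) := by
    rw [hC, add_mul, one_div_mul_cancel (by positivity)]
    have : 0 ≤ 1 / ε * (η * γ ^ 2) := by positivity
    linarith
  have hC0 : 0 < C := by rw [hC]; positivity
  clear hC hγdef
  intro X V _ _ R y w hX hVX hdeg hw hdual
  have hV : 0 < Fintype.card V := by omega
  have : Nonempty V := Fintype.card_pos_iff.1 hV
  have hn4 : (Fintype.card V : ℝ) = 4 * Fintype.card X := by exact_mod_cast hVX
  obtain ⟨N, hN⟩ : ∃ N : ℝ, N = Fintype.card X := ⟨_, rfl⟩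
  have hN0 : 0 < N := by rw [hN]; exact_mod_cast hX
  rw [← hN] at hn4 hdual
  obtain ⟨c, hcdef⟩ : ∃ c, c = C / N ^ 4 := ⟨_, rfl⟩
  have hc0 : 0 < c := by rw [hcdef]; positivity
  rw [← hcdef] at hdual
  obtain ⟨v₀, hq1, hq2⟩ := exists_quantile w (τ := η / 8) (by linarith) (by linarith)
  obtain ⟨t, ht⟩ : ∃ t, t = w v₀ := ⟨_, rfl⟩
  rw [← ht] at hq1 hq2
  obtain ⟨u, hudef⟩ : ∃ u : V → ℝ, u = fun v => max (w v - t) 0 := ⟨_, rfl⟩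
  have hu : ∀ v, 0 ≤ u v := fun v => by rw [hudef]; exact le_max_right _ _
  have hwu : ∀ v, w v ≤ t + u v := fun v => by
    rw [hudef]; linarith [le_max_left (w v - t) 0]
  have hlow : η / 8 * Fintype.card V ≤ (#{v | u v = 0} : ℝ) := by
    refine hq1.trans_eq ?_
    congr 2
    ext v
    simp [hudef]
  have hcτ : 1 ≤ c * (η / 8 * γ ^ 2 * (Fintype.card V : ℝ) ^ 4) := by
    rw [hcdef, hn4]
    have : C / N ^ 4 * (η / 8 * γ ^ 2 * (4 * N) ^ 4) = 32 * (C * (η * γ ^ 2)) := by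
      field_simp; ring
    linarith
  obtain ⟨q, hqdef⟩ : ∃ q : X → ℝ, q = fun x => 1 - y x - 4 * t := ⟨_, rfl⟩
  obtain ⟨pen, hpdef⟩ : ∃ pen : X → ℝ, pen = fun x => c * ∑ e : Fin 4 → V,
    if R x e then max (q x - ∑ i, u (e i)) 0 else 0 := ⟨_, rfl⟩
  have hpen0 : ∀ x, 0 ≤ pen x := by
    intro x; rw [hpdef]
    refine mul_nonneg hc0.le (sum_nonneg fun e _ => ?_)
    split_ifs
    · exact le_max_right _ _
    · exact le_rfl
  obtain ⟨μ, hμ⟩ : ∃ μ, ∑ v, u v = 4 * N * μ := ⟨(∑ v, u v) / (4 * N), by field_simp⟩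
  have hμ0 : 0 ≤ μ := by
    have : 0 ≤ 4 * N * μ := by rw [← hμ]; exact sum_nonneg fun v _ => hu v
    exact nonneg_of_mul_nonneg_right this (by positivity)
  have hsumw : 4 * N * t + 4 * N * μ - η / 2 * N ≤ ∑ v, w v := by
    have : ∀ v, t + u v - (if w v < t then 1 else 0) ≤ w v := by
      intro v
      rw [hudef]
      simp only
      split_ifs with h
      · rw [max_eq_right (by linarith)]
        linarith [(hw v).1, (hw v₀).2]
      · rw [max_eq_left (by linarith)]; linarith
    have h2 := sum_le_sum fun v (_ : v ∈ univ) => this v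
    rw [sum_sub_distrib, sum_add_distrib, sum_boole, hμ] at h2
    simp only [sum_const, card_univ, nsmul_eq_mul, hn4] at h2
    rw [hn4] at hq2
    linarith
  have hmain : N * (4 * μ + η / 2) < ∑ x, (q x - pen x) := by
    have h1 : ∑ x, pen x ≤ ∑ x, c *
      (∑ e : Fin 4 → V, if R x e then max (1 - y x - ∑ i, w (e i)) 0 else 0) := by
      rw [hpdef]
      refine sum_le_sum fun x _ => mul_le_mul_of_nonneg_left (sum_le_sum fun e _ => ?_) hc0.le
      split_ifs
      · refine max_le_max ?_ le_rfl
        have := sum_le_sum fun i (_ : i ∈ (univ : Finset (Fin 4))) => hwu (e i)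
        rw [sum_add_distrib] at this
        simp only [sum_const, card_univ, Fintype.card_fin, nsmul_eq_mul] at this
        rw [hqdef]; push_cast at this ⊢; linarith
      · exact le_rfl
    have h2 : ∑ x, q x = N - ∑ x, y x - N * (4 * t) := by
      rw [hqdef, sum_sub_distrib, sum_sub_distrib]; simp [hN]
    rw [sum_sub_distrib, h2]
    linarith
  have hstab : ∀ x, 0 < q x → pen x < q x → 4 * μ ≤ q x →
      (1 - 20000 * γ) * q x ≤ 4 * μ ∧ (#{v | q x / 16 ≤ u v} : ℝ) ≤
        (1 / 4 + 20000 * γ) * Fintype.card V := by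
    intro x h1 h2 h3
    have := link_stability hu hγ0.le (by linarith) h1 hc0.le (R x) (hdeg x) hlow hcτ
      (by rw [hpdef] at h2; exact h2) (by rw [hμ, hn4]; linarith [mul_le_mul_of_nonneg_left h3 hN0.le])
    refine ⟨?_, this.2⟩
    have h4 := this.1
    rw [hμ, hn4] at h4
    have : 4 * N * ((1 - 20000 * γ) * q x) ≤ 4 * N * (4 * μ) := by linarith
    exact le_of_mul_le_mul_left this (by positivity)
  obtain ⟨δ, hδ⟩ : ∃ δ, δ = 20000 * γ := ⟨_, rfl⟩
  rw [← hδ] at hstab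
  have hδ0 : 0 < δ := by linarith
  have hδ1 : δ ≤ 1 / 3 := by linarith
  have hδ2 : δ ≤ ε / 4 := by linarith
  have hqle : ∀ x, 0 < q x → pen x < q x → (1 - δ) * q x ≤ 4 * μ := by
    intro x h1 h2
    rcases le_total (4 * μ) (q x) with h | h
    · exact (hstab x h1 h2 h).1
    · have := mul_nonneg hδ0.le h1.le
      linarith
  have hup : ∀ x, q x - pen x ≤ 4 * μ * (1 + 2 * δ) := by
    intro x
    have h0 := hpen0 x
    by_cases h : 0 < q x ∧ pen x < q x
    · have := hqle x h.1 h.2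
      have h3 : q x ≤ 4 * μ * (1 + 2 * δ) := by
        have h4 := mul_le_mul_of_nonneg_right hδ1 (mul_nonneg hδ0.le h.1.le)
        have h5 := mul_le_mul_of_nonneg_left this (by linarith : 0 ≤ 1 + 2 * δ)
        linarith [mul_nonneg hδ0.le h.1.le]
      linarith
    · have : q x - pen x ≤ 0 := by
        by_contra hcon
        exact h ⟨by linarith, by linarith⟩
      have : 0 ≤ 4 * μ * (1 + 2 * δ) := by positivity
      linarith
  obtain ⟨x₀, hx₀⟩ : ∃ x, 4 * μ < q x - pen x := by
    by_contra hcon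
    push Not at hcon
    have := sum_le_sum fun x (_ : x ∈ univ) => hcon x
    simp only [sum_const, card_univ, nsmul_eq_mul, ← hN] at this
    linarith [mul_pos hN0 hη]
  have hp₀ := hpen0 x₀
  obtain ⟨hs1, hs2⟩ := hstab x₀ (by linarith) (by linarith) (by linarith)
  have hμ1 : 0 < μ := by
    have : 0 < (1 - δ) * q x₀ := mul_pos (by linarith) (by linarith)
    linarith
  have hq₀ : q x₀ ≤ 6 * μ := by
    have := mul_le_mul_of_nonneg_right (by linarith : 2 / 3 ≤ 1 - δ) (by linarith : 0 ≤ q x₀)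
    linarith
  have hbad : (#{x | q x - pen x < 2 * μ} : ℝ) ≤ 4 * δ * N := by
    have : ∀ x, q x - pen x ≤ 4 * μ * (1 + 2 * δ) +
        (if q x - pen x < 2 * μ then 1 else 0) * (2 * μ - 4 * μ * (1 + 2 * δ)) := by
      intro x
      have := hup x
      split_ifs <;> linarith
    have := sum_le_sum fun x (_ : x ∈ univ) => this x
    rw [sum_add_distrib, sum_const, ← sum_mul, sum_boole] at this
    simp only [card_univ, nsmul_eq_mul, ← hN] at this
    by_contra hcon
    push Not at hcon
    generalize (#{x | q x - pen x < 2 * μ} : ℝ) = D at *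
    have h1 : 4 * N < N * (4 * (1 + 2 * δ)) + D * (2 - 4 * (1 + 2 * δ)) := by
      have : μ * (4 * N) < μ * (N * (4 * (1 + 2 * δ)) + D * (2 - 4 * (1 + 2 * δ))) := by
        linarith [mul_pos hN0 hη]
      exact lt_of_mul_lt_mul_left this hμ0
    have h2 := mul_le_mul_of_nonneg_right hcon.le (by linarith : 0 ≤ 2 + 8 * δ)
    linarith [mul_pos hδ0 hN0, mul_pos (mul_pos hδ0 hδ0) hN0]
  obtain ⟨W, hW, hWe⟩ := exists_edgesAvoiding_le hVX R {v | q x₀ / 16 ≤ u v} hδ0.le hs2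
  refine ⟨W, hW, hWe.trans ?_⟩
  have hgood : ∀ x, ¬ q x - pen x < 2 * μ →
      (#{e : Fin 4 → V | R x e ∧ ∀ i, e i ∉ ({v | q x₀ / 16 ≤ u v} : Finset V)} : ℝ) ≤ 12 * N ^ 4 / C := by
    intro x hx
    push Not at hx
    have h0 := hpen0 x
    have hqx := hqle x (by linarith) (by linarith)
    have hq8 : q x ≤ 8 * μ := by
      have := mul_le_mul_of_nonneg_right (by linarith : 2 / 3 ≤ 1 - δ) (by linarith : 0 ≤ q x)
      linarith
    have h1 : (#{e : Fin 4 → V | R x e ∧ ∀ i, e i ∉ ({v | q x₀ / 16 ≤ u v} : Finset V)} : ℝ) * (μ / 2) ≤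
        ∑ e : Fin 4 → V, if R x e then max (q x - ∑ i, u (e i)) 0 else 0 := by
      rw [← nsmul_eq_mul, ← sum_const]
      refine le_trans (sum_le_sum fun e he => ?_) (sum_le_univ_sum_of_nonneg fun e => ?_)
      · simp only [mem_filter, mem_univ, true_and] at he
        rw [if_pos he.1]
        refine le_trans ?_ (le_max_left _ _)
        have hs : ∑ i, u (e i) ≤ ∑ i : Fin 4, q x₀ / 16 :=
          sum_le_sum fun i _ => by linarith [not_le.1 (he.2 i)]
        simp only [sum_const, card_univ, Fintype.card_fin, nsmul_eq_mul] at hs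
        push_cast at hs
        linarith
      · split_ifs
        · exact le_max_right _ _
        · exact le_rfl
    have h2 : pen x ≤ 6 * μ := by linarith
    rw [hpdef] at h2
    generalize (#{e : Fin 4 → V | R x e ∧ ∀ i, e i ∉ ({v | q x₀ / 16 ≤ u v} : Finset V)} : ℝ) = K at *
    have h3 : c * (K * (μ / 2)) ≤ 6 * μ := (mul_le_mul_of_nonneg_left h1 hc0.le).trans h2
    have h4 : μ * (c * K) ≤ μ * 12 := by linarith
    have h5 := le_of_mul_le_mul_left h4 hμ1
    rw [hcdef] at h5
    rw [le_div_iff₀ hC0]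
    have h6 : N ^ 4 * (C / N ^ 4 * K) ≤ N ^ 4 * 12 := mul_le_mul_of_nonneg_left h5 (by positivity)
    have h7 : N ^ 4 * (C / N ^ 4 * K) = K * C := by field_simp
    linarith
  have htot : (edgesAvoiding R {v | q x₀ / 16 ≤ u v} : ℝ) ≤
      N * (12 * N ^ 4 / C) + 4 * δ * N * (4 * N) ^ 4 := by
    rw [edgesAvoiding_eq_sum]
    push_cast
    have : ∀ x, (#{e : Fin 4 → V | R x e ∧ ∀ i, e i ∉ ({v | q x₀ / 16 ≤ u v} : Finset V)} : ℝ) ≤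
        12 * N ^ 4 / C + (if q x - pen x < 2 * μ then 1 else 0) * (4 * N) ^ 4 := by
      intro x
      split_ifs with h
      · have h1 : (#{e : Fin 4 → V | R x e ∧ ∀ i, e i ∉ ({v | q x₀ / 16 ≤ u v} : Finset V)}) ≤
            Fintype.card (Fin 4 → V) := card_le_univ _
        have h2 : (#{e : Fin 4 → V | R x e ∧ ∀ i, e i ∉ ({v | q x₀ / 16 ≤ u v} : Finset V)} : ℝ) ≤
            (4 * N) ^ 4 := by
          rw [← hn4]
          rw [Fintype.card_fun, Fintype.card_fin] at h1
          exact_mod_cast h1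
        have : 0 ≤ 12 * N ^ 4 / C := by positivity
        linarith
      · have := hgood x h
        linarith
    refine (sum_le_sum fun x _ => this x).trans ?_
    rw [sum_add_distrib, ← sum_mul, sum_boole]
    simp only [sum_const, card_univ, nsmul_eq_mul, ← hN]
    gcongr
  rw [hn4]
  have h1 : N * (12 * N ^ 4 / C) ≤ 12 * ε * N ^ 5 := by
    have : 12 * N ^ 4 / C ≤ 12 * ε * N ^ 4 := by
      rw [div_le_iff₀ hC0]
      have := mul_le_mul_of_nonneg_left hC1 (by positivity : 0 ≤ 12 * N ^ 4)
      linarith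
    have := mul_le_mul_of_nonneg_left this hN0.le
    linarith
  have h2 : δ * N ^ 5 ≤ ε / 4 * N ^ 5 := by gcongr
  have h3 : 0 ≤ ε * N ^ 5 := by positivity
  linarith

/-- Resampling the coordinates in the range of an injection `κ` preserves averages. -/
lemma sum_resample {X : Type*} [Fintype X] {s k : ℕ} {κ : Fin k → Fin s}
    (hκ : Function.Injective κ) (H : (Fin s → X) → ℝ) :
    (Fintype.card X : ℝ) ^ k * ∑ g, H g =
      ∑ g : Fin s → X, ∑ z : Fin k → X, H (Function.extend κ z g) := by
  let T : (Fin s → X) × (Fin k → X) → (Fin s → X) × (Fin k → X) :=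
    fun p => (Function.extend κ p.2 p.1, p.1 ∘ κ)
  have hT : Function.Involutive T := by
    rintro ⟨g, z⟩
    refine Prod.ext ?_ ?_
    · funext a
      by_cases h : ∃ i, κ i = a
      · obtain ⟨i, rfl⟩ := h
        simp only [T]
        rw [hκ.extend_apply]
        rfl
      · simp only [T]
        rw [Function.extend_apply' _ _ _ h, Function.extend_apply' _ _ _ h]
    · funext i
      simp only [T, Function.comp_apply]
      rw [hκ.extend_apply]
  rw [← Fintype.sum_prod_type' (f := fun g z => H (Function.extend κ z g))]
  rw [show (∑ p : (Fin s → X) × (Fin k → X), H (Function.extend κ p.2 p.1)) =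
    ∑ p, (fun p : (Fin s → X) × (Fin k → X) => H p.1) (hT.toPerm T p) from rfl]
  rw [Equiv.sum_comp (hT.toPerm T) (fun p => H p.1), Fintype.sum_prod_type]
  simp [mul_sum]

lemma sum_comp_injective {X : Type*} [Fintype X] {s k : ℕ} {κ : Fin k → Fin s}
    (hκ : Function.Injective κ) (H : (Fin k → X) → ℝ) :
    (Fintype.card X : ℝ) ^ k * ∑ g : Fin s → X, H (g ∘ κ) =
      (Fintype.card X : ℝ) ^ s * ∑ z, H z := by
  rw [sum_resample hκ]
  have : ∀ (g : Fin s → X) (z : Fin k → X), Function.extend κ z g ∘ κ = z := by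
    intro g z; funext i; simp [hκ.extend_apply]
  simp only [this]
  simp

lemma sum_apply_coord {X : Type*} [Fintype X] {s : ℕ} (a : Fin s) (φ : X → ℝ) :
    (Fintype.card X : ℝ) * ∑ g : Fin s → X, φ (g a) = (Fintype.card X : ℝ) ^ s * ∑ x, φ x := by
  have := sum_comp_injective (X := X) (κ := fun _ : Fin 1 => a)
    (Function.injective_of_subsingleton _) (fun z => φ (z 0))
  rw [pow_one] at this
  refine this.trans ?_
  rw [← (Equiv.funUnique (Fin 1) X).sum_comp φ]
  rfl

/-- Injective index tuples avoiding `a`. -/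
def injAvoid (s : ℕ) (a : Fin s) : Finset (Fin 4 → Fin s) :=
  {κ | Function.Injective κ ∧ ∀ i, κ i ≠ a}

lemma card_not_disjoint_le (s : ℕ) :
    #{p : (Fin 4 → Fin s) × (Fin 4 → Fin s) | ∃ i j, p.1 i = p.2 j} ≤ 16 * s ^ 7 := by
  have h1 : ∀ ij : Fin 4 × Fin 4,
      #{p : (Fin 4 → Fin s) × (Fin 4 → Fin s) | p.1 ij.1 = p.2 ij.2} ≤ s ^ 7 := by
    rintro ⟨i, j⟩
    have : ({p : (Fin 4 → Fin s) × (Fin 4 → Fin s) | p.1 i = p.2 j} : Finset _) ⊆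
        univ.image fun t : (Fin 4 → Fin s) × (Fin 3 → Fin s) =>
          (t.1, (Fin.insertNth j (t.1 i) t.2 : Fin 4 → Fin s)) := by
      rintro ⟨p, q⟩ h
      simp only [mem_filter, mem_univ, true_and] at h
      simp only [mem_image, mem_univ, true_and, Prod.mk.injEq]
      refine ⟨(p, j.removeNth q), rfl, ?_⟩
      simp only [h]
      exact Fin.insertNth_self_removeNth j q
    refine (card_le_card this).trans (card_image_le.trans ?_)
    simp [← pow_add]
  have : ({p : (Fin 4 → Fin s) × (Fin 4 → Fin s) | ∃ i j, p.1 i = p.2 j} : Finset _) =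
      univ.biUnion fun ij : Fin 4 × Fin 4 =>
        {p : (Fin 4 → Fin s) × (Fin 4 → Fin s) | p.1 ij.1 = p.2 ij.2} := by
    ext p; simp
  rw [this]
  refine card_biUnion_le.trans ((sum_le_sum fun i _ => h1 i).trans ?_)
  simp

lemma max_zero_le_add_sq {θ : ℝ} (hθ : 0 < θ) (z : ℝ) : max z 0 ≤ θ + z ^ 2 / (4 * θ) := by
  have h : 0 ≤ z ^ 2 / (4 * θ) := by positivity
  refine max_le ?_ (by linarith)
  have : z ^ 2 / (4 * θ) - z + θ = (z - 2 * θ) ^ 2 / (4 * θ) := by field_simp; ring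
  have h2 : 0 ≤ (z - 2 * θ) ^ 2 / (4 * θ) := by positivity
  linarith

/-- The expected excess load at a vertex of a random sample of `s` groups. -/
lemma sampled_excess_le {X : Type*} [Fintype X] [Nonempty X] {s : ℕ} (a : Fin s)
    (K : X → (Fin 4 → X) → ℝ) {B θ : ℝ} (hθ : 0 < θ) (hK0 : ∀ x z, 0 ≤ K x z)
    (hK : ∀ x z, (Fintype.card X : ℝ) ^ 4 * K x z ≤ B) :
    ∑ g : Fin s → X, max ((Fintype.card X : ℝ) ^ 4 / s ^ 4 *
        ∑ κ ∈ injAvoid s a, K (g a) (g ∘ κ) - 1) 0 ≤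
      (Fintype.card X : ℝ) ^ s * ((∑ x, max (∑ z, K x z - 1) 0) / Fintype.card X +
        θ + 4 * B ^ 2 / (θ * s)) := by
  obtain ⟨N, hN⟩ : ∃ N : ℝ, N = Fintype.card X := ⟨_, rfl⟩
  have hN0 : 0 < N := by rw [hN]; exact_mod_cast Fintype.card_pos
  simp only [← hN] at hK ⊢
  have hs0 : (0 : ℝ) < s := by exact_mod_cast a.pos
  obtain ⟨ℓ, hℓ⟩ : ∃ ℓ : X → ℝ, ℓ = fun x => ∑ z, K x z := ⟨_, rfl⟩
  have hℓ0 : ∀ x, 0 ≤ ℓ x := fun x => by rw [hℓ]; exact sum_nonneg fun z _ => hK0 x z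
  have hcardz : (Fintype.card (Fin 4 → X) : ℝ) = N ^ 4 := by simp [hN]
  have hℓB : ∀ x, ℓ x ≤ B := by
    intro x
    have : N ^ 4 * ℓ x ≤ N ^ 4 * B := by
      rw [hℓ, mul_sum]
      refine (sum_le_sum fun z _ => hK x z).trans_eq ?_
      rw [sum_const, card_univ, nsmul_eq_mul, hcardz]
    exact le_of_mul_le_mul_left this (by positivity)
  obtain ⟨Δ, hΔ⟩ : ∃ Δ : (Fin 4 → Fin s) → (Fin s → X) → ℝ,
    Δ = fun κ g => N ^ 4 * K (g a) (g ∘ κ) - ℓ (g a) := ⟨_, rfl⟩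
  have hΔB : ∀ κ g, |Δ κ g| ≤ B := by
    intro κ g
    rw [hΔ, abs_le]
    have h1 := hK (g a) (g ∘ κ)
    have h2 := hℓB (g a)
    have h3 := hℓ0 (g a)
    have h4 : 0 ≤ N ^ 4 * K (g a) (g ∘ κ) := mul_nonneg (by positivity) (hK0 _ _)
    constructor <;> simp only <;> linarith
  have hB0 : 0 ≤ B := (hℓ0 (Classical.arbitrary X)).trans (hℓB _)
  have hcardg : (Fintype.card (Fin s → X) : ℝ) = N ^ s := by simp [hN]
  have hcorr : ∀ κ ∈ injAvoid s a, ∀ κ' ∈ injAvoid s a,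
      ∑ g, Δ κ g * Δ κ' g ≤ if ∃ i j, κ i = κ' j then N ^ s * B ^ 2 else 0 := by
    intro κ hκ κ' hκ'
    simp only [injAvoid, mem_filter, mem_univ, true_and] at hκ hκ'
    split_ifs with h
    · calc ∑ g, Δ κ g * Δ κ' g ≤ ∑ g : Fin s → X, B ^ 2 := by
            refine sum_le_sum fun g _ => (le_abs_self _).trans ?_
            rw [abs_mul, sq]
            exact mul_le_mul (hΔB _ _) (hΔB _ _) (abs_nonneg _) hB0
        _ = _ := by rw [sum_const, card_univ, nsmul_eq_mul, hcardg]
    · push Not at h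
      have h0 := sum_resample (X := X) hκ.1 fun g => Δ κ g * Δ κ' g
      have h1 : ∀ (g : Fin s → X) (z : Fin 4 → X), Δ κ (Function.extend κ z g) *
          Δ κ' (Function.extend κ z g) = (N ^ 4 * K (g a) z - ℓ (g a)) * Δ κ' g := by
        intro g z
        have e1 : Function.extend κ z g a = g a :=
          Function.extend_apply' _ _ _ (by rintro ⟨i, hi⟩; exact hκ.2 i hi)
        have e2 : Function.extend κ z g ∘ κ = z := by funext i; simp [hκ.1.extend_apply]
        have e3 : Function.extend κ z g ∘ κ' = g ∘ κ' := by
          funext j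
          exact Function.extend_apply' _ _ _ (by rintro ⟨i, hi⟩; exact h i j hi)
        rw [hΔ]
        simp only [e1, e2, e3]
      simp only [h1, ← sum_mul, sum_sub_distrib, ← mul_sum] at h0
      have h2 : ∀ x, N ^ 4 * ∑ z, K x z - ∑ _z : Fin 4 → X, ℓ x = 0 := by
        intro x
        rw [sum_const, card_univ, nsmul_eq_mul, hcardz, hℓ]; ring
      simp only [h2, zero_mul, sum_const_zero] at h0
      rw [← hN] at h0
      exact ((mul_eq_zero.1 h0).resolve_left (by positivity)).le
  have hvar : ∑ g, (∑ κ ∈ injAvoid s a, Δ κ g) ^ 2 ≤ 16 * (s : ℝ) ^ 7 * (N ^ s * B ^ 2) := by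
    calc ∑ g, (∑ κ ∈ injAvoid s a, Δ κ g) ^ 2
        = ∑ κ ∈ injAvoid s a, ∑ κ' ∈ injAvoid s a, ∑ g, Δ κ g * Δ κ' g := by
          simp only [sq, sum_mul_sum]
          rw [sum_comm]
          refine sum_congr rfl fun κ _ => ?_
          rw [sum_comm]
      _ ≤ ∑ κ ∈ injAvoid s a, ∑ κ' ∈ injAvoid s a,
          if ∃ i j, κ i = κ' j then N ^ s * B ^ 2 else 0 :=
          sum_le_sum fun κ hκ => sum_le_sum fun κ' hκ' => hcorr κ hκ κ' hκ'
      _ ≤ ∑ κ : Fin 4 → Fin s, ∑ κ' : Fin 4 → Fin s,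
          if ∃ i j, κ i = κ' j then N ^ s * B ^ 2 else 0 := by
          have hnn : ∀ κ κ' : Fin 4 → Fin s,
              0 ≤ if ∃ i j, κ i = κ' j then N ^ s * B ^ 2 else 0 := by
            intro κ κ'; split_ifs <;> positivity
          refine (sum_le_sum fun κ _ => sum_le_univ_sum_of_nonneg fun κ' => hnn κ κ').trans ?_
          exact sum_le_univ_sum_of_nonneg fun κ => sum_nonneg fun κ' _ => hnn κ κ'
      _ = #{p : (Fin 4 → Fin s) × (Fin 4 → Fin s) | ∃ i j, p.1 i = p.2 j} * (N ^ s * B ^ 2) := by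
          rw [← Fintype.sum_prod_type' (f := fun κ κ' : Fin 4 → Fin s =>
            if ∃ i j, κ i = κ' j then N ^ s * B ^ 2 else 0), ← sum_filter, sum_const, nsmul_eq_mul]
      _ ≤ _ := by
          refine mul_le_mul_of_nonneg_right ?_ (by positivity)
          exact_mod_cast card_not_disjoint_le s
  have hpt : ∀ g : Fin s → X, max (N ^ 4 / s ^ 4 * ∑ κ ∈ injAvoid s a, K (g a) (g ∘ κ) - 1) 0 ≤
      max (ℓ (g a) - 1) 0 + θ + (∑ κ ∈ injAvoid s a, Δ κ g) ^ 2 * (1 / (s ^ 8 * (4 * θ))) := by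
    intro g
    have h1 := max_zero_le_add_sq hθ ((∑ κ ∈ injAvoid s a, Δ κ g) / s ^ 4)
    have h2 : ((∑ κ ∈ injAvoid s a, Δ κ g) / s ^ 4) ^ 2 / (4 * θ) =
      (∑ κ ∈ injAvoid s a, Δ κ g) ^ 2 * (1 / (s ^ 8 * (4 * θ))) := by field_simp
    rw [h2] at h1
    have h3 : N ^ 4 / s ^ 4 * ∑ κ ∈ injAvoid s a, K (g a) (g ∘ κ) ≤
        (∑ κ ∈ injAvoid s a, Δ κ g) / s ^ 4 + ℓ (g a) := by
      rw [hΔ]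
      simp only
      rw [sum_sub_distrib, ← mul_sum, sum_const, nsmul_eq_mul, sub_div, mul_div_right_comm]
      have : (#(injAvoid s a) : ℝ) * ℓ (g a) / s ^ 4 ≤ ℓ (g a) := by
        rw [div_le_iff₀ (by positivity), mul_comm]
        refine mul_le_mul_of_nonneg_left ?_ (hℓ0 _)
        have : #(injAvoid s a) ≤ Fintype.card (Fin 4 → Fin s) := card_le_univ _
        simp only [Fintype.card_fun, Fintype.card_fin] at this
        exact_mod_cast this
      linarith
    have h4 := le_max_left (ℓ (g a) - 1) 0
    have h5 := le_max_right (ℓ (g a) - 1) 0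
    have h6 := le_max_left ((∑ κ ∈ injAvoid s a, Δ κ g) / s ^ 4) 0
    have h7 := le_max_right ((∑ κ ∈ injAvoid s a, Δ κ g) / s ^ 4) 0
    refine max_le (by linarith) (by linarith)
  refine (sum_le_sum fun g _ => hpt g).trans ?_
  rw [sum_add_distrib, sum_add_distrib, ← sum_mul, sum_const, card_univ, nsmul_eq_mul, hcardg]
  have h1 := sum_apply_coord (X := X) a fun x => max (ℓ x - 1) 0
  rw [← hN] at h1
  have h2 : ∑ g : Fin s → X, max (ℓ (g a) - 1) 0 =
      N ^ s * ((∑ x, max (∑ z, K x z - 1) 0) / N) := by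
    rw [hℓ] at h1 ⊢
    field_simp
    linarith
  rw [h2]
  have h3 := mul_le_mul_of_nonneg_right hvar (by positivity : 0 ≤ 1 / ((s : ℝ) ^ 8 * (4 * θ)))
  have h4 : 16 * (s : ℝ) ^ 7 * (N ^ s * B ^ 2) * (1 / ((s : ℝ) ^ 8 * (4 * θ))) =
      N ^ s * (4 * B ^ 2 / (θ * s)) := by field_simp; ring
  linarith

lemma card_not_injective_le (Y : Type*) [Fintype Y] [DecidableEq Y] (k : ℕ) :
    (#{ι : Fin k → Y | ¬ Function.Injective ι} : ℝ) * Fintype.card Y ≤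
      k ^ 2 * (Fintype.card Y : ℝ) ^ k := by

  have h1 : ∀ ij ∈ (univ : Finset (Fin k × Fin k)).filter (fun p => p.1 ≠ p.2),
      (#{ι : Fin k → Y | ι ij.1 = ι ij.2} : ℝ) * Fintype.card Y ≤ (Fintype.card Y : ℝ) ^ k := by
    rintro ⟨i, j⟩ h
    simp only [mem_filter, mem_univ, true_and] at h
    have h2 : #(({ι : Fin k → Y | ι i = ι j} : Finset _) ×ˢ (univ : Finset Y)) ≤
        Fintype.card (Fin k → Y) := by
      refine card_le_card_of_injOn (fun t => Function.update t.1 i t.2) (by simp) ?_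
      rintro ⟨f, y⟩ hf ⟨g, y'⟩ hg hfg
      simp only [coe_product, Set.mem_prod, mem_coe, mem_filter, mem_univ, true_and,
        and_true] at hf hg hfg
      have hyy : y = y' := by simpa using congrFun hfg i
      have hne : ∀ k ≠ i, f k = g k := fun k hk => by simpa [hk] using congrFun hfg k
      have : f = g := by
        funext k
        by_cases hk : k = i
        · subst hk
          rw [hf, hg, hne j (Ne.symm h)]
        · exact hne k hk
      rw [this, hyy]
    rw [card_product, card_univ] at h2
    have h3 : Fintype.card (Fin k → Y) = Fintype.card Y ^ k := by simp
    rw [h3] at h2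
    exact_mod_cast h2
  have h2 : ({ι : Fin k → Y | ¬ Function.Injective ι} : Finset _) ⊆
      ((univ : Finset (Fin k × Fin k)).filter (fun p => p.1 ≠ p.2)).biUnion
        fun ij => {ι : Fin k → Y | ι ij.1 = ι ij.2} := by
    intro ι hι
    simp only [mem_filter, mem_univ, true_and, Function.Injective, not_forall] at hι
    obtain ⟨a, b, hab, hne⟩ := hι
    simp only [mem_biUnion, mem_filter, mem_univ, true_and, Prod.exists]
    exact ⟨a, b, hne, hab⟩
  have h3 : (#{ι : Fin k → Y | ¬ Function.Injective ι} : ℝ) ≤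
      ∑ ij ∈ (univ : Finset (Fin k × Fin k)).filter (fun p => p.1 ≠ p.2),
        (#{ι : Fin k → Y | ι ij.1 = ι ij.2} : ℝ) := by
    exact_mod_cast (card_le_card h2).trans card_biUnion_le
  calc _ ≤ (∑ ij ∈ (univ : Finset (Fin k × Fin k)).filter (fun p => p.1 ≠ p.2),
        (#{ι : Fin k → Y | ι ij.1 = ι ij.2} : ℝ)) * Fintype.card Y := by gcongr
    _ ≤ ∑ ij ∈ (univ : Finset (Fin k × Fin k)).filter (fun p => p.1 ≠ p.2),
        (Fintype.card Y : ℝ) ^ k := by rw [sum_mul]; exact sum_le_sum h1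
    _ ≤ _ := by
      rw [sum_const, nsmul_eq_mul]
      gcongr
      have : #((univ : Finset (Fin k × Fin k)).filter (fun p => p.1 ≠ p.2)) ≤ k ^ 2 := by
        refine (card_filter_le _ _).trans ?_
        simp [sq]
      exact_mod_cast this

/-- A function with large mean is large, with a common pattern, on a positive proportion of
the points outside a small exceptional set. -/
lemma exists_large_fiber {G K : Type*} [Fintype G] [DecidableEq G] [Fintype K] [DecidableEq K] [Nonempty K]
    (h : G → ℝ) (pat : G → K) (Bad : Finset G) {m b : ℝ} (hm : 0 < m) (hb : 0 < b)
    (hmean : 2 * m * Fintype.card G ≤ ∑ g, h g) (hle : ∀ g, h g ≤ b)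
    (hBad : (#Bad : ℝ) ≤ m / (2 * b) * Fintype.card G) (hG : 0 < Fintype.card G) :
    ∃ P : Finset G, m / (2 * b * Fintype.card K) * Fintype.card G ≤ #P ∧ P.Nonempty ∧
      (∀ g ∈ P, m ≤ h g ∧ g ∉ Bad) ∧ ∀ g ∈ P, ∀ g' ∈ P, pat g = pat g' := by
  have h1 : m / b * Fintype.card G ≤ #{g | m ≤ h g} := by
    have : ∑ g, h g ≤ ∑ g, (m + if m ≤ h g then b else 0) := by
      refine sum_le_sum fun g _ => ?_
      split_ifs with hg
      · have := hle g; linarith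
      · push Not at hg; linarith
    rw [sum_add_distrib, sum_const, card_univ, nsmul_eq_mul, ← sum_filter, sum_const,
      nsmul_eq_mul] at this
    rw [div_mul_eq_mul_div, div_le_iff₀ hb]
    linarith
  have h2 : m / (2 * b) * Fintype.card G ≤ #(({g | m ≤ h g} : Finset G) \ Bad) := by
    have := le_card_sdiff Bad ({g | m ≤ h g} : Finset G)
    have h3 : (#({g | m ≤ h g} : Finset G) : ℝ) ≤ #(({g | m ≤ h g} : Finset G) \ Bad) + #Bad := by
      exact_mod_cast (by omega : _ ≤ _)
    have h4 : m / b * Fintype.card G = 2 * (m / (2 * b) * Fintype.card G) := by field_simp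
    linarith
  have hK : (0 : ℝ) < Fintype.card K := by exact_mod_cast Fintype.card_pos
  obtain ⟨k, -, hk⟩ := exists_le_card_fiber_of_nsmul_le_card_of_maps_to (M := ℝ)
    (s := ({g | m ≤ h g} : Finset G) \ Bad) (t := (univ : Finset K)) (f := pat)
    (b := m / (2 * b * Fintype.card K) * Fintype.card G) (fun _ _ => mem_univ _)
    univ_nonempty (by
      rw [nsmul_eq_mul, card_univ]
      refine le_trans (le_of_eq ?_) h2
      field_simp)
  refine ⟨_, hk, ?_, ?_, ?_⟩
  · rw [← card_pos]
    have : (0 : ℝ) < m / (2 * b * Fintype.card K) * Fintype.card G := by positivity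
    exact_mod_cast this.trans_le hk
  · intro g hg
    simp only [mem_filter, mem_sdiff, mem_univ, true_and] at hg
    exact hg.1
  · intro g hg g' hg'
    rw [(mem_filter.1 hg).2, (mem_filter.1 hg').2]

section Sampling

variable {J O : Type} [Fintype J] [DecidableEq O]

/-- The contribution to the load of the point `(x, o)` of the edges whose other groups are `z`. -/
noncomputable def typLoad (typ : Fin 5 → J → O) {X : Type} (F : (Fin 5 → X) → J → ℝ) (o : O)
    (x : X) (z : Fin 4 → X) : ℝ :=
  ∑ i : Fin 5, ∑ j, if typ i j = o then F (Fin.insertNth i x z) j else 0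

/-- The total weight minus the excess load of the sample `g`. -/
noncomputable def sampleValue [Fintype O] (typ : Fin 5 → J → O) {X : Type} [Fintype X]
    (F : (Fin 5 → X) → J → ℝ) {s : ℕ} (g : Fin s → X) : ℝ :=
  (Fintype.card X : ℝ) ^ 4 / s ^ 4 *
      (∑ ι : Fin 5 → Fin s with Function.Injective ι, ∑ j, F (g ∘ ι) j) -
    ∑ o, ∑ a : Fin s, max ((Fintype.card X : ℝ) ^ 4 / s ^ 4 *
      ∑ κ ∈ injAvoid s a, typLoad typ F o (g a) (g ∘ κ) - 1) 0

lemma typLoad_nonneg {typ : Fin 5 → J → O} {X : Type} {F : (Fin 5 → X) → J → ℝ}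
    (hF : ∀ y j, 0 ≤ F y j) (o : O) (x : X) (z : Fin 4 → X) : 0 ≤ typLoad typ F o x z :=
  sum_nonneg fun i _ => sum_nonneg fun j _ => by split_ifs <;> simp [hF]

lemma sum_injective_ge {X : Type} [Fintype X] [Nonempty X] {s : ℕ} (hs : 0 < s)
    {F : (Fin 5 → X) → J → ℝ} {C : ℝ}
    (hF : ∀ y j, 0 ≤ F y j ∧ (Fintype.card X : ℝ) ^ 4 * F y j ≤ C) :
    (Fintype.card X : ℝ) ^ s * (s * (∑ y, ∑ j, F y j) / Fintype.card X -
        25 * Fintype.card J * C) ≤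
      ∑ g : Fin s → X, (Fintype.card X : ℝ) ^ 4 / s ^ 4 *
        ∑ ι : Fin 5 → Fin s with Function.Injective ι, ∑ j, F (g ∘ ι) j := by
  have hN0 : (0 : ℝ) < Fintype.card X := by exact_mod_cast Fintype.card_pos
  have hs0 : (0 : ℝ) < s := by exact_mod_cast hs
  have hcy : (Fintype.card (Fin 5 → X) : ℝ) = (Fintype.card X : ℝ) ^ 5 := by simp
  have hni := card_not_injective_le (Fin s) 5
  have hcomp := fun (ι : Fin 5 → Fin s) (hι : Function.Injective ι) =>
    sum_comp_injective (X := X) hι fun y => ∑ j, F y j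
  generalize (Fintype.card X : ℝ) = N at *
  obtain ⟨T, hT⟩ : ∃ T, T = ∑ y, ∑ j, F y j := ⟨_, rfl⟩
  have hT0 : 0 ≤ T := by rw [hT]; exact sum_nonneg fun _ _ => sum_nonneg fun _ _ => (hF _ _).1
  have hTle : T ≤ N * (Fintype.card J * C) := by
    have : N ^ 4 * T ≤ N ^ 4 * (N * (Fintype.card J * C)) := by
      rw [hT, mul_sum]
      simp only [mul_sum]
      refine (sum_le_sum fun y _ => sum_le_sum fun j _ => (hF y j).2).trans_eq ?_
      rw [sum_const, sum_const, card_univ, card_univ, nsmul_eq_mul, nsmul_eq_mul, hcy]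
      ring
    exact le_of_mul_le_mul_left this (by positivity)
  have h1 : ∀ ι ∈ ({ι : Fin 5 → Fin s | Function.Injective ι} : Finset _),
      ∑ g : Fin s → X, ∑ j, F (g ∘ ι) j = N ^ s * T / N ^ 5 := by
    intro ι hι
    have h := hcomp ι (mem_filter.1 hι).2
    rw [← hT] at h
    rw [eq_div_iff (by positivity), mul_comm]
    exact h
  rw [← hT, ← mul_sum, sum_comm, sum_congr rfl h1, sum_const, nsmul_eq_mul]
  have h2 : (s : ℝ) ^ 5 - 25 * s ^ 4 ≤ #({ι : Fin 5 → Fin s | Function.Injective ι} : Finset _) := by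
    have h3 := card_filter_add_card_filter_not (s := (univ : Finset (Fin 5 → Fin s)))
      (fun ι => Function.Injective ι)
    rw [card_univ] at h3
    have h4 : Fintype.card (Fin 5 → Fin s) = s ^ 5 := by simp
    rw [h4] at h3
    have h5 : (#({ι : Fin 5 → Fin s | Function.Injective ι} : Finset _) : ℝ) +
      #({ι : Fin 5 → Fin s | ¬ Function.Injective ι} : Finset _) = s ^ 5 := by exact_mod_cast h3
    have h6 : (#({ι : Fin 5 → Fin s | ¬ Function.Injective ι} : Finset _) : ℝ) ≤ 25 * s ^ 4 := by
      simp only [Fintype.card_fin] at hni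
      refine le_of_mul_le_mul_right (hni.trans_eq ?_) hs0
      norm_num; ring
    linarith
  calc N ^ s * (s * T / N - 25 * Fintype.card J * C)
      ≤ N ^ s * (s * T / N - 25 * (T / N)) := by
        refine mul_le_mul_of_nonneg_left ?_ (by positivity)
        have : T / N ≤ Fintype.card J * C := by rw [div_le_iff₀ hN0]; linarith
        linarith
    _ = N ^ 4 / s ^ 4 * (((s : ℝ) ^ 5 - 25 * s ^ 4) * (N ^ s * T / N ^ 5)) := by
        field_simp
    _ ≤ _ := by gcongr

lemma card_mul_typLoad_le {typ : Fin 5 → J → O} {X : Type} {F : (Fin 5 → X) → J → ℝ} {C N : ℝ}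
    (hF : ∀ y j, 0 ≤ F y j ∧ N ^ 4 * F y j ≤ C) (hC : 0 ≤ C) (o : O) (x : X) (z : Fin 4 → X) :
    N ^ 4 * typLoad typ F o x z ≤ 5 * Fintype.card J * C := by
  rw [typLoad, mul_sum]
  simp only [mul_sum]
  calc _ ≤ ∑ i : Fin 5, ∑ j : J, C := by
        refine sum_le_sum fun i _ => sum_le_sum fun j _ => ?_
        split_ifs
        · exact (hF _ _).2
        · simpa using hC
    _ = _ := by simp; ring

/-- The mean over all samples of the value minus the number of indices sent to `S`. -/
lemma sum_sampleValue_ge [Fintype O] [Nonempty O] (typ : Fin 5 → J → O) {X : Type} [Fintype X]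
    [DecidableEq X] [Nonempty X] {s : ℕ} (hs : 0 < s) {F : (Fin 5 → X) → J → ℝ} {C η : ℝ}
    (hC : 0 ≤ C) (hη : 0 < η)
    (hF : ∀ y j, 0 ≤ F y j ∧ (Fintype.card X : ℝ) ^ 4 * F y j ≤ C) (S : Finset X)
    (hS : (#S : ℝ) ≤ (1 - η) * Fintype.card X)
    (hV : (1 - η / 2) * Fintype.card X ≤ ∑ y, ∑ j, F y j -
      ∑ o, ∑ x, max (∑ z, typLoad typ F o x z - 1) 0) :
    (Fintype.card X : ℝ) ^ s * (s * (3 * η / 8) - 25 * Fintype.card J * C -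
        32 * (Fintype.card O : ℝ) ^ 2 * (5 * Fintype.card J * C) ^ 2 / η) ≤
      ∑ g : Fin s → X, (sampleValue typ F g - #{a | g a ∈ S}) := by
  have hN0 : (0 : ℝ) < Fintype.card X := by exact_mod_cast Fintype.card_pos
  have hO0 : (0 : ℝ) < Fintype.card O := by exact_mod_cast Fintype.card_pos
  have hs0 : (0 : ℝ) < s := by exact_mod_cast hs
  have h1 := sum_injective_ge hs hF
  obtain ⟨θ, hθ⟩ : ∃ θ, θ = η / (8 * Fintype.card O) := ⟨_, rfl⟩
  have hθ0 : 0 < θ := by rw [hθ]; positivity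
  have h2 : ∀ o, ∀ a : Fin s, _ := fun o a =>
    sampled_excess_le a (typLoad typ F o) hθ0 (typLoad_nonneg (fun y j => (hF y j).1) o)
      (card_mul_typLoad_le hF hC o)
  have h3 : ∑ g : Fin s → X, (#{a | g a ∈ S} : ℝ) =
      (Fintype.card X : ℝ) ^ s * (s * #S / Fintype.card X) := by
    have h4 : ∀ a : Fin s, ∑ g : Fin s → X, (if g a ∈ S then (1 : ℝ) else 0) =
        (Fintype.card X : ℝ) ^ s * #S / Fintype.card X := by
      intro a
      have := sum_apply_coord a fun x => if x ∈ S then (1 : ℝ) else 0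
      rw [eq_div_iff hN0.ne', mul_comm, this]
      simp
    simp only [card_filter, Nat.cast_sum, Nat.cast_ite, Nat.cast_one, Nat.cast_zero]
    rw [sum_comm, sum_congr rfl fun a _ => h4 a, sum_const, card_univ, Fintype.card_fin,
      nsmul_eq_mul]
    ring
  rw [sum_sub_distrib, h3]
  simp only [sampleValue]
  rw [sum_sub_distrib]
  have h5 : ∑ g : Fin s → X, ∑ o, ∑ a : Fin s, max ((Fintype.card X : ℝ) ^ 4 / s ^ 4 *
      ∑ κ ∈ injAvoid s a, typLoad typ F o (g a) (g ∘ κ) - 1) 0 ≤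
      (Fintype.card X : ℝ) ^ s * (s * (∑ o, ∑ x, max (∑ z, typLoad typ F o x z - 1) 0) /
        Fintype.card X + s * Fintype.card O * θ +
        Fintype.card O * (4 * (5 * Fintype.card J * C) ^ 2 / θ)) := by
    rw [sum_comm]
    simp only [sum_comm (s := (univ : Finset (Fin s → X)))]
    calc _ ≤ ∑ o, ∑ a : Fin s, _ := sum_le_sum fun o _ => sum_le_sum fun a _ => h2 o a
      _ = _ := by
        simp only [sum_const, card_univ, Fintype.card_fin, nsmul_eq_mul, ← mul_sum,
          sum_add_distrib, ← sum_div]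
        field_simp
  have h6 : (Fintype.card O : ℝ) * (4 * (5 * Fintype.card J * C) ^ 2 / θ) =
      32 * (Fintype.card O : ℝ) ^ 2 * (5 * Fintype.card J * C) ^ 2 / η := by
    rw [hθ]; field_simp; ring
  have h7 : s * Fintype.card O * θ = s * (η / 8) := by rw [hθ]; field_simp
  rw [h6, h7] at h5
  obtain ⟨Tt, hTt⟩ : ∃ T, T = ∑ y, ∑ j, F y j := ⟨_, rfl⟩
  obtain ⟨Ex, hEx⟩ : ∃ T, T = ∑ o, ∑ x, max (∑ z, typLoad typ F o x z - 1) 0 := ⟨_, rfl⟩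
  rw [← hTt, ← hEx] at hV
  rw [← hTt] at h1
  rw [← hEx] at h5
  have h8 : s * (η / 2) ≤ s * Tt / Fintype.card X - s * Ex / Fintype.card X -
      s * #S / Fintype.card X := by
    rw [← sub_div, ← sub_div, le_div_iff₀ hN0]
    have : s * (η / 2 * Fintype.card X) ≤ s * (Tt - Ex - #S) :=
      mul_le_mul_of_nonneg_left (by linarith) hs0.le
    linarith
  have h9 := mul_le_mul_of_nonneg_left h8 (by positivity : 0 ≤ (Fintype.card X : ℝ) ^ s)
  refine le_trans ?_ (sub_le_sub_right (sub_le_sub h1 h5) _)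
  rw [← mul_sub, ← mul_sub]
  refine mul_le_mul_of_nonneg_left ?_ (by positivity)
  linarith

end Sampling

/-- A positive proportion of the samples are injective, have large value, and share the same
support pattern. -/
lemma exists_sample_pattern {J O : Type} [Fintype J] [Fintype O] [DecidableEq O] [Nonempty O]
    [Nonempty J] (typ : Fin 5 → J → O) {C η : ℝ} (hC : 0 < C) (hη : 0 < η) :
    ∃ s : ℕ, 0 < s ∧ ∃ δ : ℝ, 0 < δ ∧ ∃ N₀ : ℕ, ∀ (X : Type) [Fintype X] [DecidableEq X]
      (F : (Fin 5 → X) → J → ℝ) (S : Finset X), N₀ ≤ Fintype.card X →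
      (∀ y j, 0 ≤ F y j ∧ (Fintype.card X : ℝ) ^ 4 * F y j ≤ C) →
      (#S : ℝ) ≤ (1 - η) * Fintype.card X →
      (1 - η / 2) * Fintype.card X ≤ ∑ y, ∑ j, F y j -
        ∑ o, ∑ x, max (∑ z, typLoad typ F o x z - 1) 0 →
      ∃ P : Finset (Fin s → X), δ * (Fintype.card X : ℝ) ^ s ≤ #P ∧ P.Nonempty ∧
        (∀ g ∈ P, Function.Injective g ∧ s * (η / 8) ≤ sampleValue typ F g - #{a | g a ∈ S}) ∧
        ∀ g ∈ P, ∀ g' ∈ P, (∀ ι j, F (g ∘ ι) j ≠ 0 → F (g' ∘ ι) j ≠ 0) ∧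
          ∀ a, g a ∈ S ↔ g' a ∈ S := by
  classical
  have hJ0 : (0 : ℝ) < Fintype.card J := by exact_mod_cast Fintype.card_pos
  obtain ⟨s₀, hs₀⟩ := exists_nat_ge ((25 * Fintype.card J * C +
        32 * (Fintype.card O : ℝ) ^ 2 * (5 * Fintype.card J * C) ^ 2 / η) / (η / 8))
  obtain ⟨s, hs⟩ : ∃ s, s = s₀ + 1 := ⟨_, rfl⟩
  have hs0 : (0 : ℝ) < s := by rw [hs]; positivity
  have hs1 : 25 * Fintype.card J * C +
        32 * (Fintype.card O : ℝ) ^ 2 * (5 * Fintype.card J * C) ^ 2 / η ≤ s * (η / 8) := by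
    rw [div_le_iff₀ (by positivity)] at hs₀
    refine hs₀.trans ?_
    rw [hs]; push_cast
    linarith
  let K := Finset ((Fin 5 → Fin s) × J) × Finset (Fin s)
  obtain ⟨m, hm⟩ : ∃ m, m = s * (η / 8) := ⟨_, rfl⟩
  obtain ⟨b, hb⟩ : ∃ b, b = s * (Fintype.card J * C) := ⟨_, rfl⟩
  have hm0 : 0 < m := by rw [hm]; positivity
  have hb0 : 0 < b := by rw [hb]; positivity
  have hK0 : (0 : ℝ) < Fintype.card K := by exact_mod_cast Fintype.card_pos
  obtain ⟨N₁, hN₁⟩ := exists_nat_ge ((s : ℝ) ^ 2 / (m / (2 * b)))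
  refine ⟨s, by omega, m / (2 * b * Fintype.card K), by positivity, N₁ + 1, ?_⟩
  intro X _ _ F S hN hF hS hV
  have hne : Nonempty X := Fintype.card_pos_iff.1 (by omega)
  have hN0 : (0 : ℝ) < Fintype.card X := by exact_mod_cast Fintype.card_pos
  have hmean := sum_sampleValue_ge typ (s := s) (by omega) hC.le hη hF S hS hV
  have hcardg : (Fintype.card (Fin s → X) : ℝ) = (Fintype.card X : ℝ) ^ s := by simp
  obtain ⟨P, hP1, hP2, hP3, hP4⟩ := exists_large_fiber (G := Fin s → X) (K := K)
    (fun g => sampleValue typ F g - #{a | g a ∈ S})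
    (fun g => (({p | F (g ∘ p.1) p.2 ≠ 0} : Finset _), ({a | g a ∈ S} : Finset (Fin s))))
    ({g | ¬ Function.Injective g} : Finset (Fin s → X)) hm0 hb0
    (by
      refine le_trans ?_ hmean
      rw [hcardg, mul_comm]
      refine mul_le_mul_of_nonneg_left ?_ (by positivity)
      rw [hm]; linarith)
    (by
      intro g
      have h1 : sampleValue typ F g ≤ b := by
        have h2 : 0 ≤ ∑ o, ∑ a : Fin s, max ((Fintype.card X : ℝ) ^ 4 / s ^ 4 *
            ∑ κ ∈ injAvoid s a, typLoad typ F o (g a) (g ∘ κ) - 1) 0 :=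
          sum_nonneg fun _ _ => sum_nonneg fun _ _ => le_max_right _ _
        have h3 : (Fintype.card X : ℝ) ^ 4 *
            (∑ ι : Fin 5 → Fin s with Function.Injective ι, ∑ j, F (g ∘ ι) j) ≤
            s ^ 5 * (Fintype.card J * C) := by
          simp only [mul_sum]
          refine (sum_le_sum fun ι _ => sum_le_sum fun j _ => (hF _ j).2).trans ?_
          rw [sum_const, sum_const, card_univ, nsmul_eq_mul, nsmul_eq_mul]
          refine mul_le_mul_of_nonneg_right ?_ (by positivity)
          have : #({ι : Fin 5 → Fin s | Function.Injective ι} : Finset _) ≤ s ^ 5 :=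
            (card_filter_le _ _).trans (by simp)
          exact_mod_cast this
        have h4 : (Fintype.card X : ℝ) ^ 4 / s ^ 4 *
            (∑ ι : Fin 5 → Fin s with Function.Injective ι, ∑ j, F (g ∘ ι) j) ≤ b := by
          rw [div_mul_eq_mul_div, div_le_iff₀ (by positivity), hb]
          refine h3.trans_eq ?_
          ring
        simp only [sampleValue]
        linarith
      have h2 : (0 : ℝ) ≤ #{a | g a ∈ S} := by positivity
      linarith)
    (by
      have h1 := card_not_injective_le X s
      have h2 : (s : ℝ) ^ 2 ≤ m / (2 * b) * Fintype.card X := by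
        rw [div_le_iff₀ (by positivity)] at hN₁
        refine hN₁.trans ?_
        rw [mul_comm]
        refine mul_le_mul_of_nonneg_left ?_ (by positivity)
        exact_mod_cast (by omega : N₁ ≤ Fintype.card X)
      rw [hcardg]
      refine le_of_mul_le_mul_right (h1.trans ?_) hN0
      calc _ ≤ m / (2 * b) * Fintype.card X * (Fintype.card X : ℝ) ^ s := by gcongr
        _ = _ := by ring)
    Fintype.card_pos
  refine ⟨P, by rw [← hcardg]; exact hP1, hP2, ?_, ?_⟩
  · intro g hg
    have := hP3 g hg
    simp only [mem_filter, mem_univ, true_and, not_not] at this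
    rw [← hm]
    exact ⟨this.2, this.1⟩
  · intro g hg g' hg'
    have h := hP4 g hg g' hg'
    rw [Prod.mk.injEq] at h
    refine ⟨fun ι j hne => ?_, fun a => ?_⟩
    · have := (Finset.ext_iff.1 h.1 (ι, j)).1 (by simpa using hne)
      simpa using this
    · simpa using Finset.ext_iff.1 h.2 a

/-- Dense subsets of `X ^ s` contain large combinatorial boxes. -/
lemma exists_box (s D : ℕ) : ∀ δ : ℝ, 0 < δ → ∃ N₀ : ℕ, ∀ (X : Type) [Fintype X] [DecidableEq X]
    (P : Finset (Fin s → X)), N₀ ≤ Fintype.card X → δ * (Fintype.card X : ℝ) ^ s ≤ #P →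
    ∃ A : Fin s → Fin (D + 1) → X, (∀ a, Function.Injective (A a)) ∧
      ∀ c : Fin s → Fin (D + 1), (fun a => A a (c a)) ∈ P := by
  induction s with
  | zero =>
    intro δ hδ
    refine ⟨0, fun X _ _ P _ hP => ⟨fun a => a.elim0, fun a => a.elim0, fun c => ?_⟩⟩
    have : 0 < #P := by
      have : (0 : ℝ) < #P := hδ.trans_le (by simpa using hP)
      exact_mod_cast this
    obtain ⟨g, hg⟩ := card_pos.1 this
    convert hg
  | succ s ih =>
    intro δ hδ
    obtain ⟨N₁, hN₁⟩ := ih (δ ^ (D + 1) / 2) (by positivity)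
    obtain ⟨N₂, hN₂⟩ := exists_nat_gt (((D + 1 : ℕ) : ℝ) ^ 2 / (δ ^ (D + 1) / 2))
    refine ⟨N₁ + N₂ + 1, fun X _ _ P hN hP => ?_⟩
    have hne : Nonempty X := Fintype.card_pos_iff.1 (by omega)
    have hN0 : (0 : ℝ) < Fintype.card X := by exact_mod_cast Fintype.card_pos
    have hNN₂ : ((D + 1 : ℕ) : ℝ) ^ 2 < δ ^ (D + 1) / 2 * Fintype.card X := by
      rw [div_lt_iff₀ (by positivity)] at hN₂
      refine hN₂.trans_le ?_
      rw [mul_comm]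
      refine mul_le_mul_of_nonneg_left ?_ (by positivity)
      exact_mod_cast (by omega : N₂ ≤ Fintype.card X)
    have hinj := card_not_injective_le X (D + 1)
    let Q : (Fin (D + 1) → X) → Finset (Fin s → X) :=
      fun u => {z | ∀ c, (Fin.cons (u c) z : Fin (s + 1) → X) ∈ P}
    let d : (Fin s → X) → ℝ := fun z => #{x | (Fin.cons x z : Fin (s + 1) → X) ∈ P}
    have hsumd : ∑ z, d z = #P := by
      have : #P = ∑ z : Fin s → X, #{x | (Fin.cons x z : Fin (s + 1) → X) ∈ P} := by
        simp only [card_filter]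
        rw [← Fintype.sum_prod_type_right'
          (f := fun (x : X) (z : Fin s → X) => if (Fin.cons x z : Fin (s + 1) → X) ∈ P then 1 else 0)]
        refine Eq.trans ?_ ((Fin.consEquiv (fun _ : Fin (s + 1) => X)).sum_comp
          (fun y => if y ∈ P then 1 else 0)).symm
        simp
      rw [this]; push_cast; rfl
    have hsumQ : ∑ u, (#(Q u) : ℝ) = ∑ z, d z ^ (D + 1) := by
      have : ∀ z, d z ^ (D + 1) = ∑ u : Fin (D + 1) → X,
          if ∀ c, (Fin.cons (u c) z : Fin (s + 1) → X) ∈ P then (1 : ℝ) else 0 := by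
        intro z
        have h1 : (#(Fintype.piFinset fun _ : Fin (D + 1) =>
          ({x | (Fin.cons x z : Fin (s + 1) → X) ∈ P} : Finset X)) : ℝ) = d z ^ (D + 1) := by
          simp [d]
        rw [← h1, ← sum_filter, sum_const, nsmul_eq_mul, mul_one]
        congr 2
        ext u
        simp
      simp only [this]
      rw [sum_comm]
      refine sum_congr rfl fun u _ => ?_
      simp [Q]
    have hcz : (Fintype.card (Fin s → X) : ℝ) = (Fintype.card X : ℝ) ^ s := by simp
    have hcu : (Fintype.card (Fin (D + 1) → X) : ℝ) = (Fintype.card X : ℝ) ^ (D + 1) := by simp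
    have hJ : (Fintype.card X : ℝ) ^ s * (δ * Fintype.card X) ^ (D + 1) ≤ ∑ u, (#(Q u) : ℝ) := by
      have h2 := pow_sum_div_card_le_sum_pow (s := (univ : Finset (Fin s → X))) (f := d)
        (fun _ _ => by positivity) D
      rw [hsumQ]
      refine le_trans ?_ h2
      rw [card_univ, hcz, le_div_iff₀ (by positivity), hsumd]
      calc _ = (δ * (Fintype.card X : ℝ) ^ (s + 1)) ^ (D + 1) := by ring
        _ ≤ _ := by gcongr
    obtain ⟨u, hu1, hu2⟩ : ∃ u, Function.Injective u ∧
        δ ^ (D + 1) / 2 * (Fintype.card X : ℝ) ^ s ≤ #(Q u) := by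
      by_contra hcon
      push Not at hcon
      have h1 : ∑ u, (#(Q u) : ℝ) ≤ ∑ u : Fin (D + 1) → X,
          (δ ^ (D + 1) / 2 * (Fintype.card X : ℝ) ^ s +
            if ¬ Function.Injective u then (Fintype.card X : ℝ) ^ s else 0) := by
        refine sum_le_sum fun u _ => ?_
        by_cases hu : Function.Injective u
        · simpa [hu] using (hcon u hu).le
        · rw [if_pos hu]
          have : (#(Q u) : ℝ) ≤ (Fintype.card X : ℝ) ^ s := by
            rw [← hcz]; exact_mod_cast card_le_univ _
          have h3 : 0 ≤ δ ^ (D + 1) / 2 * (Fintype.card X : ℝ) ^ s := by positivity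
          linarith
      rw [sum_add_distrib, sum_const, ← sum_filter, sum_const, card_univ, nsmul_eq_mul,
        nsmul_eq_mul, hcu] at h1
      have h2 := mul_le_mul_of_nonneg_right (hJ.trans h1) hN0.le
      have h3 := mul_le_mul_of_nonneg_right hinj
        (by positivity : 0 ≤ (Fintype.card X : ℝ) ^ s)
      have h4 := mul_lt_mul_of_pos_right hNN₂
        (by positivity : 0 < (Fintype.card X : ℝ) ^ s * (Fintype.card X : ℝ) ^ (D + 1))
      rw [mul_pow] at h2
      ring_nf at h2 h3 h4
      linarith
    obtain ⟨A, hA1, hA2⟩ := hN₁ X (Q u) (by omega) hu2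
    refine ⟨Fin.cons u A, ?_, ?_⟩
    · intro a
      refine Fin.cases ?_ (fun a => ?_) a
      · simpa using hu1
      · simpa using hA1 a
    · intro c
      have := hA2 (fun a => c a.succ)
      simp only [Q, mem_filter, mem_univ, true_and] at this
      convert this (c 0) using 1
      funext a
      refine Fin.cases ?_ (fun a => ?_) a <;> simp

/-- The elements of each fibre of a map can be ranked. -/
lemma exists_fiber_rank {Y Q : Type*} [Fintype Y] [DecidableEq Q] (f : Y → Q) :
    ∃ rk : Y → ℕ, (∀ y y', f y = f y' → rk y = rk y' → y = y') ∧
      ∀ y, rk y < #{y' | f y' = f y} := by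
  classical
  let e : ∀ q, {y // f y = q} ≃ Fin (Fintype.card {y // f y = q}) := fun q => Fintype.equivFin _
  have hrk : ∀ y q (h : f y = q), (e (f y) ⟨y, rfl⟩ : ℕ) = e q ⟨y, h⟩ := by
    rintro y q rfl; rfl
  refine ⟨fun y => e (f y) ⟨y, rfl⟩, fun y y' hf h => ?_, fun y => ?_⟩
  · simp only [hrk y (f y') hf] at h
    have := (e (f y')).injective (Fin.ext h)
    simpa using this
  · refine (Fin.isLt _).trans_eq ?_
    rw [Fintype.card_subtype]

/-- Edges on a set of points can be placed in a blow-up with `D + 1` copies of every point, after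
deleting a number of edges that is at most the total excess load. -/
lemma exists_blowup_placement {Cp Q : Type*} [Fintype Cp] [Fintype Q] [DecidableEq Cp] [DecidableEq Q]
    (pt : Cp → Fin 5 → Q) (D : ℕ) :
    ∃ (T : Finset Cp) (τ : Cp → Fin 5 → Fin (D + 1)),
      (∀ c ∈ T, ∀ c' ∈ T, ∀ i i', pt c i = pt c' i' → τ c i = τ c' i' → c = c' ∧ i = i') ∧
      Fintype.card Cp ≤ #T + ∑ q, (#{t : Cp × Fin 5 | pt t.1 t.2 = q} - (D + 1)) := by
  obtain ⟨rk, hrk1, hrk2⟩ := exists_fiber_rank fun t : Cp × Fin 5 => pt t.1 t.2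
  refine ⟨univ.filter fun c => ∀ i, rk (c, i) < D + 1, fun c i => Fin.ofNat (D + 1) (rk (c, i)), ?_, ?_⟩
  · intro c hc c' hc' i i' hp hτ
    simp only [mem_filter, mem_univ, true_and] at hc hc'
    have := congrArg Fin.val hτ
    simp only [Fin.val_ofNat, Nat.mod_eq_of_lt (hc i), Nat.mod_eq_of_lt (hc' i')] at this
    have := hrk1 (c, i) (c', i') hp this
    simpa using this
  · have h1 : #({c | ¬ ∀ i, rk (c, i) < D + 1} : Finset Cp) ≤
        #({t | D + 1 ≤ rk t} : Finset (Cp × Fin 5)) := by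
      refine (card_le_card ?_).trans (card_image_le (f := Prod.fst))
      intro c hc
      simp only [mem_filter, mem_univ, true_and, not_forall, not_lt] at hc
      obtain ⟨i, hi⟩ := hc
      exact mem_image.2 ⟨(c, i), by simpa using hi, rfl⟩
    have h2 : #({t | D + 1 ≤ rk t} : Finset (Cp × Fin 5)) ≤
        ∑ q, (#{t : Cp × Fin 5 | pt t.1 t.2 = q} - (D + 1)) := by
      rw [card_eq_sum_card_fiberwise (f := fun t : Cp × Fin 5 => pt t.1 t.2) (t := univ)
        (fun _ _ => mem_coe.2 (mem_univ _))]
      refine sum_le_sum fun q _ => ?_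
      rw [← Nat.card_Ico]
      refine card_le_card_of_injOn rk ?_ ?_
      · intro t ht
        simp only [coe_filter, mem_filter, mem_univ, true_and, Set.mem_ofPred_eq] at ht
        have := hrk2 t
        simp only [ht.2] at this
        simp only [coe_Ico, Set.mem_Ico]
        exact ⟨ht.1, this⟩
      · intro t ht t' ht' h
        simp only [coe_filter, mem_filter, mem_univ, true_and, Set.mem_ofPred_eq] at ht ht'
        exact hrk1 t t' (ht.2.trans ht'.2.symm) h
    have h3 := card_filter_add_card_filter_not (s := (univ : Finset Cp))
      (fun c => ∀ i, rk (c, i) < D + 1)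
    rw [card_univ] at h3
    omega

lemma sum_injective_filter_eq {s : ℕ} (a : Fin s) (i : Fin 5) (G : (Fin 5 → Fin s) → ℝ) :
    ∑ ι : Fin 5 → Fin s with Function.Injective ι, (if ι i = a then G ι else 0) =
      ∑ κ ∈ injAvoid s a, G (Fin.insertNth i a κ) := by
  rw [← sum_filter, filter_filter]
  refine sum_nbij' (fun ι => Fin.removeNth i ι) (fun κ => Fin.insertNth i a κ) ?_ ?_ ?_ ?_ ?_
  · intro ι hι
    simp only [mem_filter, mem_univ, true_and] at hι
    simp only [injAvoid, mem_filter, mem_univ, true_and, Fin.removeNth]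
    exact ⟨hι.1.comp Fin.succAbove_right_injective, fun k hk =>
      Fin.succAbove_ne i k (hι.1 (hk.trans hι.2.symm))⟩
  · intro κ hκ
    simp only [injAvoid, mem_filter, mem_univ, true_and] at hκ
    simp only [mem_filter, mem_univ, true_and, Fin.insertNth_apply_same, and_true]
    intro p q hpq
    rcases Fin.eq_self_or_eq_succAbove i p with rfl | ⟨p', rfl⟩
    · rcases Fin.eq_self_or_eq_succAbove p q with rfl | ⟨q', rfl⟩
      · rfl
      · simp at hpq
        exact absurd hpq.symm (hκ.2 _)
    · rcases Fin.eq_self_or_eq_succAbove i q with rfl | ⟨q', rfl⟩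
      · simp at hpq
        exact absurd hpq (hκ.2 _)
      · simp only [Fin.insertNth_apply_succAbove] at hpq
        rw [hκ.1 hpq]
  · intro ι hι
    simp only [mem_filter, mem_univ, true_and] at hι
    rw [← hι.2]
    exact Fin.insertNth_self_removeNth i ι
  · intro κ _
    simp
  · intro ι hι
    simp only [mem_filter, mem_univ, true_and] at hι
    congr 1
    rw [← hι.2]
    exact (Fin.insertNth_self_removeNth i ι).symm

/-- The load of the sampled pattern at the point `(a, o)`. -/
lemma sum_pattern_load {J O : Type} [Fintype J] [DecidableEq O] (typ : Fin 5 → J → O) {X : Type}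
    (F : (Fin 5 → X) → J → ℝ) {s : ℕ} (g : Fin s → X) (a : Fin s) (o : O) :
    ∑ ι : Fin 5 → Fin s with Function.Injective ι, ∑ j, ∑ i,
      (if (ι i, typ i j) = (a, o) then F (g ∘ ι) j else 0) =
    ∑ κ ∈ injAvoid s a, typLoad typ F o (g a) (g ∘ κ) := by
  have h1 : ∀ ι : Fin 5 → Fin s, ∑ j, ∑ i,
      (if (ι i, typ i j) = (a, o) then F (g ∘ ι) j else 0) =
      ∑ i, if ι i = a then ∑ j, (if typ i j = o then F (g ∘ ι) j else 0) else 0 := by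
    intro ι
    rw [sum_comm]
    refine sum_congr rfl fun i _ => ?_
    by_cases h : ι i = a <;> simp [h]
  simp only [h1]
  rw [sum_comm]
  simp only [sum_injective_filter_eq a _ fun ι => ∑ j, (if typ _ j = o then F (g ∘ ι) j else 0)]
  rw [sum_comm]
  refine sum_congr rfl fun κ _ => ?_
  rw [typLoad]
  refine sum_congr rfl fun i _ => sum_congr rfl fun j _ => ?_
  have : g ∘ (Fin.insertNth i a κ : Fin 5 → Fin s) = Fin.insertNth i (g a) (g ∘ κ) := by
    funext k
    rcases Fin.eq_self_or_eq_succAbove i k with rfl | ⟨k', rfl⟩ <;> simp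
  rw [this]

/-- A fractional matching of value close to `card X` yields, for every set `S` of noticeably fewer
than `card X` groups, disjoint edges on a set `U` of groups that outnumber `S ∩ U`. -/
theorem exists_augmenting_edges {J O : Type} [Fintype J] [Fintype O] [DecidableEq J]
    [DecidableEq O] [Nonempty O]
    [Nonempty J] (typ : Fin 5 → J → O) {C η : ℝ} (hC : 0 < C) (hη : 0 < η) :
    ∃ N₀ : ℕ, ∀ (X : Type) [Fintype X] [DecidableEq X]
      (F : (Fin 5 → X) → J → ℝ) (S : Finset X), N₀ ≤ Fintype.card X →
      (∀ y j, 0 ≤ F y j ∧ (Fintype.card X : ℝ) ^ 4 * F y j ≤ C) →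
      (#S : ℝ) ≤ (1 - η) * Fintype.card X →
      (1 - η / 2) * Fintype.card X ≤ ∑ y, ∑ j, F y j -
        ∑ o, ∑ x, max (∑ z, typLoad typ F o x z - 1) 0 →
      ∃ (U : Finset X) (M : ℕ) (y : Fin M → Fin 5 → X) (j : Fin M → J),
        (∀ c, F (y c) (j c) ≠ 0) ∧ (∀ c i, y c i ∈ U) ∧
        (∀ c c' i i', y c i = y c' i' → typ i (j c) = typ i' (j c') → c = c' ∧ i = i') ∧
        #(S ∩ U) < M := by
  obtain ⟨s, hs, δ, hδ, N₁, hN₁⟩ := exists_sample_pattern typ hC hη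
  have hs0 : (0 : ℝ) < s := by exact_mod_cast hs
  obtain ⟨D, hD⟩ := exists_nat_gt ((Fintype.card J * s ^ 5 : ℝ) / (s * (η / 8)))
  rw [div_lt_iff₀ (by positivity)] at hD
  obtain ⟨N₂, hN₂⟩ := exists_box s D δ hδ
  refine ⟨N₁ + N₂, fun X _ _ F S hN hF hS hV => ?_⟩
  obtain ⟨P, hPc, ⟨g, hg⟩, hP1, hP2⟩ := hN₁ X F S (by omega) hF hS hV
  obtain ⟨A, hA1, hA2⟩ := hN₂ X P (by omega) hPc
  obtain ⟨L, hL⟩ : ∃ L : ℝ, L = (Fintype.card X : ℝ) ^ 4 / s ^ 4 := ⟨_, rfl⟩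
  have hL0 : 0 ≤ L := by rw [hL]; positivity
  let mult : (Fin 5 → Fin s) → J → ℕ := fun ι j => ⌊((D + 1 : ℕ) : ℝ) * (L * F (g ∘ ι) j)⌋₊
  have hnn : ∀ ι j, 0 ≤ ((D + 1 : ℕ) : ℝ) * (L * F (g ∘ ι) j) := fun ι j =>
    mul_nonneg (by positivity) (mul_nonneg hL0 (hF _ _).1)
  have hmle : ∀ ι j, (mult ι j : ℝ) ≤ ((D + 1 : ℕ) : ℝ) * (L * F (g ∘ ι) j) := fun ι j =>
    Nat.floor_le (hnn ι j)
  have hmge : ∀ ι j, ((D + 1 : ℕ) : ℝ) * (L * F (g ∘ ι) j) - 1 ≤ mult ι j := fun ι j =>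
    (Nat.sub_one_lt_floor _).le
  let Ed := {ι : Fin 5 → Fin s // Function.Injective ι} × J
  let Cp := Σ e : Ed, Fin (mult e.1.1 e.2)
  let pt : Cp → Fin 5 → Fin s × O := fun c i => (c.1.1.1 i, typ i c.1.2)
  obtain ⟨T, τ, hτ, hT⟩ := exists_blowup_placement pt D
  obtain ⟨hginj, hval⟩ := hP1 g hg
  have hcardCp : (Fintype.card Cp : ℝ) = ∑ ι : Fin 5 → Fin s with Function.Injective ι,
      ∑ j, (mult ι j : ℝ) := by
    simp only [Cp, Ed, Fintype.card_sigma, Fintype.card_fin, Fintype.sum_prod_type]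
    push_cast
    exact (sum_subtype (univ.filter fun ι : Fin 5 → Fin s => Function.Injective ι) (by simp)
      fun ι => ∑ j, (mult ι j : ℝ)).symm
  have hload : ∀ a o, (#{t : Cp × Fin 5 | pt t.1 t.2 = (a, o)} : ℝ) ≤
      ((D + 1 : ℕ) : ℝ) * (L * ∑ κ ∈ injAvoid s a, typLoad typ F o (g a) (g ∘ κ)) := by
    intro a o
    rw [← sum_pattern_load typ F g a o]
    have h1 : (#{t : Cp × Fin 5 | pt t.1 t.2 = (a, o)} : ℝ) =
        ∑ ι : Fin 5 → Fin s with Function.Injective ι, ∑ j, ∑ i,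
          (if (ι i, typ i j) = (a, o) then (mult ι j : ℝ) else 0) := by
      rw [sum_subtype (p := fun ι => Function.Injective ι)
        (univ.filter fun ι : Fin 5 → Fin s => Function.Injective ι) (by simp)
        (fun ι => ∑ j, ∑ i, (if (ι i, typ i j) = (a, o) then (mult ι j : ℝ) else 0))]
      simp only [card_filter, Nat.cast_sum, Nat.cast_ite, Nat.cast_one, Nat.cast_zero]
      rw [Fintype.sum_prod_type]
      simp only [Cp, Ed, Fintype.sum_sigma, Fintype.sum_prod_type, pt]
      refine sum_congr rfl fun ι _ => sum_congr rfl fun j _ => ?_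
      refine (sum_const (∑ i, if ((ι : Fin 5 → Fin s) i, typ i j) = (a, o) then (1 : ℝ)
        else 0)).trans ?_
      rw [card_univ, Fintype.card_fin, nsmul_eq_mul, mul_sum]
      simp only [mul_ite, mul_one, mul_zero]
    rw [h1]
    simp only [mul_sum]
    refine sum_le_sum fun ι _ => sum_le_sum fun j _ => sum_le_sum fun i _ => ?_
    split_ifs
    · exact hmle ι j
    · simp
  have hTbig : ((D + 1 : ℕ) : ℝ) * #{a | g a ∈ S} < #T := by
    have h1 : (Fintype.card Cp : ℝ) ≤ #T +
        ∑ q : Fin s × O, ((#{t : Cp × Fin 5 | pt t.1 t.2 = q} - (D + 1) : ℕ) : ℝ) := by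
      exact_mod_cast hT
    have h2 : ∑ q : Fin s × O, ((#{t : Cp × Fin 5 | pt t.1 t.2 = q} - (D + 1) : ℕ) : ℝ) ≤
        ((D + 1 : ℕ) : ℝ) * ∑ o, ∑ a : Fin s, max (L *
          ∑ κ ∈ injAvoid s a, typLoad typ F o (g a) (g ∘ κ) - 1) 0 := by
      rw [Fintype.sum_prod_type, sum_comm]
      simp only [mul_sum (univ : Finset O), mul_sum (univ : Finset (Fin s))]
      refine sum_le_sum fun o _ => sum_le_sum fun a _ => ?_
      rw [mul_max_of_nonneg _ _ (by positivity), mul_zero]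
      rcases le_total (D + 1) (#{t : Cp × Fin 5 | pt t.1 t.2 = (a, o)}) with h | h
      · refine le_max_of_le_left ?_
        rw [Nat.cast_sub h]
        have := hload a o
        linarith
      · rw [Nat.sub_eq_zero_of_le h]
        simp
    have h3 : ((D + 1 : ℕ) : ℝ) * (L * ∑ ι : Fin 5 → Fin s with Function.Injective ι,
        ∑ j, F (g ∘ ι) j) - Fintype.card J * s ^ 5 ≤ Fintype.card Cp := by
      rw [hcardCp]
      have h4 : ∑ ι : Fin 5 → Fin s with Function.Injective ι, ∑ j,
          (((D + 1 : ℕ) : ℝ) * (L * F (g ∘ ι) j) - 1) ≤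
          ∑ ι : Fin 5 → Fin s with Function.Injective ι, ∑ j, (mult ι j : ℝ) :=
        sum_le_sum fun ι _ => sum_le_sum fun j _ => hmge ι j
      refine le_trans ?_ h4
      simp only [sum_sub_distrib, sum_const, card_univ, nsmul_eq_mul, mul_one, ← mul_sum]
      have h5 : (#({ι : Fin 5 → Fin s | Function.Injective ι} : Finset _) : ℝ) ≤ s ^ 5 := by
        exact_mod_cast (card_filter_le _ _).trans (by simp)
      have := mul_le_mul_of_nonneg_right h5 (by positivity : (0 : ℝ) ≤ Fintype.card J)
      linarith
    rw [sampleValue, ← hL] at hval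
    have h6 := mul_le_mul_of_nonneg_left hval (by positivity : (0 : ℝ) ≤ ((D + 1 : ℕ) : ℝ))
    have h7 : (D : ℝ) * (s * (η / 8)) ≤ ((D + 1 : ℕ) : ℝ) * (s * (η / 8)) := by
      push_cast
      have : 0 ≤ s * (η / 8) := by positivity
      linarith
    rw [mul_sub, mul_sub] at h6
    linarith
  have hsel : ∀ a t a' t', A a t = A a' t' → a = a' ∧ t = t' := by
    intro a t a' t' h
    by_cases haa : a = a'
    · subst haa
      exact ⟨rfl, hA1 a h⟩
    · exfalso
      have hm := hA2 (fun b => if b = a then t else t')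
      have hi := (hP1 _ hm).1
      apply haa
      apply hi
      simp [Ne.symm haa, h]
  let U : Finset X := univ.image fun t : Fin s × Fin (D + 1) => A t.1 t.2
  let eT := T.equivFin
  refine ⟨U, #T, fun c i => A ((eT.symm c).1.1.1.1 i) (τ (eT.symm c).1 i),
    fun c => (eT.symm c).1.1.2, ?_, ?_, ?_, ?_⟩
  · intro c
    beta_reduce
    generalize (eT.symm c).1 = e
    have hne : F (g ∘ e.1.1.1) e.1.2 ≠ 0 := by
      intro h0
      have hlt : 0 < mult e.1.1.1 e.1.2 := e.2.pos
      simp [mult, h0] at hlt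
    have hm := hA2 (Function.extend e.1.1.1 (τ e) 0)
    have := (hP2 g hg _ hm).1 _ _ hne
    convert this using 2
    funext i
    simp [e.1.1.2.extend_apply]
  · intro c i
    exact mem_image.2 ⟨(_, _), mem_univ _, rfl⟩
  · intro c c' i i' h1 h2
    obtain ⟨h3, h4⟩ := hsel _ _ _ _ h1
    have := hτ _ (eT.symm c).2 _ (eT.symm c').2 i i' (Prod.ext h3 h2) h4
    exact ⟨eT.symm.injective (Subtype.ext this.1), this.2⟩
  · have h1 : S ∩ U ⊆ (({a | g a ∈ S} : Finset (Fin s)) ×ˢ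
        (univ : Finset (Fin (D + 1)))).image fun t => A t.1 t.2 := by
      intro x hx
      simp only [U, mem_inter, mem_image, mem_univ, true_and] at hx
      obtain ⟨hxS, ⟨a, t⟩, rfl⟩ := hx
      have hm := hA2 (fun _ => t)
      refine mem_image.2 ⟨(a, t), ?_, rfl⟩
      simp only [mem_product, mem_filter, mem_univ, true_and, and_true]
      exact ((hP2 g hg _ hm).2 a).2 hxS
    have h2 := (card_le_card h1).trans card_image_le
    rw [card_product, card_univ, Fintype.card_fin, mul_comm] at h2
    have h3 : (D + 1) * #{a | g a ∈ S} < #T := by exact_mod_cast hTbig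
    omega

/-- The vertices in `A` can be matched, by disjoint edges, into `B`. -/
def MatchIn {X V : Type} (R : X → (Fin 4 → V) → Prop) (A : Finset X) (B : Finset V) : Prop :=
  ∃ v : X → Fin 4 → V, (∀ x ∈ A, R x (v x)) ∧ (∀ x ∈ A, ∀ i, v x i ∈ B) ∧
    ∀ x ∈ A, ∀ y ∈ A, ∀ i j, v x i = v y j → x = y

lemma sum_insertNth {X : Type} [Fintype X] [DecidableEq X] (i : Fin 5) (x : X)
    (G : (Fin 5 → X) → ℝ) :
    ∑ z : Fin 4 → X, G (Fin.insertNth i x z) = ∑ y : Fin 5 → X, if y i = x then G y else 0 := by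
  rw [← sum_filter]
  refine sum_nbij' (fun z => Fin.insertNth i x z) (fun y => Fin.removeNth i y) ?_ ?_ ?_ ?_ ?_
  · intro z _; simp
  · intro y _; simp
  · intro z _; simp
  · intro y hy
    simp only [mem_filter, mem_univ, true_and] at hy
    rw [← hy]
    exact Fin.insertNth_self_removeNth i y
  · intro z _; rfl

/-- The class of a vertex of an edge whose `V`-vertices lie in the columns `j`. -/
def columnType (i : Fin 5) (j : Fin 4 → Fin 4) : Option (Fin 4) :=
  (Fin.cons none (fun k => some (j k)) : Fin 5 → Option (Fin 4)) i

lemma sum_columns {X V : Type} [Fintype X] [Fintype V] (σ : X × Fin 4 ≃ V)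
    (G : X → (Fin 4 → V) → ℝ) :
    ∑ y : Fin 5 → X, ∑ j : Fin 4 → Fin 4, G (y 0) (fun i => σ (y i.succ, j i)) =
      ∑ x, ∑ w, G x w := by
  rw [← (Fin.consEquiv (fun _ : Fin 5 => X)).sum_comp, Fintype.sum_prod_type]
  refine sum_congr rfl fun x _ => ?_
  refine (Fintype.sum_prod_type'
    (f := fun (z : Fin 4 → X) (j : Fin 4 → Fin 4) => G x (fun i => σ (z i, j i)))).symm.trans ?_
  exact ((Equiv.arrowProdEquivProdArrow (Fin 4) (fun _ => X) (fun _ => Fin 4)).symm.trans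
    (Equiv.piCongrRight fun _ => σ)).sum_comp (fun w => G x w)

lemma sum_typLoad_columns {X V : Type} [Fintype X] [Fintype V] [DecidableEq X] [DecidableEq V]
    (σ : X × Fin 4 ≃ V) (f : X → (Fin 4 → V) → ℝ) :
    ∑ o, ∑ x, max (∑ z, typLoad columnType
      (fun y j => f (y 0) (fun i => σ (y i.succ, j i))) o x z - 1) 0 =
    ∑ x, max (∑ w, f x w - 1) 0 +
      ∑ v, max (∑ x, ∑ w, f x w * ∑ i, (if w i = v then 1 else 0) - 1) 0 := by
  have h1 : ∀ o x, ∑ z, typLoad columnType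
      (fun y j => f (y 0) (fun i => σ (y i.succ, j i))) o x z =
      ∑ y : Fin 5 → X, ∑ j : Fin 4 → Fin 4, ∑ i : Fin 5,
        if y i = x ∧ columnType i j = o then f (y 0) (fun i => σ (y i.succ, j i)) else 0 := by
    intro o x
    simp only [typLoad]
    rw [sum_comm]
    refine (sum_congr rfl fun i _ => sum_insertNth i x (fun y => ∑ j, if columnType i j = o then
      f (y 0) (fun i => σ (y i.succ, j i)) else 0)).trans ?_
    rw [sum_comm]
    refine sum_congr rfl fun y _ => ?_
    rw [sum_comm]
    refine sum_congr rfl fun i _ => ?_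
    by_cases h : y i = x <;> simp [h]
  have hnone : ∀ x, ∑ z, typLoad columnType
      (fun y j => f (y 0) (fun i => σ (y i.succ, j i))) none x z = ∑ w, f x w := by
    intro x
    rw [h1]
    refine Eq.trans ?_ ((sum_columns σ (fun x' w => if x' = x then f x' w else 0)).trans
      (by simp [sum_ite_irrel]))
    refine sum_congr rfl fun y _ => sum_congr rfl fun j _ => ?_
    rw [Fin.sum_univ_succ]
    simp [columnType]
  have hsome : ∀ k x, ∑ z, typLoad columnType
      (fun y j => f (y 0) (fun i => σ (y i.succ, j i))) (some k) x z =
      ∑ x', ∑ w, f x' w * ∑ i, (if w i = σ (x, k) then 1 else 0) := by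
    intro k x
    rw [h1, ← sum_columns σ (fun x' w => f x' w * ∑ i, (if w i = σ (x, k) then 1 else 0))]
    refine sum_congr rfl fun y _ => sum_congr rfl fun j _ => ?_
    rw [Fin.sum_univ_succ, mul_sum]
    simp [columnType]
  rw [Fintype.sum_option]
  simp only [hnone, hsome]
  congr 1
  rw [← σ.sum_comp, Fintype.sum_prod_type, sum_comm]

/-- A fractional matching with small weights yields an almost perfect matching. -/
theorem exists_matchIn_of_fractional {C η : ℝ} (hC : 0 < C) (hη : 0 < η) :
    ∃ N₀ : ℕ, ∀ (X V : Type) [Fintype X] [Fintype V] [DecidableEq X] [DecidableEq V]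
      (R : X → (Fin 4 → V) → Prop) (f : X → (Fin 4 → V) → ℝ),
      N₀ ≤ Fintype.card X → Fintype.card V = 4 * Fintype.card X →
      (∀ x w, R x w → Function.Injective w) →
      (∀ x w, 0 ≤ f x w ∧ (Fintype.card X : ℝ) ^ 4 * f x w ≤ C) →
      (∀ x w, f x w ≠ 0 → R x w) →
      (1 - η / 2) * Fintype.card X ≤ ∑ x, ∑ w, f x w - (∑ x, max (∑ w, f x w - 1) 0 +
        ∑ v, max (∑ x, ∑ w, f x w * ∑ i, (if w i = v then 1 else 0) - 1) 0) →
      ∃ S : Finset X, (1 - η) * Fintype.card X ≤ #S ∧ MatchIn R S univ := by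
  obtain ⟨N₀, hN₀⟩ := exists_augmenting_edges columnType hC hη
  refine ⟨N₀, fun X V _ _ _ _ R f hN hV hinj hf hfR hval => ?_⟩
  classical
  obtain ⟨S, hS, hmax⟩ := exists_max_image (univ.filter fun S : Finset X => MatchIn R S univ)
    (fun S => #S) ⟨∅, by
      have e : X × Fin 4 ≃ V := Fintype.equivOfCardEq (by simp [hV, mul_comm])
      exact mem_filter.2 ⟨mem_univ _, fun x i => e (x, i), by simp⟩⟩
  simp only [mem_filter, mem_univ, true_and] at hS hmax
  by_contra hcon
  push Not at hcon
  have hlt := hcon S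
  obtain ⟨v, hv1, -, hv3⟩ := hS
  have hSsmall : (#S : ℝ) ≤ (1 - η) * Fintype.card X := by
    by_contra h
    push Not at h
    exact hlt h.le ⟨v, hv1, by simp, hv3⟩
  obtain ⟨σ', hσ'⟩ := exists_equiv_extend_of_card_eq (α := X × Fin 4) (β := V) (t := univ)
    (by simp [hV, mul_comm]) (s := S ×ˢ univ) (f := fun p => v p.1 p.2) (subset_univ _) (by
      rintro ⟨x, i⟩ hx ⟨y, j⟩ hy h
      simp only [coe_product, Set.mem_prod, mem_coe, coe_univ, Set.mem_univ, and_true] at hx hy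
      have hxy := hv3 x hx y hy i j h
      subst hxy
      exact Prod.ext rfl (hinj _ _ (hv1 x hx) h))
  let σ : X × Fin 4 ≃ V := σ'.trans (Equiv.subtypeUnivEquiv (by simp))
  have hσ : ∀ x ∈ S, ∀ i, σ (x, i) = v x i := fun x hx i => hσ' (x, i) (by simp [hx])
  obtain ⟨U, M, y, j, hF, hU, hdis, hM⟩ := hN₀ X
    (fun y j => f (y 0) (fun i => σ (y i.succ, j i))) S hN (fun y j => hf _ _) hSsmall (by
      rw [sum_typLoad_columns, sum_columns σ f]
      exact hval)
  let w : Fin M → Fin 4 → V := fun c i => σ (y c i.succ, j c i)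
  have hy0 : Function.Injective fun c => y c 0 := fun c c' h => (hdis c c' 0 0 h rfl).1
  have hext : ∀ c, Function.extend (fun c => y c 0) w v (y c 0) = w c := fun c =>
    hy0.extend_apply w v c
  have hext' : ∀ x ∈ S \ U, Function.extend (fun c => y c 0) w v x = v x := by
    intro x hx
    refine Function.extend_apply' _ _ _ ?_
    rintro ⟨c, rfl⟩
    exact (mem_sdiff.1 hx).2 (hU c 0)
  have hww : ∀ c c' i i', w c i = w c' i' → c = c' := by
    intro c c' i i' h
    have := σ.injective h
    rw [Prod.mk.injEq] at this
    exact (hdis c c' i.succ i'.succ this.1 (by simp [columnType, this.2])).1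
  have hwv : ∀ c, ∀ x ∈ S \ U, ∀ i i', w c i ≠ v x i' := by
    intro c x hx i i' h
    rw [mem_sdiff] at hx
    rw [← hσ x hx.1] at h
    have := σ.injective h
    rw [Prod.mk.injEq] at this
    exact hx.2 (this.1 ▸ hU c i.succ)
  have hmatch : MatchIn R (S \ U ∪ univ.image fun c => y c 0) univ := by
    refine ⟨Function.extend (fun c => y c 0) w v, ?_, by simp, ?_⟩
    · intro x hx
      rcases mem_union.1 hx with hx | hx
      · rw [hext' x hx]
        exact hv1 x (mem_sdiff.1 hx).1
      · obtain ⟨c, -, rfl⟩ := mem_image.1 hx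
        rw [hext]
        exact hfR _ _ (hF c)
    · intro x hx x' hx' i i' h
      rcases mem_union.1 hx with hx | hx
      · rw [hext' x hx] at h
        rcases mem_union.1 hx' with hx' | hx'
        · rw [hext' x' hx'] at h
          exact hv3 x (mem_sdiff.1 hx).1 x' (mem_sdiff.1 hx').1 i i' h
        · obtain ⟨c', -, rfl⟩ := mem_image.1 hx'
          rw [hext] at h
          exact absurd h.symm (hwv _ _ hx _ _)
      · obtain ⟨c, -, rfl⟩ := mem_image.1 hx
        rw [hext] at h
        rcases mem_union.1 hx' with hx' | hx'
        · rw [hext' x' hx'] at h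
          exact absurd h (hwv _ _ hx' _ _)
        · obtain ⟨c', -, rfl⟩ := mem_image.1 hx'
          rw [hext] at h
          rw [hww _ _ _ _ h]
  have := hmax _ hmatch
  rw [card_union_of_disjoint, card_image_of_injective _ hy0, card_univ, Fintype.card_fin] at this
  · have h2 := card_sdiff_add_card_inter S U
    omega
  · rw [disjoint_left]
    intro x hx hx'
    obtain ⟨c, -, rfl⟩ := mem_image.1 hx'
    exact (mem_sdiff.1 hx).2 (hU c 0)

open Classical in
/-- A dense system either is close to extremal or has an almost perfect matching. -/
theorem exists_matchIn_or_extremal {ε : ℝ} (hε : 0 < ε) : ∃ γ : ℝ, 0 < γ ∧ ∀ η : ℝ, 0 < η →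
    ∃ N₀ : ℕ, ∀ (X V : Type) [Fintype X] [Fintype V] (R : X → (Fin 4 → V) → Prop),
      N₀ ≤ Fintype.card X → Fintype.card V = 4 * Fintype.card X →
      (∀ x w, R x w → Function.Injective w) →
      (∀ x v, (37 / 64 - γ) * (Fintype.card V : ℝ) ^ 3 ≤
        #{z : Fin 3 → V | R x (Fin.cons v z)}) →
      (∃ W : Finset V, #W = Fintype.card X ∧
        (edgesAvoiding R W : ℝ) ≤ ε * (Fintype.card V : ℝ) ^ 5) ∨
      ∃ S : Finset X, (1 - η) * Fintype.card X ≤ #S ∧ MatchIn R S univ := by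
  obtain ⟨γ, hγ, hmain⟩ := exists_edgesAvoiding_le_of_dual ε hε
  refine ⟨γ, hγ, fun η₀ hη₀ => ?_⟩
  obtain ⟨η, hη⟩ : ∃ η, η = min η₀ 1 := ⟨_, rfl⟩
  have hη0 : 0 < η := by rw [hη]; positivity
  have hη1 : η ≤ 1 := by rw [hη]; exact min_le_right _ _
  have hηη : η ≤ η₀ := by rw [hη]; exact min_le_left _ _
  obtain ⟨C, hC, hdual⟩ := hmain (η / 2) (by positivity) (by linarith)
  obtain ⟨N₀, hN₀⟩ := exists_matchIn_of_fractional hC hη0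
  refine ⟨N₀ + 1, fun X V _ _ R hN hV hinj hdeg => ?_⟩
  have hX0 : (0 : ℝ) < Fintype.card X := by exact_mod_cast (by omega : 0 < Fintype.card X)
  rcases capped_packing_duality
    (fun (e : X × (Fin 4 → V)) (p : X ⊕ V) => Sum.elim (fun x => if e.1 = x then (1 : ℝ) else 0)
      (fun v => ∑ i, if e.2 i = v then (1 : ℝ) else 0) p)
    (fun e => if R e.1 e.2 then C / (Fintype.card X : ℝ) ^ 4 else 0)
    (fun e => by positivity) ((1 - η / 2) * Fintype.card X) with ⟨f, hf1, hf2⟩ | ⟨w, hw1, hw2⟩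
  · right
    obtain ⟨S, hS, hM⟩ := hN₀ X V R (fun x w => f (x, w)) (by omega) hV hinj (by
        intro x w
        refine ⟨(hf1 (x, w)).1, ?_⟩
        have h := (hf1 (x, w)).2
        have h2 : f (x, w) ≤ C / (Fintype.card X : ℝ) ^ 4 := by
          refine h.trans ?_
          split_ifs
          · exact le_rfl
          · positivity
        rw [le_div_iff₀ (by positivity)] at h2
        linarith) (by
        intro x w hne
        by_contra hR
        have h := hf1 (x, w)
        simp only [hR, if_false] at h
        exact hne (le_antisymm h.2 h.1)) (by
        refine hf2.trans_eq ?_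
        rw [Fintype.sum_prod_type, Fintype.sum_sum_type]
        congr 2
        · refine sum_congr rfl fun x _ => ?_
          rw [Fintype.sum_prod_type, sum_comm]
          simp
        · refine sum_congr rfl fun v _ => ?_
          simp [Fintype.sum_prod_type])
    exact ⟨S, le_trans (by gcongr) hS, hM⟩
  · left
    refine hdual X V R (fun x => w (Sum.inl x)) (fun v => w (Sum.inr v)) (by omega) hV hdeg
      (fun v => hw1 _) ?_
    refine lt_of_eq_of_lt ?_ hw2
    rw [Fintype.sum_prod_type, Fintype.sum_sum_type]
    congr 1
    refine sum_congr rfl fun x _ => ?_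
    rw [mul_sum]
    refine sum_congr rfl fun e _ => ?_
    rw [Fintype.sum_sum_type]
    have h1 : ∑ v, (∑ i, if e i = v then (1 : ℝ) else 0) * w (Sum.inr v) =
        ∑ i, w (Sum.inr (e i)) := by
      simp only [sum_mul]
      rw [sum_comm]
      simp
    simp only [Sum.elim_inl, Sum.elim_inr, h1]
    by_cases hR : R x e <;> simp [hR, sub_sub]

open Classical in
/-- A greedily chosen conflict-free family in which every target occurs often. -/
lemma exists_conflict_free_family {Ω T : Type*} [Fintype Ω] [Nonempty Ω] [Fintype T]
    (Hit : T → Ω → Prop) (Conf : Ω → Ω → Prop) (Good : Ω → Prop) {c κ : ℝ} (hc : 0 < c)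
    (hc1 : c ≤ 1) (hκ : 0 ≤ κ) (hHit : ∀ t, c * Fintype.card Ω ≤ #{ω | Hit t ω})
    (hGood : (#{ω | ¬ Good ω} : ℝ) ≤ c / 4 * Fintype.card Ω)
    (hConf : ∀ ω, (#{ω' | Conf ω ω'} : ℝ) ≤ κ * Fintype.card Ω)
    (hsymm : ∀ ω ω', Conf ω ω' → Conf ω' ω) (hself : ∀ ω, Conf ω ω) (m : ℕ)
    (hm : m * κ ≤ c / 4) :
    ∃ 𝓕 : Finset Ω, #𝓕 = m ∧ (∀ ω ∈ 𝓕, Good ω) ∧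
      (∀ ω ∈ 𝓕, ∀ ω' ∈ 𝓕, ω ≠ ω' → ¬ Conf ω ω') ∧
      ∑ t, (1 / 2 : ℝ) ^ #{ω ∈ 𝓕 | Hit t ω} ≤ (1 - c / 4) ^ m * Fintype.card T := by
  have hΩ : (0 : ℝ) < Fintype.card Ω := by exact_mod_cast Fintype.card_pos
  induction m with
  | zero => exact ⟨∅, by simp⟩
  | succ m ih =>
    push_cast at hm
    obtain ⟨𝓕, hcard, hgood, hconf, hpot⟩ := ih (by nlinarith)
    let 𝒜 : Finset Ω := univ.filter fun ω => Good ω ∧ ∀ ω' ∈ 𝓕, ¬ Conf ω' ω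
    have hcompl : (#(𝒜ᶜ) : ℝ) ≤ c / 2 * Fintype.card Ω := by
      have h1 : 𝒜ᶜ ⊆ (univ.filter fun ω => ¬ Good ω) ∪
          𝓕.biUnion fun ω' => univ.filter fun ω => Conf ω' ω := by
        intro ω hω
        simp only [𝒜, mem_compl, mem_filter, mem_univ, true_and, not_and, not_forall] at hω
        simp only [mem_union, mem_filter, mem_univ, true_and, mem_biUnion]
        by_cases hg : Good ω
        · obtain ⟨ω', h1, h2⟩ := hω hg
          exact Or.inr ⟨ω', h1, not_not.1 h2⟩
        · exact Or.inl hg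
      have h2 : (#(𝒜ᶜ) : ℝ) ≤ #(univ.filter fun ω => ¬ Good ω) +
          ∑ ω' ∈ 𝓕, (#(univ.filter fun ω => Conf ω' ω) : ℝ) := by
        exact_mod_cast (card_le_card h1).trans ((card_union_le _ _).trans
          (Nat.add_le_add_left card_biUnion_le _))
      have h3 : ∑ ω' ∈ 𝓕, (#(univ.filter fun ω => Conf ω' ω) : ℝ) ≤
          m * (κ * Fintype.card Ω) := by
        refine (sum_le_sum fun ω' _ => hConf ω').trans_eq ?_
        rw [sum_const, nsmul_eq_mul, hcard]
      have h4 := mul_le_mul_of_nonneg_right (by linarith : m * κ ≤ c / 4) hΩ.le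
      linarith
    have hA : (#𝒜 : ℝ) + #(𝒜ᶜ) = Fintype.card Ω := by
      exact_mod_cast card_add_card_compl 𝒜
    have hhit : ∀ t, c / 2 * Fintype.card Ω ≤ #{ω ∈ 𝒜 | Hit t ω} := by
      intro t
      have h1 : (univ.filter fun ω => Hit t ω) ⊆ (𝒜.filter fun ω => Hit t ω) ∪ 𝒜ᶜ := by
        intro ω hω
        simp only [mem_filter, mem_univ, true_and] at hω
        by_cases h : ω ∈ 𝒜 <;> simp [h, hω]
      have h2 : (#(univ.filter fun ω => Hit t ω) : ℝ) ≤ #(𝒜.filter fun ω => Hit t ω) + #(𝒜ᶜ) := by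
        exact_mod_cast (card_le_card h1).trans (card_union_le _ _)
      have := hHit t
      linarith
    have hApos : 0 < (#𝒜 : ℝ) := by nlinarith
    have hne : 𝒜.Nonempty := card_pos.1 (by exact_mod_cast hApos)
    have hnot : ∀ ω ∈ 𝒜, ω ∉ 𝓕 := by
      intro ω hω h
      simp only [𝒜, mem_filter, mem_univ, true_and] at hω
      exact hω.2 ω h (hself ω)
    have hins : ∀ ω ∈ 𝒜, ∀ t, (1 / 2 : ℝ) ^ #{ω' ∈ insert ω 𝓕 | Hit t ω'} =
        (1 / 2 : ℝ) ^ #{ω' ∈ 𝓕 | Hit t ω'} * (1 - if Hit t ω then 1 / 2 else 0) := by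
      intro ω hω t
      rw [filter_insert]
      split_ifs with h
      · rw [card_insert_of_notMem (by simp [hnot ω hω]), pow_succ]
        norm_num
      · simp
    obtain ⟨ω, hω, hle⟩ := exists_le_of_sum_le hne (f := fun ω =>
        ∑ t, (1 / 2 : ℝ) ^ #{ω' ∈ insert ω 𝓕 | Hit t ω'})
      (g := fun _ => (1 - c / 4) * ∑ t, (1 / 2 : ℝ) ^ #{ω' ∈ 𝓕 | Hit t ω'}) (by
        rw [sum_comm, sum_const, nsmul_eq_mul, mul_sum, mul_sum]
        refine sum_le_sum fun t _ => ?_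
        rw [sum_congr rfl fun ω hω => hins ω hω t, ← mul_sum, sum_sub_distrib, sum_const,
          nsmul_eq_mul, mul_one, ← sum_filter, sum_const, nsmul_eq_mul]
        have h1 : (0 : ℝ) < (1 / 2 : ℝ) ^ #{ω' ∈ 𝓕 | Hit t ω'} := by positivity
        have h2 : (#𝒜 : ℝ) - #{ω ∈ 𝒜 | Hit t ω} * (1 / 2) ≤ #𝒜 * (1 - c / 4) := by
          have h3 := hhit t
          have h4 : c / 4 * (#𝒜 : ℝ) ≤ c / 4 * Fintype.card Ω := by
            refine mul_le_mul_of_nonneg_left ?_ (by positivity)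
            have : (0 : ℝ) ≤ #(𝒜ᶜ) := by positivity
            linarith
          linarith
        calc _ ≤ (1 / 2 : ℝ) ^ #{ω' ∈ 𝓕 | Hit t ω'} * (#𝒜 * (1 - c / 4)) :=
              mul_le_mul_of_nonneg_left h2 h1.le
          _ = _ := by ring)
    refine ⟨insert ω 𝓕, ?_, ?_, ?_, ?_⟩
    · rw [card_insert_of_notMem (hnot ω hω), hcard]
    · intro ω' h
      rcases mem_insert.1 h with rfl | h
      · exact (mem_filter.1 hω).2.1
      · exact hgood ω' h
    · have hω2 := (mem_filter.1 hω).2.2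
      intro ω₁ h₁ ω₂ h₂ hne
      rcases mem_insert.1 h₁ with rfl | h₁' <;> rcases mem_insert.1 h₂ with rfl | h₂'
      · exact absurd rfl hne
      · exact fun h => hω2 ω₂ h₂' (hsymm _ _ h)
      · exact hω2 ω₁ h₁'
      · exact hconf ω₁ h₁' ω₂ h₂' hne
    · refine hle.trans ?_
      rw [pow_succ, mul_comm (_ ^ m), mul_assoc]
      exact mul_le_mul_of_nonneg_left hpot (by linarith)

section Counting

variable {A B : Type*} [Fintype A] [Fintype B]

open Classical in
lemma mul_le_card_filter_prod (P : A → Prop) (Q : A → B → Prop) {d₁ d₂ : ℝ} (hd₂ : 0 ≤ d₂)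
    (h₁ : d₁ ≤ #{a | P a}) (h₂ : ∀ a, P a → d₂ ≤ #{b | Q a b}) :
    d₁ * d₂ ≤ #{p : A × B | P p.1 ∧ Q p.1 p.2} := by
  have h : (#{p : A × B | P p.1 ∧ Q p.1 p.2} : ℝ) = ∑ a with P a, (#{b | Q a b} : ℝ) := by
    simp only [card_filter, Nat.cast_sum, Nat.cast_ite, Nat.cast_one, Nat.cast_zero, sum_filter]
    rw [Fintype.sum_prod_type]
    refine sum_congr rfl fun a _ => ?_
    by_cases ha : P a <;> simp [ha]
  rw [h]
  calc d₁ * d₂ ≤ #{a | P a} * d₂ := by gcongr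
    _ = ∑ a with P a, d₂ := by rw [sum_const, nsmul_eq_mul]
    _ ≤ _ := sum_le_sum fun a ha => h₂ a (mem_filter.1 ha).2

open Classical in
lemma pow_le_card_filter_forall (G : Fin 4 → A → Prop) {d : ℝ} (hd : 0 ≤ d)
    (h : ∀ i, d ≤ #{a | G i a}) : d ^ 4 ≤ #{p : Fin 4 → A | ∀ i, G i (p i)} := by
  have h1 : (univ.filter fun p : Fin 4 → A => ∀ i, G i (p i)) =
      Fintype.piFinset fun i => univ.filter fun a => G i a := by
    ext p; simp
  rw [h1, Fintype.card_piFinset, Nat.cast_prod]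
  calc d ^ 4 = ∏ _i : Fin 4, d := by simp
    _ ≤ _ := prod_le_prod (fun _ _ => hd) fun i _ => h i

open Classical in
lemma card_filter_and_ge (P Q : A → Prop) {p q : ℝ} (hp : p ≤ #{a | P a}) (hq : q ≤ #{a | Q a}) :
    p + q - Fintype.card A ≤ #{a | P a ∧ Q a} := by
  have h1 := card_union_add_card_inter (univ.filter P) (univ.filter Q)
  rw [← filter_and] at h1
  have h2 := card_le_univ (univ.filter P ∪ univ.filter Q)
  have h3 : (#(univ.filter P) : ℝ) + #(univ.filter Q) ≤
      Fintype.card A + #(univ.filter fun a => P a ∧ Q a) := by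
    exact_mod_cast (by omega : _ ≤ _)
  linarith

open Classical in
lemma card_filter_cons_eq {k : ℕ} (P : (Fin (k + 1) → A) → Prop) :
    (#{w | P w} : ℝ) = ∑ v, (#{z : Fin k → A | P (Fin.cons v z)} : ℝ) := by
  simp only [card_filter, Nat.cast_sum, Nat.cast_ite, Nat.cast_one, Nat.cast_zero]
  exact sum_fin_cons _

open Classical in
lemma card_exists_mem_le {k : ℕ} (S : Finset A) :
    (#{f : Fin k → A | ∃ i, f i ∈ S} : ℝ) * Fintype.card A ≤
      k * #S * (Fintype.card A : ℝ) ^ k := by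
  have h1 : ∀ i : Fin k, (#{f : Fin k → A | f i ∈ S} : ℝ) * Fintype.card A ≤
      #S * (Fintype.card A : ℝ) ^ k := by
    intro i
    have h2 : #((univ.filter fun f : Fin k → A => f i ∈ S) ×ˢ (univ : Finset A)) ≤
        #(S ×ˢ (univ : Finset (Fin k → A))) := by
      refine card_le_card_of_injOn (fun t => (t.1 i, Function.update t.1 i t.2)) ?_ ?_
      · rintro ⟨f, y⟩ hf
        simpa using hf
      · rintro ⟨f, y⟩ hf ⟨g, y'⟩ hg h
        simp only [Prod.mk.injEq] at h ⊢
        have h3 : y = y' := by simpa using congrFun h.2 i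
        refine ⟨?_, h3⟩
        funext j
        by_cases hj : j = i
        · rw [hj]; exact h.1
        · simpa [hj] using congrFun h.2 j
    rw [card_product, card_product, card_univ, card_univ, Fintype.card_fun, Fintype.card_fin] at h2
    exact_mod_cast h2
  have h2 : (univ.filter fun f : Fin k → A => ∃ i, f i ∈ S) =
      univ.biUnion fun i => univ.filter fun f : Fin k → A => f i ∈ S := by
    ext f; simp
  have h3 : (#{f : Fin k → A | ∃ i, f i ∈ S} : ℝ) ≤
      ∑ i, (#{f : Fin k → A | f i ∈ S} : ℝ) := by
    rw [h2]; exact_mod_cast card_biUnion_le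
  calc _ ≤ (∑ i, (#{f : Fin k → A | f i ∈ S} : ℝ)) * Fintype.card A := by gcongr
    _ ≤ ∑ _i : Fin k, #S * (Fintype.card A : ℝ) ^ k := by
      rw [sum_mul]; exact sum_le_sum fun i _ => h1 i
    _ = _ := by simp; ring

end Counting

section Gadgets

variable {X V : Type}

/-- The vertices of a potential absorbing gadget. -/
abbrev Gadget (X V : Type) : Type := (Fin 5 → X) × (Fin (4 * 5) → V)

namespace Gadget

/-- The vertices of the central edge. -/
def center (ω : Gadget X V) (i : Fin 4) : V := ω.2 (finProdFinEquiv (i, 0))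

/-- The vertices that are exchanged with the absorbed ones. -/
def spoke (ω : Gadget X V) (i : Fin 4) : V := ω.2 (finProdFinEquiv (i, 1))

/-- The common links of exchanged vertices. -/
def link (ω : Gadget X V) (i : Fin 4) (k : Fin 3) : V := ω.2 (finProdFinEquiv (i, k.succ.succ))

/-- The gadget consists of five edges. -/
def IsValid (R : X → (Fin 4 → V) → Prop) (ω : Gadget X V) : Prop :=
  R (ω.1 0) ω.center ∧ ∀ i : Fin 4, R (ω.1 i.succ) (Fin.cons (ω.spoke i) (ω.link i))

/-- The gadget consists of five edges and can absorb the vertices of `t`. -/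
def Absorbs (R : X → (Fin 4 → V) → Prop) (t : X × (Fin 4 → V)) (ω : Gadget X V) : Prop :=
  ω.IsValid R ∧ R t.1 ω.center ∧ R (ω.1 0) ω.spoke ∧
    ∀ i : Fin 4, R (ω.1 i.succ) (Fin.cons (t.2 i) (ω.link i))

/-- Two gadgets share a vertex. -/
def Meets (ω ω' : Gadget X V) : Prop := (∃ i j, ω.1 i = ω'.1 j) ∨ ∃ i j, ω.2 i = ω'.2 j

/-- The gadget with prescribed parts. -/
def mk (q : ((X × (Fin 4 → V)) × (Fin 4 → V)) × (Fin 4 → X × (Fin 3 → V))) : Gadget X V :=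
  (Fin.cons q.1.1.1 fun i => (q.2 i).1, fun r =>
    (Fin.cons (q.1.1.2 (finProdFinEquiv.symm r).1) (Fin.cons (q.1.2 (finProdFinEquiv.symm r).1)
      (q.2 (finProdFinEquiv.symm r).1).2) : Fin 5 → V) (finProdFinEquiv.symm r).2)

lemma center_mk (q : ((X × (Fin 4 → V)) × (Fin 4 → V)) × (Fin 4 → X × (Fin 3 → V))) :
    (mk q).center = q.1.1.2 := by
  funext i
  simp only [center, mk, Equiv.symm_apply_apply]
  rfl

lemma spoke_mk (q : ((X × (Fin 4 → V)) × (Fin 4 → V)) × (Fin 4 → X × (Fin 3 → V))) :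
    (mk q).spoke = q.1.2 := by
  funext i
  simp only [spoke, mk, Equiv.symm_apply_apply]
  rfl

lemma link_mk (q : ((X × (Fin 4 → V)) × (Fin 4 → V)) × (Fin 4 → X × (Fin 3 → V))) (i : Fin 4) :
    (mk q).link i = (q.2 i).2 := by
  funext k
  simp only [link, mk, Equiv.symm_apply_apply]
  rfl

lemma mk_injective : Function.Injective (mk : _ → Gadget X V) := by
  rintro ⟨⟨⟨x, u⟩, w⟩, p⟩ ⟨⟨⟨x', u'⟩, w'⟩, p'⟩ h
  have h1 := congrArg center h
  have h2 := congrArg spoke h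
  have h3 := congrArg link h
  have h4 := congrArg Prod.fst h
  rw [center_mk, center_mk] at h1
  rw [spoke_mk, spoke_mk] at h2
  have h5 : x = x' := congrFun h4 0
  have h6 : p = p' := by
    funext i
    refine Prod.ext (congrFun h4 i.succ) ?_
    have := congrFun h3 i
    rw [link_mk, link_mk] at this
    exact this
  simp only at h1 h2
  rw [h1, h2, h5, h6]

open Classical in
/-- A positive proportion of all gadgets absorb a given tuple. -/
lemma le_card_absorbs [Fintype X] [Fintype V] {R : X → (Fin 4 → V) → Prop}
    (hdeg : ∀ x v, 9 / 16 * (Fintype.card V : ℝ) ^ 3 ≤ #{z : Fin 3 → V | R x (Fin.cons v z)})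
    (t : X × (Fin 4 → V)) :
    1 / 2 ^ 16 * (Fintype.card (Gadget X V) : ℝ) ≤ #{ω : Gadget X V | ω.Absorbs R t} := by
  have hpair : ∀ x v x' v', 1 / 8 * (Fintype.card V : ℝ) ^ 3 ≤
      #{z : Fin 3 → V | R x (Fin.cons v z) ∧ R x' (Fin.cons v' z)} := by
    intro x v x' v'
    refine le_trans (le_of_eq ?_) (card_filter_and_ge _ _ (hdeg x v) (hdeg x' v'))
    simp; ring
  have h1 := mul_le_card_filter_prod (A := X) (B := Fin 4 → V) (fun _ => True)
    (fun x u => R x u ∧ R t.1 u) (d₁ := Fintype.card X)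
    (d₂ := 1 / 8 * (Fintype.card V : ℝ) ^ 4) (by positivity) (by simp) (by
      intro x _
      rw [card_filter_cons_eq]
      refine le_trans (le_of_eq ?_) (sum_le_sum (f := fun _ =>
        1 / 8 * (Fintype.card V : ℝ) ^ 3) fun v _ => (hpair x v t.1 v).trans_eq (by congr!))
      rw [sum_const, card_univ, nsmul_eq_mul]; ring)
  have h2 := mul_le_card_filter_prod (A := X × (Fin 4 → V)) (B := Fin 4 → V)
    (fun p => True ∧ (R p.1 p.2 ∧ R t.1 p.2)) (fun p w => R p.1 w)
    (d₂ := 1 / 2 * (Fintype.card V : ℝ) ^ 4) (by positivity) (by convert h1) (by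
      intro p _
      rw [card_filter_cons_eq]
      refine le_trans ?_ (sum_le_sum fun v _ => hdeg p.1 v)
      rw [sum_const, card_univ, nsmul_eq_mul]
      have : (0 : ℝ) ≤ (Fintype.card V : ℝ) ^ 4 := by positivity
      linarith)
  have h3 := mul_le_card_filter_prod (A := (X × (Fin 4 → V)) × (Fin 4 → V))
    (B := Fin 4 → X × (Fin 3 → V))
    (fun q => (True ∧ (R q.1.1 q.1.2 ∧ R t.1 q.1.2)) ∧ R q.1.1 q.2)
    (fun q p => ∀ i, R (p i).1 (Fin.cons (q.2 i) (p i).2) ∧ R (p i).1 (Fin.cons (t.2 i) (p i).2))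
    (d₂ := (Fintype.card X * (1 / 8 * (Fintype.card V : ℝ) ^ 3)) ^ 4) (by positivity) (by convert h2) (by
      intro q _
      refine (pow_le_card_filter_forall (fun i (p : X × (Fin 3 → V)) =>
        R p.1 (Fin.cons (q.2 i) p.2) ∧ R p.1 (Fin.cons (t.2 i) p.2))
        (d := Fintype.card X * (1 / 8 * (Fintype.card V : ℝ) ^ 3)) (by positivity)
        fun i => ?_).trans_eq (by congr!)
      have := mul_le_card_filter_prod (A := X) (B := Fin 3 → V) (fun _ => True)
        (fun x z => R x (Fin.cons (q.2 i) z) ∧ R x (Fin.cons (t.2 i) z))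
        (d₁ := Fintype.card X) (d₂ := 1 / 8 * (Fintype.card V : ℝ) ^ 3) (by positivity) (by simp)
        fun x _ => by convert hpair x (q.2 i) x (t.2 i)
      exact this.trans_eq (by congr! 2; ext p; simp))
  have hcard : (Fintype.card (Gadget X V) : ℝ) =
      (Fintype.card X : ℝ) ^ 5 * (Fintype.card V : ℝ) ^ 20 := by simp
  rw [hcard]
  refine le_trans (le_of_eq ?_) (h3.trans ?_)
  · ring
  · rw [← card_map ⟨mk, mk_injective⟩]
    refine Nat.cast_le.2 (card_le_card ?_)
    intro ω hω
    obtain ⟨q, hq, rfl⟩ := mem_map.1 hω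
    simp only [mem_filter, mem_univ, true_and] at hq
    refine mem_filter.2 ⟨mem_univ _, ?_⟩
    simp only [Function.Embedding.coeFn_mk, Absorbs, IsValid, center_mk, spoke_mk, link_mk]
    exact ⟨⟨hq.1.1.1, fun i => (hq.2 i).1⟩, hq.1.1.2, hq.1.2, fun i => (hq.2 i).2⟩

open Classical in
lemma card_not_injective_gadget_le [Fintype X] [Fintype V] (hX : 0 < Fintype.card X)
    (hV : Fintype.card V = 4 * Fintype.card X) :
    (#{ω : Gadget X V | ¬ (Function.Injective ω.1 ∧ Function.Injective ω.2)} : ℝ) ≤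
      125 / Fintype.card X * Fintype.card (Gadget X V) := by
  have hN0 : (0 : ℝ) < Fintype.card X := by exact_mod_cast hX
  have h1 := card_not_injective_le X 5
  have h2 := card_not_injective_le V (4 * 5)
  have hVr : (Fintype.card V : ℝ) = 4 * Fintype.card X := by exact_mod_cast hV
  have hcard : (Fintype.card (Gadget X V) : ℝ) =
      (Fintype.card X : ℝ) ^ 5 * (Fintype.card V : ℝ) ^ 20 := by simp
  have h3 : (univ.filter fun ω : Gadget X V =>
      ¬ (Function.Injective ω.1 ∧ Function.Injective ω.2)) ⊆
      (univ.filter fun a : Fin 5 → X => ¬ Function.Injective a) ×ˢ univ ∪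
      univ ×ˢ (univ.filter fun b : Fin (4 * 5) → V => ¬ Function.Injective b) := by
    intro ω hω
    simp only [mem_filter, mem_univ, true_and, not_and_or] at hω
    simpa using hω
  have h4 := (card_le_card h3).trans (card_union_le _ _)
  rw [card_product, card_product, card_univ, card_univ, Fintype.card_fun, Fintype.card_fun,
    Fintype.card_fin, Fintype.card_fin] at h4
  have h5 := (Nat.cast_le (α := ℝ)).2 h4
  push_cast at h5
  refine h5.trans ?_
  rw [hcard, div_mul_eq_mul_div, le_div_iff₀ hN0, add_mul]
  rw [hVr] at h2 ⊢
  have h6 := mul_le_mul_of_nonneg_right h1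
    (by positivity : (0 : ℝ) ≤ (4 * Fintype.card X : ℝ) ^ 20)
  have h7 := mul_le_mul_of_nonneg_left h2
    (by positivity : (0 : ℝ) ≤ (Fintype.card X : ℝ) ^ 5)
  norm_num at h6 h7 ⊢
  linarith

open Classical in
lemma card_meets_le [Fintype X] [Fintype V] (hX : 0 < Fintype.card X)
    (hV : Fintype.card V = 4 * Fintype.card X) (ω : Gadget X V) :
    (#{ω' : Gadget X V | ω.Meets ω'} : ℝ) ≤
      125 / Fintype.card X * Fintype.card (Gadget X V) := by
  have hN0 : (0 : ℝ) < Fintype.card X := by exact_mod_cast hX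
  have hVr : (Fintype.card V : ℝ) = 4 * Fintype.card X := by exact_mod_cast hV
  have h1 := card_exists_mem_le (k := 5) (univ.image ω.1)
  have h2 := card_exists_mem_le (k := 4 * 5) (univ.image ω.2)
  have hc1 : (#(univ.image ω.1) : ℝ) ≤ 5 := by
    exact_mod_cast card_image_le.trans (by simp)
  have hc2 : (#(univ.image ω.2) : ℝ) ≤ 20 := by
    exact_mod_cast card_image_le.trans (by simp)
  have hcard : (Fintype.card (Gadget X V) : ℝ) =
      (Fintype.card X : ℝ) ^ 5 * (Fintype.card V : ℝ) ^ 20 := by simp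
  have h3 : (univ.filter fun ω' : Gadget X V => ω.Meets ω') ⊆
      (univ.filter fun a : Fin 5 → X => ∃ i, a i ∈ univ.image ω.1) ×ˢ univ ∪
      univ ×ˢ (univ.filter fun b : Fin (4 * 5) → V => ∃ i, b i ∈ univ.image ω.2) := by
    intro ω' hω
    simp only [mem_union, mem_product, mem_filter, mem_univ, true_and, and_true, mem_image]
    rcases (mem_filter.1 hω).2 with ⟨i, j, h⟩ | ⟨i, j, h⟩
    · exact Or.inl ⟨j, i, h⟩
    · exact Or.inr ⟨j, i, h⟩
  have h4 := (card_le_card h3).trans (card_union_le _ _)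
  rw [card_product, card_product, card_univ, card_univ, Fintype.card_fun, Fintype.card_fun,
    Fintype.card_fin, Fintype.card_fin] at h4
  have h5 := (Nat.cast_le (α := ℝ)).2 h4
  push_cast at h5
  refine h5.trans ?_
  rw [hcard, div_mul_eq_mul_div, le_div_iff₀ hN0, add_mul]
  rw [hVr] at h2 ⊢
  have h1' := h1.trans (mul_le_mul_of_nonneg_right
    (mul_le_mul_of_nonneg_left hc1 (by positivity)) (by positivity))
  have h2' := h2.trans (mul_le_mul_of_nonneg_right
    (mul_le_mul_of_nonneg_left hc2 (by positivity)) (by positivity))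
  have h6 := mul_le_mul_of_nonneg_right h1'
    (by positivity : (0 : ℝ) ≤ (4 * Fintype.card X : ℝ) ^ 20)
  have h7 := mul_le_mul_of_nonneg_left h2'
    (by positivity : (0 : ℝ) ≤ (Fintype.card X : ℝ) ^ 5)
  norm_num at h6 h7 ⊢
  linarith

end Gadget

end Gadgets

section MatchInBasics

variable {X V : Type} {R : X → (Fin 4 → V) → Prop}

lemma MatchIn.mono {A A' : Finset X} {B B' : Finset V} (h : MatchIn R A B) (hA : A' ⊆ A)
    (hB : B ⊆ B') : MatchIn R A' B' := by
  obtain ⟨v, h1, h2, h3⟩ := h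
  exact ⟨v, fun x hx => h1 x (hA hx), fun x hx i => hB (h2 x (hA hx) i),
    fun x hx y hy => h3 x (hA hx) y (hA hy)⟩

open Classical in
lemma MatchIn.biUnion [Nonempty V] {ι : Type*} {I : Finset ι} {A : ι → Finset X} {B : ι → Finset V}
    (h : ∀ i ∈ I, MatchIn R (A i) (B i))
    (hB : ∀ i ∈ I, ∀ j ∈ I, i ≠ j → Disjoint (B i) (B j)) :
    MatchIn R (I.biUnion A) (I.biUnion B) := by
  have hne : ∀ x : X, x ∈ I.biUnion A → ∃ i ∈ I, x ∈ A i := fun x hx => by simpa using hx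
  rcases isEmpty_or_nonempty ι with hι | hι
  · exact ⟨fun _ _ => Classical.arbitrary V, by simp [Finset.eq_empty_of_isEmpty I]⟩
  choose! f hf hfA using hne
  choose! v h1 h2 h3 using h
  refine ⟨fun x => v (f x) x, fun x hx => h1 _ (hf x hx) _ (hfA x hx), fun x hx i =>
    mem_biUnion.2 ⟨f x, hf x hx, h2 _ (hf x hx) _ (hfA x hx) i⟩, fun x hx y hy i j hij => ?_⟩
  beta_reduce at hij
  have hxy : f x = f y := by
    by_contra hne
    refine (Finset.disjoint_left.1 (hB _ (hf x hx) _ (hf y hy) hne))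
      (h2 _ (hf x hx) _ (hfA x hx) i) ?_
    rw [hij]
    exact h2 _ (hf y hy) _ (hfA y hy) j
  have h4 := hfA y hy
  rw [← hxy] at hij h4
  exact h3 _ (hf x hx) x (hfA x hx) y h4 i j hij

open Classical in
lemma MatchIn.union [Nonempty V] {A A' : Finset X} {B B' : Finset V} (h : MatchIn R A B)
    (h' : MatchIn R A' B') (hB : Disjoint B B') : MatchIn R (A ∪ A') (B ∪ B') := by
  have := MatchIn.biUnion (R := R) (I := (univ : Finset Bool)) (A := fun b => cond b A A')
    (B := fun b => cond b B B') (by simp [h, h']) (by simp [hB, hB.symm])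
  simpa using this

open Classical in
lemma matchIn_of_family [Nonempty V] {ι : Type*} [Fintype ι] (a : ι → X) (b : ι → Fin 4 → V)
    (hR : ∀ i, R (a i) (b i)) (hb : ∀ i j k l, b i k = b j l → i = j) :
    MatchIn R (univ.image a) (univ.biUnion fun i => univ.image (b i)) := by
  have h := MatchIn.biUnion (R := R) (I := (univ : Finset ι)) (A := fun i => {a i})
    (B := fun i => univ.image (b i))
    (fun i _ => ⟨fun _ => b i, by simpa using hR i, by simp, by
      intro x hx y hy _ _ _; rw [mem_singleton.1 hx, mem_singleton.1 hy]⟩)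
    (fun i _ j _ hij => by
      rw [Finset.disjoint_left]
      intro v hv hv'
      obtain ⟨k, -, rfl⟩ := mem_image.1 hv
      obtain ⟨l, -, hl⟩ := mem_image.1 hv'
      exact hij (hb _ _ _ _ hl.symm))
  refine h.mono ?_ subset_rfl
  intro x hx
  obtain ⟨i, -, rfl⟩ := mem_image.1 hx
  simp

end MatchInBasics

namespace Gadget

variable {X V : Type} {R : X → (Fin 4 → V) → Prop}

lemma cons_spoke_link (ω : Gadget X V) (i : Fin 4) (k : Fin 4) :
    (Fin.cons (ω.spoke i) (ω.link i) : Fin 4 → V) k = ω.2 (finProdFinEquiv (i, k.succ)) := by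
  refine Fin.cases ?_ (fun k => ?_) k <;> rfl

open Classical in
lemma matchIn_of_isValid {ω : Gadget X V} (h : ω.IsValid R) (hω : Function.Injective ω.2) :
    MatchIn R (univ.image ω.1) (univ.image ω.2) := by
  have : Nonempty V := ⟨ω.2 0⟩
  refine (matchIn_of_family (R := R) ω.1
    (Fin.cons ω.center fun i => Fin.cons (ω.spoke i) (ω.link i)) ?_ ?_).mono subset_rfl ?_
  · exact fun i => Fin.cases h.1 h.2 i
  · intro i j k l
    refine Fin.cases ?_ (fun i => ?_) i <;> refine Fin.cases ?_ (fun j => ?_) j <;>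
      simp only [Fin.cons_zero, Fin.cons_succ, cons_spoke_link, center] <;> intro h <;>
      have := finProdFinEquiv.injective (hω h) <;> simp only [Prod.mk.injEq] at this
    · trivial
    · exact absurd this.2 (Fin.succ_ne_zero _).symm
    · exact absurd this.2 (Fin.succ_ne_zero _)
    · rw [this.1]
  · intro v hv
    obtain ⟨i, -, hi⟩ := mem_biUnion.1 hv
    obtain ⟨k, -, rfl⟩ := mem_image.1 hi
    refine Fin.cases ?_ (fun i => ?_) i <;>
      simp [cons_spoke_link, center]

open Classical in
lemma matchIn_of_absorbs {ω : Gadget X V} {t : X × (Fin 4 → V)} (h : ω.Absorbs R t)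
    (hω : Function.Injective ω.2) (ht : Function.Injective t.2)
    (hd : ∀ i, t.2 i ∉ univ.image ω.2) :
    MatchIn R (univ.image ω.1 ∪ {t.1}) (univ.image ω.2 ∪ univ.image t.2) := by
  have hd' : ∀ i r, t.2 i ≠ ω.2 r := fun i r h => hd i (by simp [h])
  have : Nonempty V := ⟨ω.2 0⟩
  refine (matchIn_of_family (R := R) (Fin.cons t.1 ω.1 : Fin 6 → X)
    (Fin.cons ω.center (Fin.cons ω.spoke fun i => Fin.cons (t.2 i) (ω.link i))) ?_ ?_).mono ?_ ?_
  · exact fun i => Fin.cases h.2.1 (fun i => Fin.cases h.2.2.1 h.2.2.2 i) i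
  · have hl : ∀ (i k : Fin 4), (Fin.cons (t.2 i) (ω.link i) : Fin 4 → V) k =
        if k = 0 then t.2 i else ω.2 (finProdFinEquiv (i, k.succ)) := by
      intro i k
      refine Fin.cases ?_ (fun k => ?_) k
      · simp
      · simp [link]
    have hlc : ∀ i k j, (Fin.cons (t.2 i) (ω.link i) : Fin 4 → V) k ≠ ω.center j := by
      intro i k j hh
      rw [hl] at hh
      split_ifs at hh with h0
      · exact hd' _ _ hh
      · have := finProdFinEquiv.injective (hω hh)
        simp only [Prod.mk.injEq] at this
        exact absurd this.2 (Fin.succ_ne_zero _)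
    have hls : ∀ i k j, (Fin.cons (t.2 i) (ω.link i) : Fin 4 → V) k ≠ ω.spoke j := by
      intro i k j hh
      rw [hl] at hh
      split_ifs at hh with h0
      · exact hd' _ _ hh
      · have := finProdFinEquiv.injective (hω hh)
        simp only [Prod.mk.injEq] at this
        exact h0 (Fin.succ_injective _ this.2)
    have hcs : ∀ i j, ω.center i ≠ ω.spoke j := by
      intro i j hh
      have := finProdFinEquiv.injective (hω hh)
      simp at this
    intro i j k l
    refine Fin.cases ?_ (fun i => Fin.cases ?_ (fun i => ?_) i) i <;>
      refine Fin.cases ?_ (fun j => Fin.cases ?_ (fun j => ?_) j) j <;>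
      simp only [Fin.cons_zero, Fin.cons_succ] <;> intro hh
    · trivial
    · exact absurd hh (hcs _ _)
    · exact absurd hh.symm (hlc _ _ _)
    · exact absurd hh.symm (hcs _ _)
    · trivial
    · exact absurd hh.symm (hls _ _ _)
    · exact absurd hh (hlc _ _ _)
    · exact absurd hh (hls _ _ _)
    · rw [hl, hl] at hh
      split_ifs at hh
      · rw [ht hh]
      · exact absurd hh (hd' _ _)
      · exact absurd hh.symm (hd' _ _)
      · have := hω hh
        simp only [EmbeddingLike.apply_eq_iff_eq, Prod.mk.injEq] at this
        rw [this.1]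
  · intro x hx
    rcases mem_union.1 hx with hx | hx
    · obtain ⟨i, -, rfl⟩ := mem_image.1 hx
      exact mem_image.2 ⟨i.succ, mem_univ _, rfl⟩
    · rw [mem_singleton.1 hx]
      exact mem_image.2 ⟨0, mem_univ _, rfl⟩
  · intro v hv
    obtain ⟨i, -, hi⟩ := mem_biUnion.1 hv
    obtain ⟨k, -, rfl⟩ := mem_image.1 hi
    refine Fin.cases ?_ (fun i => Fin.cases ?_ (fun i => Fin.cases ?_ (fun k => ?_) k) i) i <;>
      simp [center, spoke, link]

end Gadget

lemma exists_pow_five_le_two_pow {α : ℝ} (hα : 0 < α) :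
    ∃ N₀ : ℕ, ∀ N : ℕ, N₀ ≤ N → 256 * (N : ℝ) ^ 5 ≤ 2 ^ ⌊α * N⌋₊ := by
  have h1 := tendsto_pow_const_div_const_pow_of_one_lt 5 (show (1 : ℝ) < 2 by norm_num)
  have h2 := (h1.eventually (gt_mem_nhds (show (0 : ℝ) < α ^ 5 / 512 by positivity)))
  obtain ⟨n₀, hn₀⟩ := Filter.eventually_atTop.1 h2
  refine ⟨⌈n₀ / α⌉₊, fun N hN => ?_⟩
  have hN1 : (n₀ : ℝ) ≤ α * N := by
    have := (Nat.ceil_le.1 hN)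
    rw [div_le_iff₀ hα] at this
    linarith
  have h3 := Nat.le_floor hN1
  have h4 := hn₀ (⌊α * N⌋₊ + 1) (by omega)
  have h5 := Nat.lt_floor_add_one (α * N)
  rw [div_lt_iff₀ (by positivity)] at h4
  have h6 : (α * N) ^ 5 ≤ ((⌊α * N⌋₊ + 1 : ℕ) : ℝ) ^ 5 := by
    push_cast
    exact pow_le_pow_left₀ (by positivity) h5.le 5
  have h7 : α ^ 5 * (256 * (N : ℝ) ^ 5) ≤ α ^ 5 * 2 ^ ⌊α * N⌋₊ := by
    rw [pow_succ 2] at h4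
    rw [mul_pow] at h6
    linarith
  exact le_of_mul_le_mul_left h7 (by positivity)

open Classical in
lemma exists_injOn_choice {A B : Type*} (S : Finset A) (G : A → Finset B)
    (h : ∀ x ∈ S, #S ≤ #(G x)) : ∃ f : S → B, Function.Injective f ∧ ∀ x : S, f x ∈ G x := by
  refine (all_card_le_biUnion_card_iff_exists_injective fun x : S => G x).1 fun s => ?_
  rcases s.eq_empty_or_nonempty with rfl | ⟨x, hx⟩
  · simp
  · calc #s ≤ #S := by simpa using card_le_univ s
      _ ≤ #(G x) := h x x.2
      _ ≤ _ := card_le_card (subset_biUnion_of_mem (fun x : S => G x) hx)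

open Classical in
lemma exists_grouping {X V : Type} [Nonempty V] (S : Finset X) (T : Finset V)
    (h : #T = 4 * #S) : ∃ v : X → Fin 4 → V, (∀ x ∈ S, ∀ i, v x i ∈ T) ∧
      ∀ x ∈ S, ∀ y ∈ S, ∀ i j, v x i = v y j → x = y ∧ i = j := by
  have hc : Fintype.card (S × Fin 4) = Fintype.card T := by simp [h, mul_comm]
  let e := Fintype.equivOfCardEq hc
  refine ⟨fun x i => if hx : x ∈ S then (e (⟨x, hx⟩, i)).1 else Classical.arbitrary V, ?_, ?_⟩
  · intro x hx i
    simp [hx]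
  · intro x hx y hy i j hij
    simp only [hx, hy, dite_true] at hij
    have := e.injective (Subtype.ext hij)
    simpa using this

open Classical in
/-- A linear-sized absorbing set exists when all degrees in the links are large. -/
theorem exists_absorber {β : ℝ} (hβ : 0 < β) :
    ∃ α : ℝ, 0 < α ∧ ∃ N₀ : ℕ, ∀ (X V : Type) [Fintype X] [Fintype V]
      (R : X → (Fin 4 → V) → Prop), N₀ ≤ Fintype.card X → Fintype.card V = 4 * Fintype.card X →
      (∀ x v, 9 / 16 * (Fintype.card V : ℝ) ^ 3 ≤ #{z : Fin 3 → V | R x (Fin.cons v z)}) →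
      ∃ (A : Finset X) (B : Finset V), #B = 4 * #A ∧ (#A : ℝ) ≤ β * Fintype.card X ∧
        ∀ (S : Finset X) (T : Finset V), Disjoint B T → #T = 4 * #S →
          (#S : ℝ) ≤ α * Fintype.card X → MatchIn R (A ∪ S) (B ∪ T) := by
  obtain ⟨q, hq⟩ := exists_pow_lt_of_lt_one (show (0 : ℝ) < 1 / 4 by norm_num)
    (show (1 : ℝ) - 1 / 2 ^ 16 / 4 < 1 by norm_num)
  have hq0 : 0 < (q : ℝ) + 1 := by positivity
  set α : ℝ := min (1 / 2 ^ 16 / 500 / (q + 1)) (β / 5 / (q + 1)) with hαdef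
  have hα : 0 < α := by rw [hαdef]; positivity
  have hα1 : α * (q + 1) ≤ 1 / 2 ^ 16 / 500 := by
    rw [← le_div_iff₀ hq0]; exact min_le_left _ _
  have hα2 : α * (q + 1) ≤ β / 5 := by
    rw [← le_div_iff₀ hq0]; exact min_le_right _ _
  obtain ⟨N₁, hN₁⟩ := exists_pow_five_le_two_pow hα
  refine ⟨α, hα, max N₁ (500 * 2 ^ 16), fun X V _ _ R hN hV hdeg => ?_⟩
  have hX : 0 < Fintype.card X := by
    have := le_trans (le_max_right _ _) hN
    omega
  have hNX : (500 * 2 ^ 16 : ℝ) ≤ Fintype.card X := by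
    exact_mod_cast le_trans (le_max_right _ _) hN
  have hNr : (0 : ℝ) < Fintype.card X := by exact_mod_cast hX
  have hVr : (Fintype.card V : ℝ) = 4 * Fintype.card X := by exact_mod_cast hV
  have : Nonempty X := Fintype.card_pos_iff.1 hX
  have : Nonempty V := Fintype.card_pos_iff.1 (by omega)
  have hpow := hN₁ _ (le_trans (le_max_left _ _) hN)
  set a : ℕ := ⌊α * Fintype.card X⌋₊ with ha
  have haN : (a : ℝ) ≤ α * Fintype.card X := Nat.floor_le (by positivity)
  have hqa : (q : ℝ) * a ≤ q * (α * Fintype.card X) := by gcongr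
  have hκ : (125 : ℝ) / Fintype.card X ≤ 1 / 2 ^ 16 / 4 := by
    rw [div_le_iff₀ hNr]
    linarith
  obtain ⟨𝓕, hcard, hgood, hdisj, hsum⟩ := exists_conflict_free_family
    (T := X × (Fin 4 → V)) (Ω := Gadget X V) (fun t ω => ω.Absorbs R t) Gadget.Meets
    (fun ω => Function.Injective ω.1 ∧ Function.Injective ω.2) (c := 1 / 2 ^ 16)
    (κ := 125 / Fintype.card X) (by norm_num) (by norm_num) (by positivity)
    (fun t => by convert Gadget.le_card_absorbs hdeg t)
    (le_trans (le_of_eq (by congr!)) ((Gadget.card_not_injective_gadget_le hX hV).trans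
      (mul_le_mul_of_nonneg_right hκ (by positivity))))
    (fun ω => by convert Gadget.card_meets_le hX hV ω)
    (fun ω ω' h => h.imp (fun ⟨i, j, h⟩ => ⟨j, i, h.symm⟩) (fun ⟨i, j, h⟩ => ⟨j, i, h.symm⟩))
    (fun ω => Or.inl ⟨0, 0, rfl⟩) (q * a) (by
      push_cast
      rw [mul_div_assoc', div_le_iff₀ hNr]
      have : α * q * Fintype.card X ≤ 1 / 2 ^ 16 / 500 * Fintype.card X := by
        refine mul_le_mul_of_nonneg_right ?_ hNr.le
        linarith
      linarith)
  have hhit : ∀ t, a ≤ #{ω ∈ 𝓕 | ω.Absorbs R t} := by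
    intro t
    by_contra hlt
    push Not at hlt
    have h1 : (1 / 2 : ℝ) ^ #{ω ∈ 𝓕 | ω.Absorbs R t} ≤
        (1 - 1 / 2 ^ 16 / 4) ^ (q * a) * Fintype.card (X × (Fin 4 → V)) :=
      le_trans (single_le_sum (f := fun t => (1 / 2 : ℝ) ^ #{ω ∈ 𝓕 | ω.Absorbs R t})
        (fun t _ => by positivity) (mem_univ t)) hsum
    have h2 : (1 / 2 : ℝ) ^ a < (1 / 2) ^ #{ω ∈ 𝓕 | ω.Absorbs R t} :=
      pow_lt_pow_right_of_lt_one₀ (by norm_num) (by norm_num) hlt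
    have h3 : (1 - 1 / 2 ^ 16 / 4 : ℝ) ^ (q * a) ≤ (1 / 4) ^ a := by
      rw [pow_mul]
      exact pow_le_pow_left₀ (pow_nonneg (by norm_num) _) hq.le a
    have h4 : (Fintype.card (X × (Fin 4 → V)) : ℝ) ≤ 2 ^ a := by
      refine le_trans (le_of_eq ?_) hpow
      simp [hVr]
      ring
    have h5 : (1 / 4 : ℝ) ^ a * 2 ^ a = (1 / 2) ^ a := by
      rw [← mul_pow]; norm_num
    have h6 := mul_le_mul h3 h4 (by positivity) (by positivity)
    linarith
  set 𝓖 := 𝓕.filter fun ω => ω.IsValid R with h𝓖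
  have hG1 : ∀ ω ∈ 𝓖, Function.Injective ω.1 ∧ Function.Injective ω.2 := fun ω hω =>
    hgood ω (mem_filter.1 hω).1
  have hG2 : ∀ ω ∈ 𝓖, ∀ ω' ∈ 𝓖, ω ≠ ω' → ¬ ω.Meets ω' := fun ω hω ω' hω' =>
    hdisj ω (mem_filter.1 hω).1 ω' (mem_filter.1 hω').1
  have hG3 : ∀ ω ∈ 𝓖, ∀ ω' ∈ 𝓖, ω ≠ ω' → Disjoint (univ.image ω.1) (univ.image ω'.1) := by
    intro ω hω ω' hω' hne
    rw [Finset.disjoint_left]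
    intro x hx hx'
    obtain ⟨i, -, rfl⟩ := mem_image.1 hx
    obtain ⟨j, -, hj⟩ := mem_image.1 hx'
    exact hG2 ω hω ω' hω' hne (Or.inl ⟨i, j, hj.symm⟩)
  have hG4 : ∀ ω ∈ 𝓖, ∀ ω' ∈ 𝓖, ω ≠ ω' → Disjoint (univ.image ω.2) (univ.image ω'.2) := by
    intro ω hω ω' hω' hne
    rw [Finset.disjoint_left]
    intro x hx hx'
    obtain ⟨i, -, rfl⟩ := mem_image.1 hx
    obtain ⟨j, -, hj⟩ := mem_image.1 hx'
    exact hG2 ω hω ω' hω' hne (Or.inr ⟨i, j, hj.symm⟩)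
  have hA : #(𝓖.biUnion fun ω => univ.image ω.1) = 5 * #𝓖 := by
    rw [card_biUnion fun ω hω ω' hω' h => hG3 ω hω ω' hω' h,
      sum_congr rfl fun ω hω => card_image_of_injective _ (hG1 ω hω).1]
    simp [mul_comm]
  have hB : #(𝓖.biUnion fun ω => univ.image ω.2) = 20 * #𝓖 := by
    rw [card_biUnion fun ω hω ω' hω' h => hG4 ω hω ω' hω' h,
      sum_congr rfl fun ω hω => card_image_of_injective _ (hG1 ω hω).2]
    simp [mul_comm]
  refine ⟨𝓖.biUnion fun ω => univ.image ω.1, 𝓖.biUnion fun ω => univ.image ω.2, by omega, ?_, ?_⟩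
  · rw [hA]
    have h1 : (#𝓖 : ℝ) ≤ q * a := by
      rw [← Nat.cast_mul, ← hcard]
      exact_mod_cast card_filter_le _ _
    have h2 : α * q * Fintype.card X ≤ β / 5 * Fintype.card X := by
      refine mul_le_mul_of_nonneg_right ?_ hNr.le
      linarith
    push_cast
    linarith
  · intro S T hT hTS hS
    obtain ⟨v, hv1, hv2⟩ := exists_grouping S T hTS
    have hSa : #S ≤ a := Nat.le_floor hS
    obtain ⟨f, hf1, hf2⟩ := exists_injOn_choice S
      (fun x => 𝓕.filter fun ω : Gadget X V => ω.Absorbs R (x, v x)) fun x _ => hSa.trans (hhit _)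
    have hfG : ∀ x : S, f x ∈ 𝓖 := fun x =>
      mem_filter.2 ⟨(mem_filter.1 (hf2 x)).1, (mem_filter.1 (hf2 x)).2.1⟩
    set P : Gadget X V → Finset X := fun ω =>
      (univ.filter fun x : S => f x = ω).image Subtype.val with hP
    have hmain := MatchIn.biUnion (R := R) (I := 𝓖) (A := fun ω => univ.image ω.1 ∪ P ω)
      (B := fun ω => univ.image ω.2 ∪ (P ω).biUnion fun x => univ.image (v x)) ?_ ?_
    · refine hmain.mono ?_ ?_
      · intro x hx
        rcases mem_union.1 hx with hx | hx
        · obtain ⟨ω, hω, hx⟩ := mem_biUnion.1 hx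
          exact mem_biUnion.2 ⟨ω, hω, mem_union_left _ hx⟩
        · exact mem_biUnion.2 ⟨f ⟨x, hx⟩, hfG _, mem_union_right _
            (mem_image.2 ⟨⟨x, hx⟩, by simp, rfl⟩)⟩
      · intro y hy
        obtain ⟨ω, hω, hy⟩ := mem_biUnion.1 hy
        rcases mem_union.1 hy with hy | hy
        · exact mem_union_left _ (mem_biUnion.2 ⟨ω, hω, hy⟩)
        · obtain ⟨x, hx, hy⟩ := mem_biUnion.1 hy
          obtain ⟨x, -, rfl⟩ := mem_image.1 hx
          obtain ⟨i, -, rfl⟩ := mem_image.1 hy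
          exact mem_union_right _ (hv1 _ x.2 i)
    · intro ω hω
      by_cases hx : ∃ x : S, f x = ω
      · obtain ⟨x, rfl⟩ := hx
        have hPx : P (f x) = {x.1} := by
          ext y
          simp only [hP, mem_image, mem_filter, mem_univ, true_and, mem_singleton]
          constructor
          · rintro ⟨z, hz, rfl⟩; rw [hf1 hz]
          · rintro rfl; exact ⟨x, rfl, rfl⟩
        simp only [hPx, singleton_biUnion]
        refine Gadget.matchIn_of_absorbs (t := (x.1, v x)) (mem_filter.1 (hf2 x)).2
          (hG1 _ hω).2 (fun i j h => (hv2 _ x.2 _ x.2 i j h).2) fun i h => ?_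
        exact Finset.disjoint_left.1 hT (mem_biUnion.2 ⟨_, hω, h⟩) (hv1 _ x.2 i)
      · have hPx : P ω = ∅ := by
          simp only [hP, image_eq_empty, filter_eq_empty_iff]
          exact fun x _ h => hx ⟨x, h⟩
        simp only [hPx, biUnion_empty, union_empty]
        exact Gadget.matchIn_of_isValid (mem_filter.1 hω).2 (hG1 _ hω).2
    · intro ω hω ω' hω' hne
      have hPT : ∀ ω, ((P ω).biUnion fun x => univ.image (v x)) ⊆ T := by
        intro ω y hy
        obtain ⟨x, hx, hy⟩ := mem_biUnion.1 hy
        obtain ⟨x, -, rfl⟩ := mem_image.1 hx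
        obtain ⟨i, -, rfl⟩ := mem_image.1 hy
        exact hv1 _ x.2 i
      have hωT : ∀ ω ∈ 𝓖, Disjoint (univ.image ω.2) T := fun ω hω =>
        hT.mono_left (subset_biUnion_of_mem (fun ω : Gadget X V => univ.image ω.2) hω)
      rw [disjoint_union_left, disjoint_union_right, disjoint_union_right]
      refine ⟨⟨hG4 ω hω ω' hω' hne, (hωT ω hω).mono_right (hPT _)⟩,
        ((hωT ω' hω').mono_right (hPT _)).symm, ?_⟩
      rw [Finset.disjoint_left]
      intro y hy hy'
      obtain ⟨x, hx, hy⟩ := mem_biUnion.1 hy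
      obtain ⟨x, hfx, rfl⟩ := mem_image.1 hx
      obtain ⟨i, -, rfl⟩ := mem_image.1 hy
      obtain ⟨x', hx', hy'⟩ := mem_biUnion.1 hy'
      obtain ⟨x', hfx', rfl⟩ := mem_image.1 hx'
      obtain ⟨j, -, hj⟩ := mem_image.1 hy'
      have := Subtype.ext (hv2 _ x'.2 _ x.2 j i hj).1
      rw [this] at hfx'
      exact hne ((mem_filter.1 hfx).2.symm.trans (mem_filter.1 hfx').2)

section Cyclic

/-- The permutation that rotates the points of an embedded `Fin 5` by `i`. -/
noncomputable def rotatePoints {ι : Type*} [Fintype ι] [DecidableEq ι] (e : Fin 5 ↪ ι)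
    (i : Fin 5) : Equiv.Perm ι :=
  (Equiv.addRight i).viaFintypeEmbedding e

lemma rotatePoints_apply {ι : Type*} [Fintype ι] [DecidableEq ι] (e : Fin 5 ↪ ι) (i j : Fin 5) :
    rotatePoints e i (e j) = e (j + i) := by
  simp [rotatePoints]

lemma rotatePoints_apply_of_notMem {ι : Type*} [Fintype ι] [DecidableEq ι] (e : Fin 5 ↪ ι)
    (i : Fin 5) {z : ι} (hz : z ∉ Set.range e) : rotatePoints e i z = z := by
  simp [rotatePoints, Equiv.Perm.viaFintypeEmbedding_apply_notMem_range _ _ hz]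

open Classical in
/-- A dense balanced `5`-partite relation contains a perfect matching. -/
theorem exists_perm_of_dense {ι : Type*} [Fintype ι] (Q : (Fin 5 → ι) → Prop) {d : ℝ}
    (hQ : ∀ i z, (#{y : Fin 5 → ι | y i = z ∧ ¬ Q y} : ℝ) ≤ d)
    (hd : 5 * d + 20 * (Fintype.card ι : ℝ) ^ 3 < (Fintype.card ι : ℝ) ^ 4) :
    ∃ π : Fin 5 → Equiv.Perm ι, ∀ z, Q fun i => π i z := by
  obtain ⟨π, -, hπ⟩ := exists_max_image (univ : Finset (Fin 5 → Equiv.Perm ι))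
    (fun π => #{z | Q fun i => π i z}) univ_nonempty
  refine ⟨π, fun z₀ => ?_⟩
  by_contra hz₀
  have hM : (0 : ℝ) < Fintype.card ι := by
    exact_mod_cast Fintype.card_pos_iff.2 ⟨z₀⟩
  have hbad : ∀ j : Fin 5, (#{f : Fin 4 → ι | ¬ Q fun i => π i
      ((Fin.cons z₀ f : Fin 5 → ι) (j + i))} : ℝ) ≤ d := by
    intro j
    refine le_trans (Nat.cast_le.2 ?_) (hQ (-j) (π (-j) z₀))
    refine card_le_card_of_injOn (fun f i => π i ((Fin.cons z₀ f : Fin 5 → ι) (j + i))) ?_ ?_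
    · intro f hf
      have hf : f ∈ univ.filter fun f : Fin 4 → ι => ¬ Q fun i => π i
        ((Fin.cons z₀ f : Fin 5 → ι) (j + i)) := hf
      have := (mem_filter.1 hf).2
      refine mem_coe.2 (mem_filter.2 ⟨mem_univ _, ?_, this⟩)
      simp
    · intro f _ g _ hfg
      have h1 : (Fin.cons z₀ f : Fin 5 → ι) = Fin.cons z₀ g := by
        funext i
        have := congrFun hfg (i - j)
        simpa using this
      exact (Fin.cons_right_injective (α := fun _ => ι) z₀) h1
  have hinj : (#{f : Fin 4 → ι | ¬ Function.Injective (Fin.cons z₀ f : Fin 5 → ι)} : ℝ) ≤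
      20 * (Fintype.card ι : ℝ) ^ 3 := by
    have h1 := card_not_injective_le ι 4
    have h2 := card_exists_mem_le (A := ι) (k := 4) {z₀}
    have h3 : (univ.filter fun f : Fin 4 → ι => ¬ Function.Injective (Fin.cons z₀ f : Fin 5 → ι)) ⊆
        (univ.filter fun f : Fin 4 → ι => ¬ Function.Injective f) ∪
        (univ.filter fun f : Fin 4 → ι => ∃ i, f i ∈ ({z₀} : Finset ι)) := by
      intro f hf
      simp only [mem_filter, mem_univ, true_and, Fin.cons_injective_iff, not_and_or,
        mem_union, Set.mem_range, mem_singleton, not_not] at hf ⊢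
      exact hf.symm
    have h4 : (#{f : Fin 4 → ι | ¬ Function.Injective (Fin.cons z₀ f : Fin 5 → ι)} : ℝ) ≤
        #{f : Fin 4 → ι | ¬ Function.Injective f} +
        #{f : Fin 4 → ι | ∃ i, f i ∈ ({z₀} : Finset ι)} := by
      exact_mod_cast (card_le_card h3).trans (card_union_le _ _)
    refine le_of_mul_le_mul_right ?_ hM
    have h5 := mul_le_mul_of_nonneg_right h4 hM.le
    simp only [card_singleton] at h2
    push_cast at h1 h2
    linarith
  obtain ⟨f, hf⟩ : ∃ f : Fin 4 → ι, Function.Injective (Fin.cons z₀ f : Fin 5 → ι) ∧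
      ∀ j : Fin 5, Q fun i => π i ((Fin.cons z₀ f : Fin 5 → ι) (j + i)) := by
    by_contra hno
    push Not at hno
    have h1 : (univ : Finset (Fin 4 → ι)) ⊆
        (univ.filter fun f : Fin 4 → ι => ¬ Function.Injective (Fin.cons z₀ f : Fin 5 → ι)) ∪
        univ.biUnion fun j : Fin 5 => univ.filter fun f : Fin 4 → ι => ¬ Q fun i => π i
          ((Fin.cons z₀ f : Fin 5 → ι) (j + i)) := by
      intro f _
      simp only [mem_union, mem_filter, mem_univ, true_and, mem_biUnion]
      exact or_iff_not_imp_left.2 fun h => hno f (not_not.1 h)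
    have h2 := (card_le_card h1).trans ((card_union_le _ _).trans
      (Nat.add_le_add_left card_biUnion_le _))
    have h3 := (Nat.cast_le (α := ℝ)).2 h2
    push_cast at h3
    have h4 : ∑ j : Fin 5, (#{f : Fin 4 → ι | ¬ Q fun i => π i
        ((Fin.cons z₀ f : Fin 5 → ι) (j + i))} : ℝ) ≤ 5 * d := by
      refine (sum_le_sum fun j _ => hbad j).trans ?_
      simp
    have h5 : ((#(univ : Finset (Fin 4 → ι)) : ℕ) : ℝ) = (Fintype.card ι : ℝ) ^ 4 := by simp
    linarith
  let e : Fin 5 ↪ ι := ⟨Fin.cons z₀ f, hf.1⟩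
  have hlt : #{z | Q fun i => π i z} <
      #{z | Q fun i => ((rotatePoints e i).trans (π i)) z} := by
    refine card_lt_card ⟨?_, fun h => hz₀ ?_⟩
    · intro z hz
      have hz := (mem_filter.1 hz).2
      refine mem_filter.2 ⟨mem_univ _, ?_⟩
      simp only [Equiv.trans_apply]
      by_cases hze : z ∈ Set.range e
      · obtain ⟨j, rfl⟩ := hze
        simp only [rotatePoints_apply]
        exact hf.2 j
      · simpa [rotatePoints_apply_of_notMem e _ hze] using hz
    · have : z₀ ∈ univ.filter fun z => Q fun i => ((rotatePoints e i).trans (π i)) z := by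
        refine mem_filter.2 ⟨mem_univ _, ?_⟩
        simp only [Equiv.trans_apply]
        have h0 : z₀ = e 0 := rfl
        rw [h0]
        simp only [rotatePoints_apply]
        exact hf.2 0
      exact (mem_filter.1 (h this)).2
  exact absurd (hπ (fun i => (rotatePoints e i).trans (π i)) (mem_univ _)) (not_le.2 hlt)

end Cyclic

open Classical in
lemma sum_card_filter_eq {A C : Type*} [Fintype A] [Fintype C] (S : Finset A)
    (P : A → C → Prop) {_ : ∀ a, DecidablePred (P a)} :
    ∑ a ∈ S, #{c | P a c} = #{p : A × C | p.1 ∈ S ∧ P p.1 p.2} := by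
  simp only [card_filter]
  rw [Fintype.sum_prod_type, ← sum_filter_add_sum_filter_not univ (· ∈ S)]
  have h1 : ∑ a with a ∉ S, ∑ c, (if a ∈ S ∧ P a c then 1 else 0) = 0 :=
    sum_eq_zero fun a ha => sum_eq_zero fun c _ => if_neg fun h => (mem_filter.1 ha).2 h.1
  rw [h1, add_zero, filter_mem_eq_inter, univ_inter]
  exact sum_congr rfl fun a ha => sum_congr rfl fun c _ => by simp [ha]

lemma card_filter_lt_mul_le {A : Type*} (S : Finset A) (f : A → ℕ) (θ : ℝ) :
    (#{a ∈ S | θ < f a} : ℝ) * θ ≤ ((∑ a ∈ S, f a : ℕ) : ℝ) := by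
  push_cast
  calc (#{a ∈ S | θ < f a} : ℝ) * θ ≤ ∑ a ∈ S with θ < f a, (f a : ℝ) := by
        rw [← nsmul_eq_mul]
        exact card_nsmul_le_sum _ _ _ fun a ha => (mem_filter.1 ha).2.le
    _ ≤ _ := sum_le_sum_of_subset_of_nonneg (filter_subset _ _) fun _ _ _ => by positivity

section Extremal

variable {X V : Type} [Fintype X] [Fintype V] (r : X → V → V → V → V → Prop) (W : Finset V)

open Classical in
/-- The number of edges at a vertex whose other vertices avoid `W`. -/
noncomputable def innerDeg (v : V) : ℕ :=
  #{q : X × V × V × V | (q.2.1 ∉ W ∧ q.2.2.1 ∉ W ∧ q.2.2.2 ∉ W) ∧ r q.1 v q.2.1 q.2.2.1 q.2.2.2}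

open Classical in
/-- The number of edges in the link of `x` that avoid `W`. -/
noncomputable def innerLink (x : X) : ℕ :=
  #{q : V × V × V × V | (q.1 ∉ W ∧ q.2.1 ∉ W ∧ q.2.2.1 ∉ W ∧ q.2.2.2 ∉ W) ∧
    r x q.1 q.2.1 q.2.2.1 q.2.2.2}

open Classical in
/-- The number of non-edges at a vertex with another vertex in `W`. -/
noncomputable def missIn (v : V) : ℕ :=
  #{q : X × V × V × V | q.2.1 ∈ W ∧ ¬ r q.1 v q.2.1 q.2.2.1 q.2.2.2}

open Classical in
/-- The number of non-edges at a vertex with another vertex outside `W`. -/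
noncomputable def missOut (v : V) : ℕ :=
  #{q : X × V × V × V | q.2.1 ∉ W ∧ ¬ r q.1 v q.2.1 q.2.2.1 q.2.2.2}

open Classical in
/-- The number of non-edges in the link of `x` with vertices outside and inside `W`. -/
noncomputable def missLink (x : X) : ℕ :=
  #{q : V × V × V × V | q.1 ∉ W ∧ q.2.1 ∈ W ∧ ¬ r x q.1 q.2.1 q.2.2.1 q.2.2.2}

open Classical in
lemma card_triple_hits_le (hW : 4 * #W = Fintype.card V) :
    (#{q : V × V × V | ¬ (q.1 ∉ W ∧ q.2.1 ∉ W ∧ q.2.2 ∉ W)} : ℝ) =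
      37 / 64 * (Fintype.card V : ℝ) ^ 3 := by
  have h1 := card_filter_add_card_filter_not (s := (univ : Finset (V × V × V)))
    (fun q : V × V × V => q.1 ∉ W ∧ q.2.1 ∉ W ∧ q.2.2 ∉ W)
  have h2 : (univ.filter fun q : V × V × V => q.1 ∉ W ∧ q.2.1 ∉ W ∧ q.2.2 ∉ W) =
      Wᶜ ×ˢ Wᶜ ×ˢ Wᶜ := by
    ext q; simp
  rw [h2, card_product, card_product, card_univ, Fintype.card_prod, Fintype.card_prod] at h1
  have h3 := card_add_card_compl W
  have h4 : (#Wᶜ : ℝ) = 3 / 4 * Fintype.card V := by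
    have : (#W : ℝ) + #Wᶜ = Fintype.card V := by exact_mod_cast h3
    have h5 : (4 : ℝ) * #W = Fintype.card V := by exact_mod_cast hW
    linarith
  have h5 := congrArg (Nat.cast : ℕ → ℝ) h1
  push_cast at h5
  rw [h4] at h5
  linarith

open Classical in
lemma missIn_le (hW : 4 * #W = Fintype.card V) (hX : 4 * Fintype.card X = Fintype.card V)
    (hdeg : ∀ x v, 37 / 64 * (Fintype.card V : ℝ) ^ 3 - 6 * (Fintype.card V : ℝ) ^ 2 ≤
      #{q : V × V × V | r x v q.1 q.2.1 q.2.2}) (v : V) :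
    (missIn r W v : ℝ) ≤ innerDeg r W v + 2 * (Fintype.card V : ℝ) ^ 3 := by
  have h1 : ∀ x, (#{q : V × V × V | q.1 ∈ W ∧ ¬ r x v q.1 q.2.1 q.2.2} : ℝ) ≤
      #{q : V × V × V | (q.1 ∉ W ∧ q.2.1 ∉ W ∧ q.2.2 ∉ W) ∧ r x v q.1 q.2.1 q.2.2} +
        6 * (Fintype.card V : ℝ) ^ 2 := by
    intro x
    have hd : Disjoint (univ.filter fun q : V × V × V => q.1 ∈ W ∧ ¬ r x v q.1 q.2.1 q.2.2)
        (univ.filter fun q : V × V × V => r x v q.1 q.2.1 q.2.2) := by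
      rw [Finset.disjoint_left]
      intro q hq hq'
      exact (mem_filter.1 hq).2.2 (mem_filter.1 hq').2
    have hs : (univ.filter fun q : V × V × V => q.1 ∈ W ∧ ¬ r x v q.1 q.2.1 q.2.2) ∪
        (univ.filter fun q : V × V × V => r x v q.1 q.2.1 q.2.2) ⊆
        (univ.filter fun q : V × V × V => (q.1 ∉ W ∧ q.2.1 ∉ W ∧ q.2.2 ∉ W) ∧
          r x v q.1 q.2.1 q.2.2) ∪
        (univ.filter fun q : V × V × V => ¬ (q.1 ∉ W ∧ q.2.1 ∉ W ∧ q.2.2 ∉ W)) := by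
      intro q hq
      simp only [mem_union, mem_filter, mem_univ, true_and] at hq ⊢
      tauto
    have h2 := (card_le_card hs).trans (card_union_le _ _)
    rw [card_union_of_disjoint hd] at h2
    have h3 := (Nat.cast_le (α := ℝ)).2 h2
    push_cast at h3
    rw [card_triple_hits_le W hW] at h3
    linarith [hdeg x v]
  have h4 := sum_le_sum fun x (_ : x ∈ (univ : Finset X)) => h1 x
  rw [sum_add_distrib, sum_const, card_univ, nsmul_eq_mul] at h4
  have h5 : (missIn r W v : ℝ) =
      ∑ x, (#{q : V × V × V | q.1 ∈ W ∧ ¬ r x v q.1 q.2.1 q.2.2} : ℝ) := by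
    rw [missIn, ← Nat.cast_sum, sum_card_filter_eq]
    simp
  have h6 : (innerDeg r W v : ℝ) = ∑ x, (#{q : V × V × V | (q.1 ∉ W ∧ q.2.1 ∉ W ∧ q.2.2 ∉ W) ∧
      r x v q.1 q.2.1 q.2.2} : ℝ) := by
    rw [innerDeg, ← Nat.cast_sum, sum_card_filter_eq]
    simp
  have h7 : (4 : ℝ) * Fintype.card X = Fintype.card V := by exact_mod_cast hX
  have h8 : (Fintype.card X : ℝ) * (6 * (Fintype.card V : ℝ) ^ 2) =
      6 / 4 * (Fintype.card V : ℝ) ^ 3 := by rw [← h7]; ring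
  have h9 : (0 : ℝ) ≤ (Fintype.card V : ℝ) ^ 3 := by positivity
  rw [h5, h6]
  linarith

open Classical in
lemma sum_innerDeg_le : ∑ v ∈ Wᶜ, innerDeg r W v ≤
    #{q : X × V × V × V × V | (q.2.1 ∉ W ∧ q.2.2.1 ∉ W ∧ q.2.2.2.1 ∉ W ∧ q.2.2.2.2 ∉ W) ∧
      r q.1 q.2.1 q.2.2.1 q.2.2.2.1 q.2.2.2.2} := by
  unfold innerDeg
  rw [sum_card_filter_eq]
  refine card_le_card_of_injOn (fun p => (p.2.1, p.1, p.2.2)) ?_ ?_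
  · rintro ⟨v, x, b, c, d⟩ h
    simp only [coe_filter, mem_univ, true_and, Set.mem_ofPred_eq, mem_compl] at h ⊢
    tauto
  · rintro ⟨v, x, q⟩ _ ⟨v', x', q'⟩ _ h
    simp only [Prod.mk.injEq] at h ⊢
    tauto

open Classical in
lemma sum_innerLink_eq : ∑ x, innerLink r W x =
    #{q : X × V × V × V × V | (q.2.1 ∉ W ∧ q.2.2.1 ∉ W ∧ q.2.2.2.1 ∉ W ∧ q.2.2.2.2 ∉ W) ∧
      r q.1 q.2.1 q.2.2.1 q.2.2.2.1 q.2.2.2.2} := by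
  unfold innerLink
  rw [sum_card_filter_eq]
  congr 1
  ext q
  simp

open Classical in
lemma sum_missOut_le (h12 : ∀ x a b c d, r x a b c d → r x b a c d) :
    ∑ v ∈ W, missOut r W v ≤ ∑ v ∈ Wᶜ, missIn r W v := by
  unfold missOut missIn
  rw [sum_card_filter_eq, sum_card_filter_eq]
  refine card_le_card_of_injOn (fun p => (p.2.2.1, p.2.1, p.1, p.2.2.2)) ?_ ?_
  · rintro ⟨v, x, b, c, d⟩ h
    simp only [coe_filter, mem_univ, true_and, Set.mem_ofPred_eq, mem_compl] at h ⊢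
    exact ⟨h.2.1, h.1, fun h' => h.2.2 (h12 _ _ _ _ _ h')⟩
  · rintro ⟨v, x, b, q⟩ _ ⟨v', x', b', q'⟩ _ h
    simp only [Prod.mk.injEq] at h ⊢
    tauto

open Classical in
lemma sum_missLink_le : ∑ x, missLink r W x ≤ ∑ v ∈ Wᶜ, missIn r W v := by
  unfold missLink missIn
  rw [sum_card_filter_eq, sum_card_filter_eq]
  refine card_le_card_of_injOn (fun p => (p.2.1, p.1, p.2.2)) ?_ ?_
  · rintro ⟨x, a, b, c, d⟩ h
    simp only [coe_filter, mem_univ, true_and, Set.mem_ofPred_eq, mem_compl] at h ⊢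
    tauto
  · rintro ⟨v, x, q⟩ _ ⟨v', x', q'⟩ _ h
    simp only [Prod.mk.injEq] at h ⊢
    tauto

end Extremal

section Extremal

variable {X V : Type} [Fintype X] [Fintype V] (r : X → V → V → V → V → Prop) (W : Finset V)

open Classical in
lemma le_innerDeg_add_missOut (hW : 4 * #W = Fintype.card V)
    (hX : 4 * Fintype.card X = Fintype.card V) (v : V) :
    27 / 256 * (Fintype.card V : ℝ) ^ 4 ≤ innerDeg r W v + missOut r W v := by
  have h1 : (univ : Finset X) ×ˢ Wᶜ ×ˢ Wᶜ ×ˢ Wᶜ ⊆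
      (univ.filter fun q : X × V × V × V => (q.2.1 ∉ W ∧ q.2.2.1 ∉ W ∧ q.2.2.2 ∉ W) ∧
        r q.1 v q.2.1 q.2.2.1 q.2.2.2) ∪
      univ.filter fun q : X × V × V × V => q.2.1 ∉ W ∧ ¬ r q.1 v q.2.1 q.2.2.1 q.2.2.2 := by
    intro q hq
    simp only [mem_product, mem_univ, true_and, mem_compl, mem_union, mem_filter] at hq ⊢
    tauto
  have h2 := (card_le_card h1).trans (card_union_le _ _)
  rw [card_product, card_product, card_product, card_univ] at h2
  have h3 : Fintype.card X * (#Wᶜ * (#Wᶜ * #Wᶜ)) ≤ innerDeg r W v + missOut r W v := by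
    unfold innerDeg missOut
    exact h2
  have h4 := card_add_card_compl W
  have h5 : (#Wᶜ : ℝ) = 3 / 4 * Fintype.card V := by
    have : (#W : ℝ) + #Wᶜ = Fintype.card V := by exact_mod_cast h4
    have h5 : (4 : ℝ) * #W = Fintype.card V := by exact_mod_cast hW
    linarith
  have h6 : (Fintype.card X : ℝ) = 1 / 4 * Fintype.card V := by
    have h5 : (4 : ℝ) * Fintype.card X = Fintype.card V := by exact_mod_cast hX
    linarith
  have h7 := (Nat.cast_le (α := ℝ)).2 h3
  push_cast at h7
  rw [h5, h6] at h7
  refine le_trans (le_of_eq ?_) h7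
  ring

lemma card_le_of_mul_pow_four_le {k : ℕ} {n : ℝ} (hn : 0 < n)
    (h : (k : ℝ) * (1 / 10 ^ 6 * n ^ 4) ≤ 2 / 10 ^ 16 * n ^ 5) : (k : ℝ) ≤ 1 / 10 ^ 9 * n := by
  have h1 : (0 : ℝ) < 1 / 10 ^ 6 * n ^ 4 := by positivity
  have h2 : (0 : ℝ) < n ^ 5 := by positivity
  refine le_of_mul_le_mul_right (h.trans ?_) h1
  have h3 : 1 / 10 ^ 9 * n * (1 / 10 ^ 6 * n ^ 4) = 1 / 10 ^ 15 * n ^ 5 := by ring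
  rw [h3]
  linarith

open Classical in
/-- The vertices of an almost extremal configuration can be classified so that all but few of them
behave as in the extremal one. -/
lemma exists_extremal_classification (hW : 4 * #W = Fintype.card V)
    (hX : 4 * Fintype.card X = Fintype.card V) (hlarge : 10 ^ 17 ≤ Fintype.card V)
    (h12 : ∀ x a b c d, r x a b c d → r x b a c d)
    (hdeg : ∀ x v, 37 / 64 * (Fintype.card V : ℝ) ^ 3 - 6 * (Fintype.card V : ℝ) ^ 2 ≤
      #{q : V × V × V | r x v q.1 q.2.1 q.2.2})
    (hext : (#{q : X × V × V × V × V | (q.2.1 ∉ W ∧ q.2.2.1 ∉ W ∧ q.2.2.2.1 ∉ W ∧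
      q.2.2.2.2 ∉ W) ∧ r q.1 q.2.1 q.2.2.1 q.2.2.2.1 q.2.2.2.2} : ℝ) ≤
        1 / 10 ^ 16 * (Fintype.card V : ℝ) ^ 5) :
    ∃ (Y : Finset X) (U W' : Finset V),
      (#Yᶜ : ℝ) ≤ 2 / 10 ^ 9 * Fintype.card V ∧
      (∀ x ∈ Y, (innerLink r W x : ℝ) ≤ 1 / 10 ^ 6 * (Fintype.card V : ℝ) ^ 4 ∧
        (missLink r W x : ℝ) ≤ 1 / 10 ^ 6 * (Fintype.card V : ℝ) ^ 4) ∧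
      U ⊆ W ∧ U ⊆ W' ∧ (#(W \ U) : ℝ) ≤ 1 / 10 ^ 9 * Fintype.card V ∧
      (∀ u ∈ U, (missOut r W u : ℝ) ≤ 1 / 10 ^ 6 * (Fintype.card V : ℝ) ^ 4) ∧
      (#(W' \ W) : ℝ) ≤ 1 / 10 ^ 9 * Fintype.card V ∧
      (∀ v ∈ W', 1 / 10 ^ 6 * (Fintype.card V : ℝ) ^ 4 < innerDeg r W v) ∧
      ∀ v ∉ W', (innerDeg r W v : ℝ) ≤ 1 / 10 ^ 6 * (Fintype.card V : ℝ) ^ 4 ∧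
        (missIn r W v : ℝ) ≤ 2 / 10 ^ 6 * (Fintype.card V : ℝ) ^ 4 := by
  have hn : (10 : ℝ) ^ 17 ≤ Fintype.card V := by exact_mod_cast hlarge
  have hmiss := missIn_le r W hW hX hdeg
  have hI := (Nat.cast_le (α := ℝ)).2 (sum_innerDeg_le r W)
  have hJ := congrArg (Nat.cast : ℕ → ℝ) (sum_innerLink_eq r W)
  have hG := (Nat.cast_le (α := ℝ)).2 (sum_missOut_le r W h12)
  have hK := (Nat.cast_le (α := ℝ)).2 (sum_missLink_le r W)
  have hIG := le_innerDeg_add_missOut r W hW hX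
  have hIe := hI.trans hext
  have hJe := hJ.le.trans hext
  have hcW : (#Wᶜ : ℝ) ≤ Fintype.card V := by exact_mod_cast card_le_univ _
  generalize (Fintype.card V : ℝ) = n at *
  have hn0 : 0 < n := by linarith
  have hn3 : 2 * n ^ 3 ≤ 1 / 10 ^ 16 * n ^ 4 := by
    have : n ^ 4 = n * n ^ 3 := by ring
    rw [this]
    have h0 : 0 ≤ n ^ 3 := by positivity
    have h := mul_le_mul_of_nonneg_right hn h0
    linarith
  have hn4 : 0 < n ^ 4 := by positivity
  have hn5 : 0 < n ^ 5 := by positivity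
  have hH : ((∑ v ∈ Wᶜ, missIn r W v : ℕ) : ℝ) ≤ 2 / 10 ^ 16 * n ^ 5 := by
    have h1 : ((∑ v ∈ Wᶜ, missIn r W v : ℕ) : ℝ) ≤
        ((∑ v ∈ Wᶜ, innerDeg r W v : ℕ) : ℝ) + #Wᶜ * (1 / 10 ^ 16 * n ^ 4) := by
      push_cast
      rw [← nsmul_eq_mul, ← sum_const, ← sum_add_distrib]
      exact sum_le_sum fun v _ => (hmiss v).trans (by linarith)
    have h2 := mul_le_mul_of_nonneg_right hcW (by positivity : 0 ≤ 1 / 10 ^ 16 * n ^ 4)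
    have h3 : n * (1 / 10 ^ 16 * n ^ 4) = 1 / 10 ^ 16 * n ^ 5 := by ring
    linarith
  have b1 := card_le_of_mul_pow_four_le hn0 ((card_filter_lt_mul_le univ
    (fun x => innerLink r W x) (1 / 10 ^ 6 * n ^ 4)).trans (by linarith))
  have b2 := card_le_of_mul_pow_four_le hn0 ((card_filter_lt_mul_le univ
    (fun x => missLink r W x) (1 / 10 ^ 6 * n ^ 4)).trans (by linarith))
  have b3 := card_le_of_mul_pow_four_le hn0 ((card_filter_lt_mul_le W
    (fun x => missOut r W x) (1 / 10 ^ 6 * n ^ 4)).trans (by linarith))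
  have b4 := card_le_of_mul_pow_four_le hn0 ((card_filter_lt_mul_le Wᶜ
    (fun x => innerDeg r W x) (1 / 10 ^ 6 * n ^ 4)).trans (by linarith))
  refine ⟨univ.filter fun x => (innerLink r W x : ℝ) ≤ 1 / 10 ^ 6 * n ^ 4 ∧
      (missLink r W x : ℝ) ≤ 1 / 10 ^ 6 * n ^ 4,
    W.filter fun u => (missOut r W u : ℝ) ≤ 1 / 10 ^ 6 * n ^ 4,
    univ.filter fun v => 1 / 10 ^ 6 * n ^ 4 < innerDeg r W v, ?_, ?_, filter_subset _ _, ?_, ?_,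
    ?_, ?_, ?_, ?_⟩
  · have h1 : (univ.filter fun x => (innerLink r W x : ℝ) ≤ 1 / 10 ^ 6 * n ^ 4 ∧
        (missLink r W x : ℝ) ≤ 1 / 10 ^ 6 * n ^ 4)ᶜ ⊆
        (univ.filter fun x => 1 / 10 ^ 6 * n ^ 4 < (innerLink r W x : ℝ)) ∪
        univ.filter fun x => 1 / 10 ^ 6 * n ^ 4 < (missLink r W x : ℝ) := by
      intro x hx
      simp only [mem_compl, mem_filter, mem_univ, true_and, mem_union] at hx ⊢
      rw [not_and_or, not_le, not_le] at hx
      exact hx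
    have h2 := (Nat.cast_le (α := ℝ)).2 ((card_le_card h1).trans (card_union_le _ _))
    push_cast at h2
    linarith
  · exact fun x hx => (mem_filter.1 hx).2
  · intro u hu
    have h1 := (mem_filter.1 hu).2
    refine mem_filter.2 ⟨mem_univ _, ?_⟩
    have h2 := hIG u
    linarith
  · have h1 : (W \ W.filter fun u => (missOut r W u : ℝ) ≤ 1 / 10 ^ 6 * n ^ 4) =
        W.filter fun u => 1 / 10 ^ 6 * n ^ 4 < (missOut r W u : ℝ) := by
      rw [← filter_not]
      exact filter_congr fun u _ => not_le
    rw [h1]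
    exact b3
  · exact fun u hu => (mem_filter.1 hu).2
  · have h1 : (univ.filter fun v => 1 / 10 ^ 6 * n ^ 4 < (innerDeg r W v : ℝ)) \ W =
        Wᶜ.filter fun v => 1 / 10 ^ 6 * n ^ 4 < (innerDeg r W v : ℝ) := by
      ext v
      simp only [mem_sdiff, mem_filter, mem_univ, true_and, mem_compl]
      tauto
    rw [h1]
    exact b4
  · exact fun v hv => (mem_filter.1 hv).2
  · intro v hv
    have h1 : (innerDeg r W v : ℝ) ≤ 1 / 10 ^ 6 * n ^ 4 := by
      by_contra h
      exact hv (mem_filter.2 ⟨mem_univ _, not_le.1 h⟩)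
    refine ⟨h1, (hmiss v).trans ?_⟩
    linarith

end Extremal

open Classical in
lemma exists_independent {Ω : Type*} (E : Finset Ω) (Conf : Ω → Ω → Prop) {d : ℝ} (hd0 : 0 ≤ d)
    (hd : ∀ e ∈ E, (#{e' ∈ E | Conf e e'} : ℝ) ≤ d) (hself : ∀ e, Conf e e)
    (hsymm : ∀ e e', Conf e e' → Conf e' e) (k : ℕ) (hk : k * d < #E) :
    ∃ F ⊆ E, #F = k + 1 ∧ ∀ e ∈ F, ∀ e' ∈ F, e ≠ e' → ¬ Conf e e' := by
  induction k with
  | zero =>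
    have : 0 < #E := by
      have h : (0 : ℝ) < #E := by simpa using hk
      exact_mod_cast h
    obtain ⟨e, he⟩ := card_pos.1 this
    exact ⟨{e}, by simpa using he, by simp, by simp⟩
  | succ k ih =>
    obtain ⟨F, hFE, hF, hFi⟩ := ih (by push_cast at hk; linarith)
    have h1 : (#(F.biUnion fun e => E.filter fun e' => Conf e e') : ℝ) ≤ (k + 1) * d := by
      calc (#(F.biUnion fun e => E.filter fun e' => Conf e e') : ℝ) ≤
          ∑ e ∈ F, (#{e' ∈ E | Conf e e'} : ℝ) := by exact_mod_cast card_biUnion_le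
        _ ≤ ∑ e ∈ F, d := sum_le_sum fun e he => hd e (hFE he)
        _ = (k + 1) * d := by rw [sum_const, hF, nsmul_eq_mul]; push_cast; ring
    have h2 : #(F.biUnion fun e => E.filter fun e' => Conf e e') < #E := by
      push_cast at hk
      have h := h1.trans_lt hk
      exact_mod_cast h
    obtain ⟨e, he, hne⟩ := exists_mem_notMem_of_card_lt_card h2
    have h3 : ∀ f ∈ F, ¬ Conf f e := fun f hf hc =>
      hne (mem_biUnion.2 ⟨f, hf, mem_filter.2 ⟨he, hc⟩⟩)
    have h4 : e ∉ F := fun h => h3 e h (hself e)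
    refine ⟨insert e F, insert_subset he hFE, by rw [card_insert_of_notMem h4, hF], ?_⟩
    intro a ha b hb hab
    rcases mem_insert.1 ha with ha' | ha' <;> rcases mem_insert.1 hb with hb' | hb'
    · exact absurd (ha'.trans hb'.symm) hab
    · rw [ha']; exact fun h => h3 b hb' (hsymm _ _ h)
    · rw [hb']; exact h3 a ha'
    · exact hFi a ha' b hb' hab

open Classical in
lemma card_distinct_triples {V : Type*} [Fintype V] (S : Finset V) :
    (#{q : V × V × V | (q.1 ∈ S ∧ q.2.1 ∈ S ∧ q.2.2 ∈ S) ∧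
      q.1 ≠ q.2.1 ∧ q.1 ≠ q.2.2 ∧ q.2.1 ≠ q.2.2} : ℝ) = #S * (#S - 1) * (#S - 2) := by
  have h1 : #{q : V × V × V | (q.1 ∈ S ∧ q.2.1 ∈ S ∧ q.2.2 ∈ S) ∧
      q.1 ≠ q.2.1 ∧ q.1 ≠ q.2.2 ∧ q.2.1 ≠ q.2.2} =
      #(S.sigma fun a => (S.erase a).sigma fun b => (S.erase a).erase b) := by
    refine card_nbij' (fun q => ⟨q.1, q.2.1, q.2.2⟩) (fun p => (p.1, p.2.1, p.2.2)) ?_ ?_ ?_ ?_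
    · rintro ⟨a, b, c⟩ h
      simp only [coe_filter, mem_univ, true_and, Set.mem_ofPred_eq] at h
      simp only [coe_sigma, Set.mem_sigma_iff, mem_coe, mem_erase]
      exact ⟨h.1.1, ⟨h.2.1.symm, h.1.2.1⟩, h.2.2.2.symm, h.2.2.1.symm, h.1.2.2⟩
    · rintro ⟨a, b, c⟩ h
      simp only [mem_coe, mem_erase, mem_sigma] at h
      simp only [coe_filter, mem_univ, true_and, Set.mem_ofPred_eq]
      exact ⟨⟨h.1, h.2.1.2, h.2.2.2.2⟩, h.2.1.1.symm, h.2.2.2.1.symm, h.2.2.1.symm⟩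
    · intro _ _; rfl
    · intro _ _; rfl
  have h2 : #(S.sigma fun a => (S.erase a).sigma fun b => (S.erase a).erase b) =
      #S * ((#S - 1) * (#S - 1 - 1)) := by
    rw [card_sigma]
    refine (sum_congr rfl fun a ha => ?_).trans (by rw [sum_const, smul_eq_mul])
    rw [card_sigma]
    refine (sum_congr rfl fun b hb => card_erase_of_mem hb).trans ?_
    rw [sum_const, smul_eq_mul, card_erase_of_mem ha]
  rw [h1, h2]
  rcases Nat.lt_or_ge #S 2 with h | h
  · interval_cases #S <;> simp
  · have h3 : #S - 1 - 1 = #S - 2 := by omega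
    rw [h3]
    push_cast [Nat.cast_sub h, Nat.cast_sub (by omega : 1 ≤ #S)]
    ring

lemma card_filter_mem_le_of_injective {A B V : Type*} [Fintype A] [Fintype B] [DecidableEq V]
    (S : Finset V) (f : A → V) (g : A → B) (h : Function.Injective fun a => (f a, g a)) :
    #{a | f a ∈ S} ≤ #S * Fintype.card B := by
  rw [← card_univ, ← card_product]
  refine card_le_card_of_injOn (fun a => (f a, g a)) ?_ h.injOn
  intro a ha
  simpa using ha

section Extremal

variable {X V : Type} [Fintype X] [Fintype V] (r : X → V → V → V → V → Prop) (W W' : Finset V)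

open Classical in
lemma card_quadruple_hits_le (S : Finset V) :
    #{q : V × V × V × V | ¬ (q.1 ∉ S ∧ q.2.1 ∉ S ∧ q.2.2.1 ∉ S ∧ q.2.2.2 ∉ S)} ≤
      4 * (#S * Fintype.card V ^ 3) := by
  have hc : Fintype.card (V × V × V) = Fintype.card V ^ 3 := by
    simp only [Fintype.card_prod]; ring
  have h1 := card_filter_mem_le_of_injective S (fun q : V × V × V × V => q.1)
    (fun q => q.2) (fun _ _ h => h)
  have h2 := card_filter_mem_le_of_injective S (fun q : V × V × V × V => q.2.1)
    (fun q => (q.1, q.2.2)) (by rintro ⟨a, b, c, d⟩ ⟨a', b', c', d'⟩ h; simp_all)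
  have h3 := card_filter_mem_le_of_injective S (fun q : V × V × V × V => q.2.2.1)
    (fun q => (q.1, q.2.1, q.2.2.2)) (by rintro ⟨a, b, c, d⟩ ⟨a', b', c', d'⟩ h; simp_all)
  have h4 := card_filter_mem_le_of_injective S (fun q : V × V × V × V => q.2.2.2)
    (fun q => (q.1, q.2.1, q.2.2.1)) (by rintro ⟨a, b, c, d⟩ ⟨a', b', c', d'⟩ h; simp_all)
  rw [hc] at h1 h2 h3 h4
  have h5 : (univ.filter fun q : V × V × V × V =>
      ¬ (q.1 ∉ S ∧ q.2.1 ∉ S ∧ q.2.2.1 ∉ S ∧ q.2.2.2 ∉ S)) ⊆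
      ((univ.filter fun q : V × V × V × V => q.1 ∈ S) ∪
        univ.filter fun q : V × V × V × V => q.2.1 ∈ S) ∪
      ((univ.filter fun q : V × V × V × V => q.2.2.1 ∈ S) ∪
        univ.filter fun q : V × V × V × V => q.2.2.2 ∈ S) := by
    intro q hq
    simp only [mem_union, mem_filter, mem_univ, true_and] at hq ⊢
    tauto
  have h6 := card_le_card h5
  have h7 := card_union_le ((univ.filter fun q : V × V × V × V => q.1 ∈ S) ∪
        univ.filter fun q : V × V × V × V => q.2.1 ∈ S)
      ((univ.filter fun q : V × V × V × V => q.2.2.1 ∈ S) ∪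
        univ.filter fun q : V × V × V × V => q.2.2.2 ∈ S)
  have h8 := card_union_le (univ.filter fun q : V × V × V × V => q.1 ∈ S)
    (univ.filter fun q : V × V × V × V => q.2.1 ∈ S)
  have h9 := card_union_le (univ.filter fun q : V × V × V × V => q.2.2.1 ∈ S)
    (univ.filter fun q : V × V × V × V => q.2.2.2 ∈ S)
  omega

open Classical in
lemma card_star_hits_le (S : Finset V) :
    #{q : X × V × V × V | ¬ (q.2.1 ∉ S ∧ q.2.2.1 ∉ S ∧ q.2.2.2 ∉ S)} ≤
      3 * (#S * (Fintype.card X * Fintype.card V ^ 2)) := by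
  have hc : Fintype.card (X × V × V) = Fintype.card X * Fintype.card V ^ 2 := by
    simp only [Fintype.card_prod]; ring
  have h2 := card_filter_mem_le_of_injective S (fun q : X × V × V × V => q.2.1)
    (fun q => (q.1, q.2.2)) (by rintro ⟨a, b, c, d⟩ ⟨a', b', c', d'⟩ h; simp_all)
  have h3 := card_filter_mem_le_of_injective S (fun q : X × V × V × V => q.2.2.1)
    (fun q => (q.1, q.2.1, q.2.2.2)) (by rintro ⟨a, b, c, d⟩ ⟨a', b', c', d'⟩ h; simp_all)
  have h4 := card_filter_mem_le_of_injective S (fun q : X × V × V × V => q.2.2.2)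
    (fun q => (q.1, q.2.1, q.2.2.1)) (by rintro ⟨a, b, c, d⟩ ⟨a', b', c', d'⟩ h; simp_all)
  rw [hc] at h2 h3 h4
  have h5 : (univ.filter fun q : X × V × V × V => ¬ (q.2.1 ∉ S ∧ q.2.2.1 ∉ S ∧ q.2.2.2 ∉ S)) ⊆
      (univ.filter fun q : X × V × V × V => q.2.1 ∈ S) ∪
      ((univ.filter fun q : X × V × V × V => q.2.2.1 ∈ S) ∪
        univ.filter fun q : X × V × V × V => q.2.2.2 ∈ S) := by
    intro q hq
    simp only [mem_union, mem_filter, mem_univ, true_and] at hq ⊢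
    tauto
  have h6 := card_le_card h5
  have h7 := card_union_le (univ.filter fun q : X × V × V × V => q.2.1 ∈ S)
      ((univ.filter fun q : X × V × V × V => q.2.2.1 ∈ S) ∪
        univ.filter fun q : X × V × V × V => q.2.2.2 ∈ S)
  have h9 := card_union_le (univ.filter fun q : X × V × V × V => q.2.2.1 ∈ S)
    (univ.filter fun q : X × V × V × V => q.2.2.2 ∈ S)
  omega

open Classical in
lemma innerLink_le_add (x : X) :
    innerLink r W' x ≤ innerLink r W x + 4 * (#(W \ W') * Fintype.card V ^ 3) := by
  refine le_trans ?_ (Nat.add_le_add_left (card_quadruple_hits_le (W \ W')) _)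
  unfold innerLink
  refine le_trans (card_le_card ?_) (card_union_le _ _)
  intro q hq
  simp only [mem_union, mem_filter, mem_univ, true_and, mem_sdiff] at hq ⊢
  tauto

open Classical in
lemma innerDeg_le_add (v : V) : innerDeg r W' v ≤
    innerDeg r W v + 3 * (#(W \ W') * (Fintype.card X * Fintype.card V ^ 2)) := by
  refine le_trans ?_ (Nat.add_le_add_left (card_star_hits_le (W \ W')) _)
  unfold innerDeg
  refine le_trans (card_le_card ?_) (card_union_le _ _)
  intro q hq
  simp only [mem_union, mem_filter, mem_univ, true_and, mem_sdiff] at hq ⊢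
  tauto

/-- The vertices in `V` of a potential edge. -/
def tupleVerts (q : X × V × V × V × V) : Fin 4 → V := ![q.2.1, q.2.2.1, q.2.2.2.1, q.2.2.2.2]

variable {r} in
open Classical in
lemma card_inner_edges_at_le (h12 : ∀ x a b c d, r x a b c d → r x b a c d)
    (h23 : ∀ x a b c d, r x a b c d → r x a c b d) (h34 : ∀ x a b c d, r x a b c d → r x a b d c)
    (u : V) (i : Fin 4) :
    #{q : X × V × V × V × V | ((q.2.1 ∉ W ∧ q.2.2.1 ∉ W ∧ q.2.2.2.1 ∉ W ∧ q.2.2.2.2 ∉ W) ∧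
      r q.1 q.2.1 q.2.2.1 q.2.2.2.1 q.2.2.2.2) ∧ tupleVerts q i = u} ≤ innerDeg r W u := by
  unfold innerDeg
  fin_cases i
  · refine card_le_card_of_injOn (fun q => (q.1, q.2.2.1, q.2.2.2.1, q.2.2.2.2)) ?_ ?_
    · rintro ⟨x, a, b, c, d⟩ h
      obtain ⟨⟨h1, h2⟩, rfl⟩ := (mem_filter.1 (mem_coe.1 h)).2
      refine mem_coe.2 (mem_filter.2 ⟨mem_univ _, ?_⟩)
      exact ⟨h1.2, h2⟩
    · rintro ⟨x, a, b, c, d⟩ h ⟨x', a', b', c', d'⟩ h' heq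
      have h1 : a = u := (mem_filter.1 (mem_coe.1 h)).2.2
      have h2 : a' = u := (mem_filter.1 (mem_coe.1 h')).2.2
      simp only [Prod.mk.injEq] at heq ⊢
      have h3 := h1.trans h2.symm
      tauto
  · refine card_le_card_of_injOn (fun q => (q.1, q.2.1, q.2.2.2.1, q.2.2.2.2)) ?_ ?_
    · rintro ⟨x, a, b, c, d⟩ h
      obtain ⟨⟨h1, h2⟩, rfl⟩ := (mem_filter.1 (mem_coe.1 h)).2
      refine mem_coe.2 (mem_filter.2 ⟨mem_univ _, ?_⟩)
      exact ⟨⟨h1.1, h1.2.2⟩, h12 _ _ _ _ _ h2⟩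
    · rintro ⟨x, a, b, c, d⟩ h ⟨x', a', b', c', d'⟩ h' heq
      have h1 : b = u := (mem_filter.1 (mem_coe.1 h)).2.2
      have h2 : b' = u := (mem_filter.1 (mem_coe.1 h')).2.2
      simp only [Prod.mk.injEq] at heq ⊢
      have h3 := h1.trans h2.symm
      tauto
  · refine card_le_card_of_injOn (fun q => (q.1, q.2.1, q.2.2.1, q.2.2.2.2)) ?_ ?_
    · rintro ⟨x, a, b, c, d⟩ h
      obtain ⟨⟨h1, h2⟩, rfl⟩ := (mem_filter.1 (mem_coe.1 h)).2
      refine mem_coe.2 (mem_filter.2 ⟨mem_univ _, ?_⟩)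
      exact ⟨⟨h1.1, h1.2.1, h1.2.2.2⟩, h12 _ _ _ _ _ (h23 _ _ _ _ _ h2)⟩
    · rintro ⟨x, a, b, c, d⟩ h ⟨x', a', b', c', d'⟩ h' heq
      have h1 : c = u := (mem_filter.1 (mem_coe.1 h)).2.2
      have h2 : c' = u := (mem_filter.1 (mem_coe.1 h')).2.2
      simp only [Prod.mk.injEq] at heq ⊢
      have h3 := h1.trans h2.symm
      tauto
  · refine card_le_card_of_injOn (fun q => (q.1, q.2.1, q.2.2.1, q.2.2.2.1)) ?_ ?_
    · rintro ⟨x, a, b, c, d⟩ h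
      obtain ⟨⟨h1, h2⟩, rfl⟩ := (mem_filter.1 (mem_coe.1 h)).2
      refine mem_coe.2 (mem_filter.2 ⟨mem_univ _, ?_⟩)
      exact ⟨⟨h1.1, h1.2.1, h1.2.2.1⟩, h12 _ _ _ _ _ (h23 _ _ _ _ _ (h34 _ _ _ _ _ h2))⟩
    · rintro ⟨x, a, b, c, d⟩ h ⟨x', a', b', c', d'⟩ h' heq
      have h1 : d = u := (mem_filter.1 (mem_coe.1 h)).2.2
      have h2 : d' = u := (mem_filter.1 (mem_coe.1 h')).2.2
      simp only [Prod.mk.injEq] at heq ⊢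
      have h3 := h1.trans h2.symm
      tauto

end Extremal

section Extremal

variable {X V : Type} [Fintype X] [Fintype V]

open Classical in
lemma le_card_inner_triples (r : X → V → V → V → V → Prop) (W : Finset V)
    (hdist : ∀ x a b c d, r x a b c d → (a ≠ b ∧ a ≠ c ∧ a ≠ d) ∧ b ≠ c ∧ b ≠ d ∧ c ≠ d)
    (x : X) {v : V} (hv : v ∉ W) {L : ℝ}
    (hdeg : ((Fintype.card V : ℝ) - 1) * (Fintype.card V - 2) * (Fintype.card V - 3) - L ≤
      #{q : V × V × V | r x v q.1 q.2.1 q.2.2}) :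
    ((#Wᶜ : ℝ) - 1) * (#Wᶜ - 2) * (#Wᶜ - 3) - L ≤
      #{q : V × V × V | (q.1 ∉ W ∧ q.2.1 ∉ W ∧ q.2.2 ∉ W) ∧ r x v q.1 q.2.1 q.2.2} := by
  have h1 := card_distinct_triples ((univ : Finset V).erase v)
  have h2 := card_distinct_triples (Wᶜ.erase v)
  have hpos : 1 ≤ Fintype.card V := Fintype.card_pos_iff.2 ⟨v⟩
  have hv' : v ∈ Wᶜ := mem_compl.2 hv
  have hpos' : 1 ≤ #Wᶜ := card_pos.2 ⟨v, hv'⟩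
  rw [card_erase_of_mem (mem_univ v), card_univ, Nat.cast_sub hpos] at h1
  rw [card_erase_of_mem hv', Nat.cast_sub hpos'] at h2
  push_cast at h1 h2
  set D₁ := univ.filter fun q : V × V × V => (q.1 ∈ (univ : Finset V).erase v ∧
    q.2.1 ∈ (univ : Finset V).erase v ∧ q.2.2 ∈ (univ : Finset V).erase v) ∧
      q.1 ≠ q.2.1 ∧ q.1 ≠ q.2.2 ∧ q.2.1 ≠ q.2.2 with hD₁
  set D₂ := univ.filter fun q : V × V × V => (q.1 ∈ Wᶜ.erase v ∧
    q.2.1 ∈ Wᶜ.erase v ∧ q.2.2 ∈ Wᶜ.erase v) ∧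
      q.1 ≠ q.2.1 ∧ q.1 ≠ q.2.2 ∧ q.2.1 ≠ q.2.2 with hD₂
  have h3 : D₂ ⊆ D₁ := by
    intro q hq
    simp only [hD₁, hD₂, mem_filter, mem_univ, true_and, mem_erase, and_true] at hq ⊢
    tauto
  have h4 : (univ.filter fun q : V × V × V => r x v q.1 q.2.1 q.2.2) ⊆
      (univ.filter fun q : V × V × V => (q.1 ∉ W ∧ q.2.1 ∉ W ∧ q.2.2 ∉ W) ∧
        r x v q.1 q.2.1 q.2.2) ∪ (D₁ \ D₂) := by
    intro q hq
    have hq' := (mem_filter.1 hq).2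
    have hd := hdist _ _ _ _ _ hq'
    simp only [hD₁, hD₂, mem_union, mem_sdiff, mem_filter, mem_univ, true_and, mem_erase,
      mem_compl, and_true]
    by_cases h : q.1 ∉ W ∧ q.2.1 ∉ W ∧ q.2.2 ∉ W
    · exact Or.inl ⟨h, hq'⟩
    · refine Or.inr ⟨⟨⟨hd.1.1.symm, hd.1.2.1.symm, hd.1.2.2.symm⟩, hd.2⟩, fun h' => h ?_⟩
      exact ⟨h'.1.1.2, h'.1.2.1.2, h'.1.2.2.2⟩
  have h5 := (card_le_card h4).trans (card_union_le _ _)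
  rw [card_sdiff_of_subset h3] at h5
  have h6 := card_le_card h3
  have h7 := (Nat.cast_le (α := ℝ)).2 h5
  push_cast [Nat.cast_sub h6] at h7
  rw [h1, h2] at h7
  have h8 := hdeg.trans h7
  ring_nf at h8 ⊢
  linarith

open Classical in
lemma le_card_inner_edges (r : X → V → V → V → V → Prop) (W : Finset V) (Y : Finset X)
    {y b t : ℝ} (hb0 : 0 ≤ b) (ht0 : 0 ≤ t) (hy : y ≤ #Y) (hb : b ≤ #Wᶜ)
    (ht : ∀ x v, v ∉ W → t ≤
      #{q : V × V × V | (q.1 ∉ W ∧ q.2.1 ∉ W ∧ q.2.2 ∉ W) ∧ r x v q.1 q.2.1 q.2.2}) :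
    y * (b * t) ≤ #{q : X × V × V × V × V | q.1 ∈ Y ∧ q.2.1 ∉ W ∧
      (q.2.2.1 ∉ W ∧ q.2.2.2.1 ∉ W ∧ q.2.2.2.2 ∉ W) ∧
        r q.1 q.2.1 q.2.2.1 q.2.2.2.1 q.2.2.2.2} := by
  have h1 : ∀ x, b * t ≤ #{q : V × V × V × V | q.1 ∉ W ∧ (q.2.1 ∉ W ∧ q.2.2.1 ∉ W ∧ q.2.2.2 ∉ W) ∧
      r x q.1 q.2.1 q.2.2.1 q.2.2.2} := by
    intro x
    have h := mul_le_card_filter_prod (d₁ := b) (d₂ := t) (fun v => v ∉ W)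
      (fun v (q : V × V × V) => (q.1 ∉ W ∧ q.2.1 ∉ W ∧ q.2.2 ∉ W) ∧ r x v q.1 q.2.1 q.2.2) ht0
      (by rw [← compl_filter, filter_mem_eq_inter, univ_inter]; exact hb)
      (fun v hv => (ht x v hv).trans_eq (by congr!))
    exact h.trans_eq (by congr!)
  have h := mul_le_card_filter_prod (d₁ := y) (d₂ := b * t) (fun x => x ∈ Y)
    (fun x (q : V × V × V × V) => q.1 ∉ W ∧ (q.2.1 ∉ W ∧ q.2.2.1 ∉ W ∧ q.2.2.2 ∉ W) ∧
      r x q.1 q.2.1 q.2.2.1 q.2.2.2) (by positivity)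
    (hy.trans_eq (by congr 2; ext; simp))
    (fun x _ => (h1 x).trans_eq (by congr!))
  exact h.trans_eq (by congr!)

open Classical in
lemma card_family_verts [Nonempty V] (F : Finset (X × V × V × V × V))
    (hinj : ∀ q ∈ F, Function.Injective (tupleVerts q))
    (hd : ∀ q ∈ F, ∀ q' ∈ F, ∀ i j, tupleVerts q i = tupleVerts q' j → q = q') :
    #((univ : Finset F).biUnion fun q => univ.image (tupleVerts q.1)) = 4 * #F := by
  rw [card_biUnion]
  · rw [sum_congr rfl fun q _ => card_image_of_injective univ (hinj q.1 q.2)]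
    simp [mul_comm]
  · intro q _ q' _ hne
    refine Finset.disjoint_left.2 ?_
    intro u hu hu'
    obtain ⟨i, -, hi⟩ := mem_image.1 hu
    obtain ⟨j, -, hj⟩ := mem_image.1 hu'
    exact hne (Subtype.ext (hd _ q.2 _ q'.2 i j (hi.trans hj.symm)))

open Classical in
/-- In an almost extremal configuration whose special set `W'` is too small, the deficit can be
compensated by disjoint edges avoiding `W'`. -/
lemma exists_inner_matching (R : X → (Fin 4 → V) → Prop) (W W' : Finset V) (Y : Finset X)
    (hW : 4 * #W = Fintype.card V) (hX : 4 * Fintype.card X = Fintype.card V)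
    (hlarge : 10 ^ 17 ≤ Fintype.card V)
    (hinj : ∀ x w, R x w → Function.Injective w)
    (hperm : ∀ x w (σ : Equiv.Perm (Fin 4)), R x w → R x (w ∘ σ))
    (hdeg : ∀ x v, ((Fintype.card V : ℝ) - 1) * (Fintype.card V - 2) * (Fintype.card V - 3) -
      (3 / 4 * (Fintype.card V : ℝ) * (3 / 4 * Fintype.card V - 1) *
        (3 / 4 * Fintype.card V - 2) - 1) ≤
      #{q : V × V × V | R x ![v, q.1, q.2.1, q.2.2]})
    (hY : (#Yᶜ : ℝ) ≤ 2 / 10 ^ 9 * Fintype.card V)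
    (hYlink : ∀ x ∈ Y, (innerLink (fun x a b c d => R x ![a, b, c, d]) W x : ℝ) ≤
      1 / 10 ^ 6 * (Fintype.card V : ℝ) ^ 4)
    (hWW' : (#(W \ W') : ℝ) ≤ 1 / 10 ^ 9 * Fintype.card V)
    (hW' : ∀ v, v ∉ W' → (innerDeg (fun x a b c d => R x ![a, b, c, d]) W v : ℝ) ≤
      1 / 10 ^ 6 * (Fintype.card V : ℝ) ^ 4) :
    ∃ A B, #A = #W - #W' ∧ #B = 4 * #A ∧ Disjoint B W' ∧ MatchIn R A B := by
  rcases Nat.lt_or_ge #W' #W with hlt | hge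
  swap
  · refine ⟨∅, ∅, by simp; omega, by simp, by simp, ?_⟩
    have : Nonempty V := Fintype.card_pos_iff.1 (by omega)
    exact ⟨fun _ _ => Classical.arbitrary V, by simp, by simp, by simp⟩
  obtain ⟨s, hs⟩ : ∃ s, #W = #W' + (s + 1) := ⟨#W - #W' - 1, by omega⟩
  set r : X → V → V → V → V → Prop := fun x a b c d => R x ![a, b, c, d] with hr
  have h12 : ∀ x a b c d, r x a b c d → r x b a c d := by
    intro x a b c d h
    have := hperm x _ (Equiv.swap 0 1) h
    convert this using 1
    funext i; fin_cases i <;> rfl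
  have h23 : ∀ x a b c d, r x a b c d → r x a c b d := by
    intro x a b c d h
    have := hperm x _ (Equiv.swap 1 2) h
    convert this using 1
    funext i; fin_cases i <;> rfl
  have h34 : ∀ x a b c d, r x a b c d → r x a b d c := by
    intro x a b c d h
    have := hperm x _ (Equiv.swap 2 3) h
    convert this using 1
    funext i; fin_cases i <;> rfl
  have hdist : ∀ x a b c d, r x a b c d → (a ≠ b ∧ a ≠ c ∧ a ≠ d) ∧ b ≠ c ∧ b ≠ d ∧ c ≠ d := by
    intro x a b c d h
    have hi := hinj x _ h
    have hne : ∀ i j : Fin 4, i ≠ j → ![a, b, c, d] i ≠ ![a, b, c, d] j := fun i j h => hi.ne h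
    exact ⟨⟨hne 0 1 (by decide), hne 0 2 (by decide), hne 0 3 (by decide)⟩,
      hne 1 2 (by decide), hne 1 3 (by decide), hne 2 3 (by decide)⟩
  have hcW := card_add_card_compl W'
  have hcY := card_add_card_compl Y
  have hlargeR : (10 : ℝ) ^ 17 ≤ Fintype.card V := by exact_mod_cast hlarge
  have hWR : 4 * ((#W' : ℝ) + (s + 1)) = Fintype.card V := by rw [hs] at hW; exact_mod_cast hW
  have hXR : 4 * (Fintype.card X : ℝ) = Fintype.card V := by exact_mod_cast hX
  have hcWR : (#W' : ℝ) + #W'ᶜ = Fintype.card V := by exact_mod_cast hcW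
  have hcYR : (#Y : ℝ) + #Yᶜ = Fintype.card X := by exact_mod_cast hcY
  set E : Finset (X × V × V × V × V) := univ.filter fun q => q.1 ∈ Y ∧ q.2.1 ∉ W' ∧
    (q.2.2.1 ∉ W' ∧ q.2.2.2.1 ∉ W' ∧ q.2.2.2.2 ∉ W') ∧
      r q.1 q.2.1 q.2.2.1 q.2.2.2.1 q.2.2.2.2 with hE
  set Conf : X × V × V × V × V → X × V × V × V × V → Prop := fun e e' =>
    e.1 = e'.1 ∨ ∃ i j, tupleVerts e i = tupleVerts e' j with hConf
  have hdegE : ∀ e ∈ E, (#{e' ∈ E | Conf e e'} : ℝ) ≤ 1 / 100 * (Fintype.card V : ℝ) ^ 4 := by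
    intro e he
    have hsub : (E.filter fun e' => Conf e e') ⊆
        (univ.filter fun q : X × V × V × V × V => q.1 = e.1 ∧ (q.2.1 ∉ W' ∧ q.2.2.1 ∉ W' ∧
          q.2.2.2.1 ∉ W' ∧ q.2.2.2.2 ∉ W') ∧ r e.1 q.2.1 q.2.2.1 q.2.2.2.1 q.2.2.2.2) ∪
        (univ : Finset (Fin 4 × Fin 4)).biUnion fun p => univ.filter fun q : X × V × V × V × V =>
          ((q.2.1 ∉ W' ∧ q.2.2.1 ∉ W' ∧ q.2.2.2.1 ∉ W' ∧ q.2.2.2.2 ∉ W') ∧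
            r q.1 q.2.1 q.2.2.1 q.2.2.2.1 q.2.2.2.2) ∧ tupleVerts q p.2 = tupleVerts e p.1 := by
      intro q hq
      obtain ⟨hq1, hq2⟩ := mem_filter.1 hq
      have hq3 := (mem_filter.1 hq1).2
      rcases hq2 with h | ⟨i, j, h⟩
      · refine mem_union_left _ (mem_filter.2 ⟨mem_univ _, h.symm, ?_, ?_⟩)
        · tauto
        · rw [h]; exact hq3.2.2.2
      · refine mem_union_right _ (mem_biUnion.2 ⟨(i, j), mem_univ _,
          mem_filter.2 ⟨mem_univ _, ?_, h.symm⟩⟩)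
        tauto
    have h1 : #(univ.filter fun q : X × V × V × V × V => q.1 = e.1 ∧ (q.2.1 ∉ W' ∧
        q.2.2.1 ∉ W' ∧ q.2.2.2.1 ∉ W' ∧ q.2.2.2.2 ∉ W') ∧
          r e.1 q.2.1 q.2.2.1 q.2.2.2.1 q.2.2.2.2) ≤ innerLink r W' e.1 := by
      unfold innerLink
      refine card_le_card_of_injOn (fun q => q.2) ?_ ?_
      · intro q hq
        exact mem_coe.2 (mem_filter.2 ⟨mem_univ _, (mem_filter.1 (mem_coe.1 hq)).2.2⟩)
      · intro q hq q' hq' h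
        exact Prod.ext ((mem_filter.1 (mem_coe.1 hq)).2.1.trans
          (mem_filter.1 (mem_coe.1 hq')).2.1.symm) h
    have he' := (mem_filter.1 he).2
    have hev : ∀ i, tupleVerts e i ∉ W' := by
      intro i
      fin_cases i
      exacts [he'.2.1, he'.2.2.1.1, he'.2.2.1.2.1, he'.2.2.1.2.2]
    have h2 : ∀ p : Fin 4 × Fin 4, (#(univ.filter fun q : X × V × V × V × V =>
          ((q.2.1 ∉ W' ∧ q.2.2.1 ∉ W' ∧ q.2.2.2.1 ∉ W' ∧ q.2.2.2.2 ∉ W') ∧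
            r q.1 q.2.1 q.2.2.1 q.2.2.2.1 q.2.2.2.2) ∧ tupleVerts q p.2 = tupleVerts e p.1) : ℝ) ≤
          2 / 10 ^ 6 * (Fintype.card V : ℝ) ^ 4 := by
      intro p
      have h3 := (card_inner_edges_at_le W' h12 h23 h34 (tupleVerts e p.1) p.2).trans
        (innerDeg_le_add r W W' (tupleVerts e p.1))
      have h4 := (Nat.cast_le (α := ℝ)).2 h3
      push_cast at h4
      have h5 := hW' _ (hev p.1)
      have h6 : (Fintype.card X : ℝ) * (Fintype.card V : ℝ) ^ 2 =
          1 / 4 * (Fintype.card V : ℝ) ^ 3 := by rw [← hXR]; ring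
      rw [h6] at h4
      have h7 := mul_le_mul_of_nonneg_right hWW'
        (by positivity : (0 : ℝ) ≤ 1 / 4 * (Fintype.card V : ℝ) ^ 3)
      have h8 : (0 : ℝ) ≤ (Fintype.card V : ℝ) ^ 4 := by positivity
      have h9 : 1 / 10 ^ 9 * (Fintype.card V : ℝ) * (1 / 4 * (Fintype.card V : ℝ) ^ 3) =
        1 / 4 / 10 ^ 9 * (Fintype.card V : ℝ) ^ 4 := by ring
      rw [h9] at h7
      refine h4.trans ?_
      linarith
    have h3 : (innerLink r W' e.1 : ℝ) ≤ 2 / 10 ^ 6 * (Fintype.card V : ℝ) ^ 4 := by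
      have h4 := (Nat.cast_le (α := ℝ)).2 (innerLink_le_add r W W' e.1)
      push_cast at h4
      have h5 := hYlink _ he'.1
      have h7 := mul_le_mul_of_nonneg_right hWW'
        (by positivity : (0 : ℝ) ≤ (Fintype.card V : ℝ) ^ 3)
      have h8 : (0 : ℝ) ≤ (Fintype.card V : ℝ) ^ 4 := by positivity
      have h9 : 1 / 10 ^ 9 * (Fintype.card V : ℝ) * (Fintype.card V : ℝ) ^ 3 =
        1 / 10 ^ 9 * (Fintype.card V : ℝ) ^ 4 := by ring
      rw [h9] at h7
      refine h4.trans ?_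
      linarith
    have h4 := (card_le_card hsub).trans ((card_union_le _ _).trans
      (Nat.add_le_add h1 card_biUnion_le))
    have h5 := (Nat.cast_le (α := ℝ)).2 h4
    rw [Nat.cast_add, Nat.cast_sum] at h5
    have h6 := sum_le_sum fun p (_ : p ∈ (univ : Finset (Fin 4 × Fin 4))) => h2 p
    rw [sum_const, card_univ, nsmul_eq_mul] at h6
    have h7 : ((Fintype.card (Fin 4 × Fin 4) : ℕ) : ℝ) = 16 := by simp
    rw [h7] at h6
    have h8 : (0 : ℝ) ≤ (Fintype.card V : ℝ) ^ 4 := by positivity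
    refine h5.trans ((add_le_add h3 h6).trans ?_)
    linarith
  have hEcard : (s : ℝ) * (1 / 100 * (Fintype.card V : ℝ) ^ 4) < #E := by
    have h1 : ∀ x v, v ∉ W' → (s : ℝ) * (Fintype.card V : ℝ) ^ 2 + 1 ≤
        #{q : V × V × V | (q.1 ∉ W' ∧ q.2.1 ∉ W' ∧ q.2.2 ∉ W') ∧ r x v q.1 q.2.1 q.2.2} := by
      intro x v hv
      refine le_trans ?_ (le_card_inner_triples r W' hdist x hv (hdeg x v))
      have h2 : (#W'ᶜ : ℝ) = 3 / 4 * Fintype.card V + s + 1 := by linarith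
      rw [h2]
      generalize (Fintype.card V : ℝ) = n at *
      have h3 : (0 : ℝ) ≤ s := by positivity
      have h4 : (0 : ℝ) ≤ s * (n * (11 / 16 * n - 9 / 2)) :=
        mul_nonneg h3 (mul_nonneg (by linarith) (by linarith))
      have h5 : (0 : ℝ) ≤ s * (s * (9 / 4 * n - 3)) :=
        mul_nonneg h3 (mul_nonneg h3 (by linarith))
      have h6 : (0 : ℝ) ≤ s * (s * s + 2) := by positivity
      nlinarith
    have h3 : 1 / 5 * (Fintype.card V : ℝ) *
        (3 / 4 * (Fintype.card V : ℝ) * ((s : ℝ) * (Fintype.card V : ℝ) ^ 2 + 1)) ≤ #E := by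
      have h0 : (0 : ℝ) ≤ s := by positivity
      exact le_card_inner_edges r W' Y (by positivity) (by positivity) (by linarith) (by linarith)
        h1
    refine lt_of_lt_of_le ?_ h3
    generalize (Fintype.card V : ℝ) = n at *
    have h4 : (0 : ℝ) ≤ s * n ^ 4 := by positivity
    have h5 : (0 : ℝ) < n ^ 2 := by
      have : 0 < n := lt_of_lt_of_le (by positivity) hlargeR
      positivity
    have h6 : 1 / 5 * n * (3 / 4 * n * (s * n ^ 2 + 1)) = 3 / 20 * (s * n ^ 4) + 3 / 20 * n ^ 2 := by
      ring
    rw [h6]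
    linarith
  obtain ⟨F, hFE, hF, hFi⟩ := exists_independent E Conf (by positivity)
    (fun e he => by convert hdegE e he)
    (fun e => Or.inl rfl) (fun e e' h => by
      rcases h with h | ⟨i, j, h⟩
      · exact Or.inl h.symm
      · exact Or.inr ⟨j, i, h.symm⟩) s hEcard
  have : Nonempty V := Fintype.card_pos_iff.1 (by omega)
  have hFR : ∀ q ∈ F, R q.1 (tupleVerts q) := fun q hq => (mem_filter.1 (hFE hq)).2.2.2.2
  have hFd : ∀ q ∈ F, ∀ q' ∈ F, ∀ i j, tupleVerts q i = tupleVerts q' j → q = q' := by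
    intro q hq q' hq' i j h
    by_contra hne
    exact hFi q hq q' hq' hne (Or.inr ⟨i, j, h⟩)
  have hAc : #((univ : Finset F).image fun q => q.1.1) = #F := by
    rw [card_image_of_injective, card_univ, Fintype.card_coe]
    intro q q' h
    by_contra hne
    exact hFi q q.2 q' q'.2 (fun h => hne (Subtype.ext h)) (Or.inl h)
  refine ⟨(univ : Finset F).image fun q => q.1.1,
    (univ : Finset F).biUnion fun q => univ.image (tupleVerts q.1), ?_, ?_, ?_, ?_⟩
  · rw [hAc]; omega
  · rw [hAc]; exact card_family_verts F (fun q hq => hinj _ _ (hFR q hq)) hFd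
  · rw [Finset.disjoint_left]
    intro u hu
    obtain ⟨q, -, hq⟩ := mem_biUnion.1 hu
    obtain ⟨i, -, rfl⟩ := mem_image.1 hq
    have h := (mem_filter.1 (hFE q.2)).2
    fin_cases i
    exacts [h.2.1, h.2.2.1.1, h.2.2.1.2.1, h.2.2.1.2.2]
  · exact matchIn_of_family (fun q : F => q.1.1) (fun q => tupleVerts q.1)
      (fun q => hFR q.1 q.2) fun q q' i j h => Subtype.ext (hFd _ q.2 _ q'.2 i j h)

end Extremal

lemma exists_state_all_done {S T : Type*} (Inv : S → Prop) (size : S → ℕ) (Done : S → T → Prop)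
    (K : ℕ) (step : ∀ s t, Inv s → size s ≤ K → ∃ s', Inv s' ∧ size s' ≤ size s + 1 ∧ Done s' t ∧
      ∀ t', Done s t' → Done s' t') (s₀ : S) (h₀ : Inv s₀) (I : Finset T)
    (hK : size s₀ + #I ≤ K) :
    ∃ s, Inv s ∧ size s ≤ size s₀ + #I ∧ (∀ t ∈ I, Done s t) ∧ ∀ t, Done s₀ t → Done s t := by
  classical
  induction I using Finset.induction_on with
  | empty => exact ⟨s₀, h₀, by simp, by simp, fun _ h => h⟩
  | insert t I ht ih =>
    rw [card_insert_of_notMem ht] at hK ⊢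
    obtain ⟨s, hs, hsize, hdone, hkeep⟩ := ih (by omega)
    obtain ⟨s', hs', hsize', hdone', hkeep'⟩ := step s t hs (by omega)
    refine ⟨s', hs', by omega, ?_, fun t' h => hkeep' _ (hkeep _ h)⟩
    intro t' h
    rcases mem_insert.1 h with rfl | h
    · exact hdone'
    · exact hkeep' _ (hdone _ h)

section Extremal

variable {X V : Type} [Fintype X] [Fintype V] {R : X → (Fin 4 → V) → Prop}

/-- A partial matching in which at most `#A - k` vertices of `W` are used. -/
def IsFrugal [DecidableEq V] (R : X → (Fin 4 → V) → Prop) (W : Finset V) (k : ℕ)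
    (s : Finset X × Finset V) : Prop :=
  MatchIn R s.1 s.2 ∧ #s.2 = 4 * #s.1 ∧ #(s.2 ∩ W) + k ≤ #s.1

open Classical in
lemma IsFrugal.add_edge [Nonempty V] {W : Finset V} {k : ℕ} {s : Finset X × Finset V}
    (h : IsFrugal R W k s) {x : X} {w : Fin 4 → V} (hx : x ∉ s.1) (hR : R x w)
    (hw : Function.Injective w) (hws : ∀ i, w i ∉ s.2) {j : Fin 4} (hj : ∀ i, i ≠ j → w i ∉ W) :
    IsFrugal R W k (insert x s.1, s.2 ∪ univ.image w) := by
  obtain ⟨hm, hB, hW⟩ := h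
  have hd : Disjoint s.2 (univ.image w) := by
    rw [Finset.disjoint_left]
    intro v hv hv'
    obtain ⟨i, -, rfl⟩ := mem_image.1 hv'
    exact hws i hv
  have h1 : MatchIn R {x} (univ.image w) :=
    ⟨fun _ => w, by simpa using hR, by simp, by simp⟩
  refine ⟨?_, ?_, ?_⟩
  · have := hm.union h1 hd
    rw [union_comm] at this
    exact this
  · change #(s.2 ∪ univ.image w) = 4 * #(insert x s.1)
    rw [card_union_of_disjoint hd, card_insert_of_notMem hx, card_image_of_injective _ hw, hB,
      card_univ, Fintype.card_fin]
    ring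
  · change #((s.2 ∪ univ.image w) ∩ W) + k ≤ #(insert x s.1)
    rw [card_insert_of_notMem hx, union_inter_distrib_right]
    have h2 : univ.image w ∩ W ⊆ {w j} := by
      intro v hv
      obtain ⟨hv1, hv2⟩ := mem_inter.1 hv
      obtain ⟨i, -, rfl⟩ := mem_image.1 hv1
      by_contra hne
      exact hj i (fun h => hne (by simp [h])) hv2
    have h3 := card_le_card h2
    rw [card_singleton] at h3
    have h4 := card_union_le (s.2 ∩ W) (univ.image w ∩ W)
    omega

open Classical in
lemma card_triple_bad_le (S T : Finset V) :
    #{q : V × V × V | (q.1 ∈ S ∧ q.2.1 ∈ S ∨ q.1 ∈ S ∧ q.2.2 ∈ S ∨ q.2.1 ∈ S ∧ q.2.2 ∈ S) ∨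
      q.1 ∈ T ∨ q.2.1 ∈ T ∨ q.2.2 ∈ T} ≤
      3 * (#S * #S * Fintype.card V) + 3 * (#T * (Fintype.card V * Fintype.card V)) := by
  have h1 := card_filter_mem_le_of_injective (S ×ˢ S) (fun q : V × V × V => (q.1, q.2.1))
    (fun q => q.2.2) (by rintro ⟨b, c, d⟩ ⟨b', c', d'⟩ h; simp_all)
  have h2 := card_filter_mem_le_of_injective (S ×ˢ S) (fun q : V × V × V => (q.1, q.2.2))
    (fun q => q.2.1) (by rintro ⟨b, c, d⟩ ⟨b', c', d'⟩ h; simp_all)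
  have h3 := card_filter_mem_le_of_injective (S ×ˢ S) (fun q : V × V × V => (q.2.1, q.2.2))
    (fun q => q.1) (by rintro ⟨b, c, d⟩ ⟨b', c', d'⟩ h; simp_all)
  have h4 := card_filter_mem_le_of_injective T (fun q : V × V × V => q.1)
    (fun q => (q.2.1, q.2.2)) (by rintro ⟨b, c, d⟩ ⟨b', c', d'⟩ h; simp_all)
  have h5 := card_filter_mem_le_of_injective T (fun q : V × V × V => q.2.1)
    (fun q => (q.1, q.2.2)) (by rintro ⟨b, c, d⟩ ⟨b', c', d'⟩ h; simp_all)
  have h6 := card_filter_mem_le_of_injective T (fun q : V × V × V => q.2.2)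
    (fun q => (q.1, q.2.1)) (by rintro ⟨b, c, d⟩ ⟨b', c', d'⟩ h; simp_all)
  rw [card_product] at h1 h2 h3
  rw [Fintype.card_prod] at h4 h5 h6
  set F₁ := univ.filter fun q : V × V × V => (q.1, q.2.1) ∈ S ×ˢ S
  set F₂ := univ.filter fun q : V × V × V => (q.1, q.2.2) ∈ S ×ˢ S
  set F₃ := univ.filter fun q : V × V × V => (q.2.1, q.2.2) ∈ S ×ˢ S
  set F₄ := univ.filter fun q : V × V × V => q.1 ∈ T
  set F₅ := univ.filter fun q : V × V × V => q.2.1 ∈ T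
  set F₆ := univ.filter fun q : V × V × V => q.2.2 ∈ T
  have h7 : (univ.filter fun q : V × V × V =>
      (q.1 ∈ S ∧ q.2.1 ∈ S ∨ q.1 ∈ S ∧ q.2.2 ∈ S ∨ q.2.1 ∈ S ∧ q.2.2 ∈ S) ∨
        q.1 ∈ T ∨ q.2.1 ∈ T ∨ q.2.2 ∈ T) ⊆ (F₁ ∪ (F₂ ∪ F₃)) ∪ (F₄ ∪ (F₅ ∪ F₆)) := by
    intro q hq
    simp only [F₁, F₂, F₃, F₄, F₅, F₆, mem_union, mem_filter, mem_univ, true_and,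
      mem_product] at hq ⊢
    tauto
  have h8 := card_le_card h7
  have h9 := card_union_le (F₁ ∪ (F₂ ∪ F₃)) (F₄ ∪ (F₅ ∪ F₆))
  have h10 := card_union_le F₁ (F₂ ∪ F₃)
  have h11 := card_union_le F₂ F₃
  have h12 := card_union_le F₄ (F₅ ∪ F₆)
  have h13 := card_union_le F₅ F₆
  omega

open Classical in
lemma exists_edge_at_left (hlarge : 10 ^ 17 ≤ Fintype.card V)
    (hdeg : ∀ x v, 37 / 64 * (Fintype.card V : ℝ) ^ 3 - 6 * (Fintype.card V : ℝ) ^ 2 ≤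
      #{q : V × V × V | R x ![v, q.1, q.2.1, q.2.2]})
    {W B : Finset V} (hW : (#W : ℝ) ≤ 13 / 50 * Fintype.card V)
    (hB : (#B : ℝ) ≤ 1 / 100 * Fintype.card V) (x : X) :
    ∃ w : Fin 4 → V, R x w ∧ (∀ i, w i ∉ B) ∧ ∃ j, ∀ i, i ≠ j → w i ∉ W := by
  have hlargeR : (10 : ℝ) ^ 17 ≤ Fintype.card V := by exact_mod_cast hlarge
  obtain ⟨a, ha⟩ : ∃ a, a ∉ W ∪ B := by
    by_contra! h
    have h1 : (univ : Finset V) ⊆ W ∪ B := fun a _ => h a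
    have h2 := (card_le_card h1).trans (card_union_le _ _)
    rw [card_univ] at h2
    have h3 : (Fintype.card V : ℝ) ≤ #W + #B := by exact_mod_cast h2
    linarith
  rw [mem_union, not_or] at ha
  have h1 := card_triple_bad_le W B
  have h2 : #{q : V × V × V | (q.1 ∈ W ∧ q.2.1 ∈ W ∨ q.1 ∈ W ∧ q.2.2 ∈ W ∨ q.2.1 ∈ W ∧ q.2.2 ∈ W) ∨
      q.1 ∈ B ∨ q.2.1 ∈ B ∨ q.2.2 ∈ B} < #{q : V × V × V | R x ![a, q.1, q.2.1, q.2.2]} := by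
    have h3 := (Nat.cast_le (α := ℝ)).2 h1
    push_cast at h3
    have h4 := hdeg x a
    rw [← Nat.cast_lt (α := ℝ)]
    refine lt_of_le_of_lt h3 (lt_of_lt_of_le ?_ h4)
    have h5 : (0 : ℝ) ≤ #W := by positivity
    generalize (Fintype.card V : ℝ) = n at *
    generalize (#W : ℝ) = p at *
    generalize (#B : ℝ) = b at *
    have hn : 0 < n := lt_of_lt_of_le (by positivity) hlargeR
    have h6 : p * p ≤ 13 / 50 * n * (13 / 50 * n) := mul_le_mul hW hW h5 (by positivity)
    have h7 : p * p * n ≤ 13 / 50 * n * (13 / 50 * n) * n := mul_le_mul_of_nonneg_right h6 hn.le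
    have h8 : b * (n * n) ≤ 1 / 100 * n * (n * n) := mul_le_mul_of_nonneg_right hB (by positivity)
    have h9 : 6 * n ^ 2 ≤ 1 / 100 * n ^ 3 := by
      have : 0 ≤ n ^ 2 * (1 / 100 * n - 6) := mul_nonneg (by positivity) (by linarith)
      linarith [this, (by ring : n ^ 2 * (1 / 100 * n - 6) = 1 / 100 * n ^ 3 - 6 * n ^ 2)]
    have h10 : 0 < n ^ 3 := by positivity
    have h11 : 13 / 50 * n * (13 / 50 * n) * n = 169 / 2500 * n ^ 3 := by ring
    have h12 : 1 / 100 * n * (n * n) = 1 / 100 * n ^ 3 := by ring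
    linarith
  obtain ⟨⟨b, c, d⟩, h3, h4⟩ := exists_mem_notMem_of_card_lt_card h2
  have h5 : R x ![a, b, c, d] := (mem_filter.1 h3).2
  have h6 : ¬ ((b ∈ W ∧ c ∈ W ∨ b ∈ W ∧ d ∈ W ∨ c ∈ W ∧ d ∈ W) ∨ b ∈ B ∨ c ∈ B ∨ d ∈ B) :=
    fun h => h4 (mem_filter.2 ⟨mem_univ _, h⟩)
  refine ⟨![a, b, c, d], h5, ?_, ?_⟩
  · intro i
    fin_cases i
    · exact ha.2
    · exact fun h => h6 (Or.inr (Or.inl h))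
    · exact fun h => h6 (Or.inr (Or.inr (Or.inl h)))
    · exact fun h => h6 (Or.inr (Or.inr (Or.inr h)))
  · by_cases hb : b ∈ W
    · refine ⟨1, fun i hi => ?_⟩
      fin_cases i
      exacts [ha.1, absurd rfl hi, fun h : c ∈ W => h6 (by tauto), fun h : d ∈ W => h6 (by tauto)]
    · by_cases hc : c ∈ W
      · refine ⟨2, fun i hi => ?_⟩
        fin_cases i
        exacts [ha.1, hb, absurd rfl hi, fun h : d ∈ W => h6 (by tauto)]
      · refine ⟨3, fun i hi => ?_⟩
        fin_cases i
        exacts [ha.1, hb, hc, absurd rfl hi]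

open Classical in
lemma exists_edge_at_right (hX : 4 * Fintype.card X = Fintype.card V) (hpos : 0 < Fintype.card V)
    {W W' B : Finset V} {A : Finset X} (hW : (#(W' \ W) : ℝ) ≤ 1 / 10 ^ 9 * Fintype.card V)
    (hA : (#A : ℝ) ≤ 5 / 10 ^ 9 * Fintype.card V) (hB : (#B : ℝ) ≤ 20 / 10 ^ 9 * Fintype.card V)
    {v : V} (hvB : v ∉ B) (hv : 1 / 10 ^ 6 * (Fintype.card V : ℝ) ^ 4 <
      innerDeg (fun x a b c d => R x ![a, b, c, d]) W v) :
    ∃ x, x ∉ A ∧ ∃ w : Fin 4 → V, R x w ∧ w 0 = v ∧ (∀ i, w i ∉ B) ∧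
      ∀ i, i ≠ 0 → w i ∉ W' := by
  have h1 := card_star_hits_le (X := X) (B ∪ W' \ W)
  have h2 := card_filter_mem_le_of_injective A (fun q : X × V × V × V => q.1)
    (fun q => q.2) (fun _ _ h => h)
  have hc : Fintype.card (V × V × V) = Fintype.card V ^ 3 := by
    simp only [Fintype.card_prod]; ring
  rw [hc] at h2
  have h3 := card_union_le B (W' \ W)
  have h4 := card_union_le (univ.filter fun q : X × V × V × V =>
    ¬ (q.2.1 ∉ B ∪ W' \ W ∧ q.2.2.1 ∉ B ∪ W' \ W ∧ q.2.2.2 ∉ B ∪ W' \ W))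
    (univ.filter fun q : X × V × V × V => q.1 ∈ A)
  have h5 : #((univ.filter fun q : X × V × V × V =>
    ¬ (q.2.1 ∉ B ∪ W' \ W ∧ q.2.2.1 ∉ B ∪ W' \ W ∧ q.2.2.2 ∉ B ∪ W' \ W)) ∪
    (univ.filter fun q : X × V × V × V => q.1 ∈ A)) <
      innerDeg (fun x a b c d => R x ![a, b, c, d]) W v := by
    rw [← Nat.cast_lt (α := ℝ)]
    refine lt_of_le_of_lt ?_ hv
    have h6 := (Nat.cast_le (α := ℝ)).2 (h4.trans (Nat.add_le_add h1 h2))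
    have h7 := (Nat.cast_le (α := ℝ)).2 h3
    push_cast at h6 h7
    have hXR : (Fintype.card X : ℝ) = 1 / 4 * Fintype.card V := by
      have : 4 * (Fintype.card X : ℝ) = Fintype.card V := by exact_mod_cast hX
      linarith
    rw [hXR] at h6
    refine h6.trans ?_
    generalize (#(B ∪ W' \ W) : ℝ) = p at *
    have h8 : (0 : ℝ) ≤ (Fintype.card V : ℝ) := by positivity
    generalize (Fintype.card V : ℝ) = n at *
    have h9 : p * (1 / 4 * n * n ^ 2) ≤ 21 / 10 ^ 9 * n * (1 / 4 * n * n ^ 2) :=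
      mul_le_mul_of_nonneg_right (by linarith) (by positivity)
    have h10 := mul_le_mul_of_nonneg_right hA (by positivity : 0 ≤ n ^ 3)
    have h11 : 0 ≤ n ^ 4 := by positivity
    have h12 : 21 / 10 ^ 9 * n * (1 / 4 * n * n ^ 2) = 21 / 4 / 10 ^ 9 * n ^ 4 := by ring
    have h13 : 5 / 10 ^ 9 * n * n ^ 3 = 5 / 10 ^ 9 * n ^ 4 := by ring
    linarith
  unfold innerDeg at h5
  obtain ⟨⟨x, b, c, d⟩, h6, h7⟩ := exists_mem_notMem_of_card_lt_card h5
  obtain ⟨h8, h9⟩ : (b ∉ W ∧ c ∉ W ∧ d ∉ W) ∧ R x ![v, b, c, d] := (mem_filter.1 h6).2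
  have h10 : ¬ (¬ (b ∉ B ∪ W' \ W ∧ c ∉ B ∪ W' \ W ∧ d ∉ B ∪ W' \ W) ∨ x ∈ A) := by
    intro h
    refine h7 (mem_union.2 ?_)
    rcases h with h | h
    · exact Or.inl (mem_filter.2 ⟨mem_univ _, h⟩)
    · exact Or.inr (mem_filter.2 ⟨mem_univ _, h⟩)
  rw [not_or, not_not] at h10
  obtain ⟨⟨hb, hc, hd⟩, hxA⟩ := h10
  simp only [mem_union, mem_sdiff] at hb hc hd
  refine ⟨x, hxA, ![v, b, c, d], h9, rfl, ?_, ?_⟩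
  · intro i
    fin_cases i
    exacts [hvB, fun h => hb (Or.inl h), fun h => hc (Or.inl h), fun h => hd (Or.inl h)]
  · intro i hi
    fin_cases i
    exacts [absurd rfl hi, fun h => hb (Or.inr ⟨h, h8.1⟩), fun h => hc (Or.inr ⟨h, h8.2.1⟩),
      fun h => hd (Or.inr ⟨h, h8.2.2⟩)]

open Classical in
/-- All exceptional vertices can be covered by a small frugal matching. -/
lemma exists_cover_exceptional {W W' U : Finset V} {Y : Finset X}
    (hX : 4 * Fintype.card X = Fintype.card V) (hlarge : 10 ^ 17 ≤ Fintype.card V)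
    (hW : 4 * #W = Fintype.card V)
    (hinj : ∀ x w, R x w → Function.Injective w)
    (hdeg : ∀ x v, 37 / 64 * (Fintype.card V : ℝ) ^ 3 - 6 * (Fintype.card V : ℝ) ^ 2 ≤
      #{q : V × V × V | R x ![v, q.1, q.2.1, q.2.2]})
    (hY : (#Yᶜ : ℝ) ≤ 2 / 10 ^ 9 * Fintype.card V)
    (hWU : (#(W \ U) : ℝ) ≤ 1 / 10 ^ 9 * Fintype.card V)
    (hW'W : (#(W' \ W) : ℝ) ≤ 1 / 10 ^ 9 * Fintype.card V)
    (hin : ∀ v ∈ W', 1 / 10 ^ 6 * (Fintype.card V : ℝ) ^ 4 <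
      innerDeg (fun x a b c d => R x ![a, b, c, d]) W v)
    {k : ℕ} {s₀ : Finset X × Finset V} (h₀ : IsFrugal R W' k s₀)
    (hs₀ : (#s₀.1 : ℝ) ≤ 1 / 10 ^ 9 * Fintype.card V) :
    ∃ s, IsFrugal R W' k s ∧ (#s.1 : ℝ) ≤ 5 / 10 ^ 9 * Fintype.card V ∧ Yᶜ ⊆ s.1 ∧
      W' \ U ⊆ s.2 := by
  have : Nonempty V := Fintype.card_pos_iff.1 (by omega)
  have hW'U : (#(W' \ U) : ℝ) ≤ 2 / 10 ^ 9 * Fintype.card V := by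
    have h1 : W' \ U ⊆ (W' \ W) ∪ (W \ U) := by
      intro v hv
      simp only [mem_union, mem_sdiff] at hv ⊢
      tauto
    have h2 := (Nat.cast_le (α := ℝ)).2 ((card_le_card h1).trans (card_union_le _ _))
    push_cast at h2
    linarith
  have hcW' : (#W' : ℝ) ≤ 13 / 50 * Fintype.card V := by
    have h1 : W' ⊆ (W' \ W) ∪ W := by
      intro v hv
      simp only [mem_union, mem_sdiff] at hv ⊢
      tauto
    have h2 := (Nat.cast_le (α := ℝ)).2 ((card_le_card h1).trans (card_union_le _ _))
    push_cast at h2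
    have h3 : 4 * (#W : ℝ) = Fintype.card V := by exact_mod_cast hW
    linarith
  set I : Finset (X ⊕ V) := Yᶜ.disjSum (W' \ U) with hI
  have hIc : (#I : ℝ) ≤ 4 / 10 ^ 9 * Fintype.card V := by
    rw [hI, card_disjSum]
    push_cast
    linarith
  have hK : ((#s₀.1 + #I : ℕ) : ℝ) ≤ 5 / 10 ^ 9 * Fintype.card V := by
    push_cast
    linarith
  obtain ⟨s, hs1, hs2, hs3, -⟩ := exists_state_all_done (T := X ⊕ V) (IsFrugal R W' k)
    (fun s => #s.1) (fun s t => t ∈ I → Sum.elim (· ∈ s.1) (· ∈ s.2) t) (#s₀.1 + #I) (by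
      intro s t hs hsize
      have hA : (#s.1 : ℝ) ≤ 5 / 10 ^ 9 * Fintype.card V := le_trans (by exact_mod_cast hsize) hK
      have hB : (#s.2 : ℝ) ≤ 20 / 10 ^ 9 * Fintype.card V := by
        rw [hs.2.1]; push_cast; linarith
      by_cases hdone : t ∈ I → Sum.elim (· ∈ s.1) (· ∈ s.2) t
      · exact ⟨s, hs, by omega, hdone, fun _ h => h⟩
      have key : ∀ (x : X) (w : Fin 4 → V) (j : Fin 4), x ∉ s.1 → R x w → (∀ i, w i ∉ s.2) →
          (∀ i, i ≠ j → w i ∉ W') → Sum.elim (· = x) (· ∈ univ.image w) t →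
          ∃ s' : Finset X × Finset V, IsFrugal R W' k s' ∧ #s'.1 ≤ #s.1 + 1 ∧
            (t ∈ I → Sum.elim (· ∈ s'.1) (· ∈ s'.2) t) ∧
            ∀ t', (t' ∈ I → Sum.elim (· ∈ s.1) (· ∈ s.2) t') →
              (t' ∈ I → Sum.elim (· ∈ s'.1) (· ∈ s'.2) t') := by
        intro x w j hx hR hw hj ht
        refine ⟨(insert x s.1, s.2 ∪ univ.image w), hs.add_edge hx hR (hinj x w hR) hw hj,
          card_insert_le _ _, fun _ => ?_, fun t' h h' => ?_⟩
        · rcases t with t | t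
          · exact mem_insert.2 (Or.inl ht)
          · exact mem_union_right _ ht
        · rcases t' with t' | t'
          · exact mem_insert_of_mem (h h')
          · exact mem_union_left _ (h h')
      have hdone' := Classical.not_imp.1 hdone
      rcases t with x | v
      · obtain ⟨w, hw, hw', j, hj⟩ := exists_edge_at_left hlarge hdeg hcW'
          (B := s.2) (by linarith) x
        exact key x w j hdone'.2 hw hw' hj rfl
      · have hv : v ∈ W' \ U := by simpa [hI] using hdone'.1
        obtain ⟨x, hx, w, hw, hwv, hwB, hj⟩ := exists_edge_at_right hX (by omega) hW'W hA hB
          hdone'.2 (hin v (mem_sdiff.1 hv).1)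
        exact key x w 0 hx hw hwB hj (mem_image.2 ⟨0, mem_univ _, hwv⟩)) s₀ h₀ I le_rfl
  refine ⟨s, hs1, le_trans (by exact_mod_cast hs2) hK, ?_, ?_⟩
  · intro x hx
    have h : (Sum.inl x : X ⊕ V) ∈ I := by rw [hI, inl_mem_disjSum]; exact hx
    exact hs3 _ h h
  · intro v hv
    have h : (Sum.inr v : X ⊕ V) ∈ I := by rw [hI, inr_mem_disjSum]; exact hv
    exact hs3 _ h h

end Extremal

section Extremal

variable {X V : Type} [Fintype X] [Fintype V] (r : X → V → V → V → V → Prop) (W : Finset V)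

open Classical in
lemma card_le_missIn {A : Type*} {S : Finset A} (g : A → X × V × V × V) (hg : Set.InjOn g S) {v : V}
    (h : ∀ y ∈ S, (g y).2.1 ∈ W ∧ ¬ r (g y).1 v (g y).2.1 (g y).2.2.1 (g y).2.2.2) :
    #S ≤ missIn r W v := by
  unfold missIn
  exact card_le_card_of_injOn g (fun y hy => mem_coe.2 (mem_filter.2 ⟨mem_univ _, h y hy⟩)) hg

open Classical in
lemma card_le_missOut_add {A : Type*} {S : Finset A} (g : A → X × V × V × V) (hg : Set.InjOn g S)
    {v : V} {C : Finset V}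
    (h : ∀ y ∈ S, (g y).2.1 ∈ C ∧ ¬ r (g y).1 v (g y).2.1 (g y).2.2.1 (g y).2.2.2) :
    #S ≤ missOut r W v + #(C ∩ W) * (Fintype.card X * Fintype.card V ^ 2) := by
  have hc : Fintype.card (X × V × V) = Fintype.card X * Fintype.card V ^ 2 := by
    simp only [Fintype.card_prod]; ring
  have h1 := card_filter_mem_le_of_injective (C ∩ W) (fun q : X × V × V × V => q.2.1)
    (fun q => (q.1, q.2.2)) (by rintro ⟨a, b, c, d⟩ ⟨a', b', c', d'⟩ h; simp_all)
  rw [hc] at h1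
  refine le_trans ?_ (Nat.add_le_add_left h1 _)
  unfold missOut
  refine le_trans ?_ (card_union_le _ _)
  refine card_le_card_of_injOn g (fun y hy => mem_coe.2 ?_) hg
  have h2 := h y hy
  by_cases h3 : (g y).2.1 ∈ W
  · exact mem_union_right _ (mem_filter.2 ⟨mem_univ _, mem_inter.2 ⟨h2.1, h3⟩⟩)
  · exact mem_union_left _ (mem_filter.2 ⟨mem_univ _, h3, h2.2⟩)

open Classical in
lemma card_le_missLink_add {A : Type*} {S : Finset A} (g : A → V × V × V × V) (hg : Set.InjOn g S)
    {x : X} {C : Finset V}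
    (h : ∀ y ∈ S, (g y).1 ∈ C ∧ (g y).2.1 ∈ W ∧
      ¬ r x (g y).1 (g y).2.1 (g y).2.2.1 (g y).2.2.2) :
    #S ≤ missLink r W x + #(C ∩ W) * Fintype.card V ^ 3 := by
  have hc : Fintype.card (V × V × V) = Fintype.card V ^ 3 := by
    simp only [Fintype.card_prod]; ring
  have h1 := card_filter_mem_le_of_injective (C ∩ W) (fun q : V × V × V × V => q.1)
    (fun q => q.2) (fun _ _ h => h)
  rw [hc] at h1
  refine le_trans ?_ (Nat.add_le_add_left h1 _)
  unfold missLink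
  refine le_trans ?_ (card_union_le _ _)
  refine card_le_card_of_injOn g (fun y hy => mem_coe.2 ?_) hg
  have h2 := h y hy
  by_cases h3 : (g y).1 ∈ W
  · exact mem_union_right _ (mem_filter.2 ⟨mem_univ _, mem_inter.2 ⟨h2.1, h3⟩⟩)
  · exact mem_union_left _ (mem_filter.2 ⟨mem_univ _, h3, h2.2⟩)

variable {r W}

open Classical in
lemma card_nonedges_le {M : ℕ} {U W' C : Finset V} {Y : Finset X}
    (hX : 4 * Fintype.card X = Fintype.card V)
    (h12 : ∀ x a b c d, r x a b c d → r x b a c d)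
    (h23 : ∀ x a b c d, r x a b c d → r x a c b d) (h34 : ∀ x a b c d, r x a b c d → r x a b d c)
    (hUW : U ⊆ W)
    (hlink : ∀ x ∈ Y, (missLink r W x : ℝ) ≤ 1 / 10 ^ 6 * (Fintype.card V : ℝ) ^ 4)
    (hout : ∀ u ∈ U, (missOut r W u : ℝ) ≤ 1 / 10 ^ 6 * (Fintype.card V : ℝ) ^ 4)
    (hin : ∀ v, v ∉ W' → (missIn r W v : ℝ) ≤ 2 / 10 ^ 6 * (Fintype.card V : ℝ) ^ 4)
    (hC : ∀ v ∈ C, v ∉ W' ∨ v ∈ U) (hCW : (#(C ∩ W) : ℝ) ≤ 5 / 10 ^ 9 * Fintype.card V)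
    {f : Fin M → X} (hf : Function.Injective f) (hfY : ∀ z, f z ∈ Y)
    {F₀ F₁ F₂ F₃ : Fin M → V} (hF₀ : Function.Injective F₀) (hF₁ : Function.Injective F₁)
    (hF₂ : Function.Injective F₂) (hF₃ : Function.Injective F₃) (hF₀U : ∀ z, F₀ z ∈ U)
    (hF₁C : ∀ z, F₁ z ∈ C) (hF₂C : ∀ z, F₂ z ∈ C) (hF₃C : ∀ z, F₃ z ∈ C) (i : Fin 5) (z : Fin M) :
    (#{y : Fin 5 → Fin M | y i = z ∧
      ¬ r (f (y 0)) (F₀ (y 1)) (F₁ (y 2)) (F₂ (y 3)) (F₃ (y 4))} : ℝ) ≤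
      1 / 10 ^ 5 * (Fintype.card V : ℝ) ^ 4 := by
  have hn4 : (0 : ℝ) ≤ (Fintype.card V : ℝ) ^ 4 := by positivity
  have boundOut : ∀ {S : Finset (Fin 5 → Fin M)} {u : V}, u ∈ U →
      #S ≤ missOut r W u + #(C ∩ W) * (Fintype.card X * Fintype.card V ^ 2) →
      (#S : ℝ) ≤ 1 / 10 ^ 5 * (Fintype.card V : ℝ) ^ 4 := by
    intro S u hu h
    have h1 := (Nat.cast_le (α := ℝ)).2 h
    push_cast at h1
    have h2 : (Fintype.card X : ℝ) * (Fintype.card V : ℝ) ^ 2 =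
        1 / 4 * (Fintype.card V : ℝ) ^ 3 := by
      have hXR : 4 * (Fintype.card X : ℝ) = Fintype.card V := by exact_mod_cast hX
      rw [← hXR]; ring
    rw [h2] at h1
    have h3 := mul_le_mul_of_nonneg_right hCW
      (by positivity : (0 : ℝ) ≤ 1 / 4 * (Fintype.card V : ℝ) ^ 3)
    have h4 : 5 / 10 ^ 9 * (Fintype.card V : ℝ) * (1 / 4 * (Fintype.card V : ℝ) ^ 3) =
      5 / 4 / 10 ^ 9 * (Fintype.card V : ℝ) ^ 4 := by ring
    rw [h4] at h3
    refine h1.trans ((add_le_add (hout u hu) h3).trans ?_)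
    linarith
  have boundIn : ∀ {S : Finset (Fin 5 → Fin M)} {v : V}, v ∉ W' → #S ≤ missIn r W v →
      (#S : ℝ) ≤ 1 / 10 ^ 5 * (Fintype.card V : ℝ) ^ 4 := by
    intro S v hv h
    refine ((Nat.cast_le (α := ℝ)).2 h).trans ((hin v hv).trans ?_)
    linarith
  have hinj : ∀ {y y' : Fin 5 → Fin M}, y 0 = y' 0 → y 1 = y' 1 → y 2 = y' 2 → y 3 = y' 3 →
      y 4 = y' 4 → y = y' := by
    intro y y' h0 h1 h2 h3 h4
    funext j
    fin_cases j <;> assumption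
  have hmem : ∀ {j : Fin 5} {y : Fin 5 → Fin M}, y ∈ (univ.filter fun y : Fin 5 → Fin M => y j = z ∧
      ¬ r (f (y 0)) (F₀ (y 1)) (F₁ (y 2)) (F₂ (y 3)) (F₃ (y 4))) → y j = z ∧
      ¬ r (f (y 0)) (F₀ (y 1)) (F₁ (y 2)) (F₂ (y 3)) (F₃ (y 4)) := fun h => (mem_filter.1 h).2
  have hF₀W : ∀ z, F₀ z ∈ W := fun z => hUW (hF₀U z)
  fin_cases i
  · have h1 := card_le_missLink_add r W (x := f z) (C := C)
      (S := univ.filter fun y : Fin 5 → Fin M => y 0 = z ∧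
        ¬ r (f (y 0)) (F₀ (y 1)) (F₁ (y 2)) (F₂ (y 3)) (F₃ (y 4)))
      (fun y => (F₁ (y 2), F₀ (y 1), F₂ (y 3), F₃ (y 4)))
      (by
        intro y hy y' hy' h
        simp only [Prod.mk.injEq, hF₀.eq_iff, hF₁.eq_iff, hF₂.eq_iff, hF₃.eq_iff] at h
        exact hinj ((hmem hy).1.trans (hmem hy').1.symm) h.2.1 h.1 h.2.2.1 h.2.2.2)
      (by
        intro y hy
        obtain ⟨h2, h3⟩ := hmem hy
        rw [h2] at h3
        exact ⟨hF₁C _, hF₀W _, fun h => h3 (h12 _ _ _ _ _ h)⟩)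
    have h2 := (Nat.cast_le (α := ℝ)).2 h1
    push_cast at h2
    have h3 := mul_le_mul_of_nonneg_right hCW
      (by positivity : (0 : ℝ) ≤ (Fintype.card V : ℝ) ^ 3)
    have h4 : 5 / 10 ^ 9 * (Fintype.card V : ℝ) * (Fintype.card V : ℝ) ^ 3 =
      5 / 10 ^ 9 * (Fintype.card V : ℝ) ^ 4 := by ring
    rw [h4] at h3
    refine h2.trans ((add_le_add (hlink _ (hfY z)) h3).trans ?_)
    linarith
  · refine boundOut (hF₀U z) (card_le_missOut_add r W
      (S := univ.filter fun y : Fin 5 → Fin M => y 1 = z ∧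
        ¬ r (f (y 0)) (F₀ (y 1)) (F₁ (y 2)) (F₂ (y 3)) (F₃ (y 4)))
      (fun y => (f (y 0), F₁ (y 2), F₂ (y 3), F₃ (y 4))) ?_ ?_)
    · intro y hy y' hy' h
      simp only [Prod.mk.injEq, hf.eq_iff, hF₁.eq_iff, hF₂.eq_iff, hF₃.eq_iff] at h
      exact hinj h.1 ((hmem hy).1.trans (hmem hy').1.symm) h.2.1 h.2.2.1 h.2.2.2
    · intro y hy
      obtain ⟨h2, h3⟩ := hmem hy
      rw [h2] at h3
      exact ⟨hF₁C _, h3⟩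
  · rcases hC _ (hF₁C z) with hv | hv
    · refine boundIn hv (card_le_missIn r W
        (S := univ.filter fun y : Fin 5 → Fin M => y 2 = z ∧
          ¬ r (f (y 0)) (F₀ (y 1)) (F₁ (y 2)) (F₂ (y 3)) (F₃ (y 4)))
        (fun y => (f (y 0), F₀ (y 1), F₂ (y 3), F₃ (y 4))) ?_ ?_)
      · intro y hy y' hy' h
        simp only [Prod.mk.injEq, hf.eq_iff, hF₀.eq_iff, hF₂.eq_iff, hF₃.eq_iff] at h
        exact hinj h.1 h.2.1 ((hmem hy).1.trans (hmem hy').1.symm) h.2.2.1 h.2.2.2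
      · intro y hy
        obtain ⟨h2, h3⟩ := hmem hy
        rw [h2] at h3
        exact ⟨hF₀W _, fun h => h3 (h12 _ _ _ _ _ h)⟩
    · refine boundOut hv (card_le_missOut_add r W
        (S := univ.filter fun y : Fin 5 → Fin M => y 2 = z ∧
          ¬ r (f (y 0)) (F₀ (y 1)) (F₁ (y 2)) (F₂ (y 3)) (F₃ (y 4)))
        (fun y => (f (y 0), F₂ (y 3), F₀ (y 1), F₃ (y 4))) ?_ ?_)
      · intro y hy y' hy' h
        simp only [Prod.mk.injEq, hf.eq_iff, hF₀.eq_iff, hF₂.eq_iff, hF₃.eq_iff] at h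
        exact hinj h.1 h.2.2.1 ((hmem hy).1.trans (hmem hy').1.symm) h.2.1 h.2.2.2
      · intro y hy
        obtain ⟨h2, h3⟩ := hmem hy
        rw [h2] at h3
        exact ⟨hF₂C _, fun h => h3 (h12 _ _ _ _ _ (h23 _ _ _ _ _ h))⟩
  · rcases hC _ (hF₂C z) with hv | hv
    · refine boundIn hv (card_le_missIn r W
        (S := univ.filter fun y : Fin 5 → Fin M => y 3 = z ∧
          ¬ r (f (y 0)) (F₀ (y 1)) (F₁ (y 2)) (F₂ (y 3)) (F₃ (y 4)))
        (fun y => (f (y 0), F₀ (y 1), F₁ (y 2), F₃ (y 4))) ?_ ?_)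
      · intro y hy y' hy' h
        simp only [Prod.mk.injEq, hf.eq_iff, hF₀.eq_iff, hF₁.eq_iff, hF₃.eq_iff] at h
        exact hinj h.1 h.2.1 h.2.2.1 ((hmem hy).1.trans (hmem hy').1.symm) h.2.2.2
      · intro y hy
        obtain ⟨h2, h3⟩ := hmem hy
        rw [h2] at h3
        exact ⟨hF₀W _, fun h => h3 (h23 _ _ _ _ _ (h12 _ _ _ _ _ h))⟩
    · refine boundOut hv (card_le_missOut_add r W
        (S := univ.filter fun y : Fin 5 → Fin M => y 3 = z ∧
          ¬ r (f (y 0)) (F₀ (y 1)) (F₁ (y 2)) (F₂ (y 3)) (F₃ (y 4)))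
        (fun y => (f (y 0), F₁ (y 2), F₀ (y 1), F₃ (y 4))) ?_ ?_)
      · intro y hy y' hy' h
        simp only [Prod.mk.injEq, hf.eq_iff, hF₀.eq_iff, hF₁.eq_iff, hF₃.eq_iff] at h
        exact hinj h.1 h.2.2.1 h.2.1 ((hmem hy).1.trans (hmem hy').1.symm) h.2.2.2
      · intro y hy
        obtain ⟨h2, h3⟩ := hmem hy
        rw [h2] at h3
        exact ⟨hF₁C _, fun h => h3 (h12 _ _ _ _ _ (h23 _ _ _ _ _ (h12 _ _ _ _ _ h)))⟩
  · rcases hC _ (hF₃C z) with hv | hv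
    · refine boundIn hv (card_le_missIn r W
        (S := univ.filter fun y : Fin 5 → Fin M => y 4 = z ∧
          ¬ r (f (y 0)) (F₀ (y 1)) (F₁ (y 2)) (F₂ (y 3)) (F₃ (y 4)))
        (fun y => (f (y 0), F₀ (y 1), F₁ (y 2), F₂ (y 3))) ?_ ?_)
      · intro y hy y' hy' h
        simp only [Prod.mk.injEq, hf.eq_iff, hF₀.eq_iff, hF₁.eq_iff, hF₂.eq_iff] at h
        exact hinj h.1 h.2.1 h.2.2.1 h.2.2.2 ((hmem hy).1.trans (hmem hy').1.symm)
      · intro y hy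
        obtain ⟨h2, h3⟩ := hmem hy
        rw [h2] at h3
        exact ⟨hF₀W _, fun h => h3 (h34 _ _ _ _ _ (h23 _ _ _ _ _ (h12 _ _ _ _ _ h)))⟩
    · refine boundOut hv (card_le_missOut_add r W
        (S := univ.filter fun y : Fin 5 → Fin M => y 4 = z ∧
          ¬ r (f (y 0)) (F₀ (y 1)) (F₁ (y 2)) (F₂ (y 3)) (F₃ (y 4)))
        (fun y => (f (y 0), F₁ (y 2), F₀ (y 1), F₂ (y 3))) ?_ ?_)
      · intro y hy y' hy' h
        simp only [Prod.mk.injEq, hf.eq_iff, hF₀.eq_iff, hF₁.eq_iff, hF₂.eq_iff] at h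
        exact hinj h.1 h.2.2.1 h.2.1 h.2.2.2 ((hmem hy).1.trans (hmem hy').1.symm)
      · intro y hy
        obtain ⟨h2, h3⟩ := hmem hy
        rw [h2] at h3
        exact ⟨hF₁C _, fun h => h3
          (h34 _ _ _ _ _ (h12 _ _ _ _ _ (h23 _ _ _ _ _ (h12 _ _ _ _ _ h))))⟩

end Extremal

section Extremal

variable {X V : Type} [Fintype X] [Fintype V] {R : X → (Fin 4 → V) → Prop}

open Classical in
/-- The vertices left over by a frugal matching covering all exceptional vertices can be matched. -/
lemma matchIn_univ_of_isFrugal {W W' U : Finset V} {Y : Finset X}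
    (hX : 4 * Fintype.card X = Fintype.card V) (hlarge : 10 ^ 17 ≤ Fintype.card V)
    (hW : 4 * #W = Fintype.card V)
    (hperm : ∀ x w (σ : Equiv.Perm (Fin 4)), R x w → R x (w ∘ σ))
    (hUW : U ⊆ W)
    (hlink : ∀ x ∈ Y, (missLink (fun x a b c d => R x ![a, b, c, d]) W x : ℝ) ≤
      1 / 10 ^ 6 * (Fintype.card V : ℝ) ^ 4)
    (hout : ∀ u ∈ U, (missOut (fun x a b c d => R x ![a, b, c, d]) W u : ℝ) ≤
      1 / 10 ^ 6 * (Fintype.card V : ℝ) ^ 4)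
    (hin : ∀ v, v ∉ W' → (missIn (fun x a b c d => R x ![a, b, c, d]) W v : ℝ) ≤
      2 / 10 ^ 6 * (Fintype.card V : ℝ) ^ 4)
    {s : Finset X × Finset V} (hs : IsFrugal R W' (#W - #W') s)
    (hA : (#s.1 : ℝ) ≤ 5 / 10 ^ 9 * Fintype.card V) (hYs : Yᶜ ⊆ s.1) (hUs : W' \ U ⊆ s.2) :
    MatchIn R univ univ := by
  have : Nonempty V := Fintype.card_pos_iff.1 (by omega)
  obtain ⟨A, B⟩ := s
  obtain ⟨hm, hB, hk⟩ := hs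
  dsimp only at hm hB hk hA hYs hUs
  have hcA := card_add_card_compl A
  have hcB := card_add_card_compl B
  have hcW' : #(W' \ B) + #(B ∩ W') = #W' := by
    rw [inter_comm]; exact card_sdiff_add_card_inter W' B
  obtain ⟨Z, hZW', hZ⟩ : ∃ Z ⊆ W' \ B, #Z = #Aᶜ := exists_subset_card_eq (by omega)
  have hZU : Z ⊆ U := by
    intro v hv
    by_contra h
    obtain ⟨h1, h2⟩ := mem_sdiff.1 (hZW' hv)
    exact h2 (hUs (mem_sdiff.2 ⟨h1, h⟩))
  have hZB : Z ⊆ Bᶜ := fun v hv => mem_compl.2 (mem_sdiff.1 (hZW' hv)).2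
  set C := Bᶜ \ Z with hCdef
  have hCc : #C = 3 * #Aᶜ := by
    rw [hCdef, card_sdiff_of_subset hZB]; omega
  have hC : ∀ v ∈ C, v ∉ W' ∨ v ∈ U := by
    intro v hv
    by_contra! h
    exact (mem_compl.1 (mem_sdiff.1 hv).1) (hUs (mem_sdiff.2 h))
  have hCW : (#(C ∩ W) : ℝ) ≤ 5 / 10 ^ 9 * Fintype.card V := by
    have h1 : C ∩ W ⊆ W \ Z := by
      intro v hv
      simp only [hCdef, mem_inter, mem_sdiff] at hv ⊢
      tauto
    have h2 := card_le_card h1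
    rw [card_sdiff_of_subset (hZU.trans hUW)] at h2
    exact le_trans (by exact_mod_cast (by omega : #(C ∩ W) ≤ #A)) hA
  set M := #Aᶜ with hM
  set f : Fin M ≃ (Aᶜ : Finset X) := Fintype.equivOfCardEq (by rw [Fintype.card_fin, Fintype.card_coe]) with hf
  set g : Fin M ≃ Z := Fintype.equivOfCardEq (by rw [Fintype.card_fin, Fintype.card_coe, hZ]) with hg
  set h : Fin 3 × Fin M ≃ C := Fintype.equivOfCardEq (by simp [hCc]) with hh
  have hfi : Function.Injective fun z => (f z : X) := Subtype.val_injective.comp f.injective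
  have hgi : Function.Injective fun z => (g z : V) := Subtype.val_injective.comp g.injective
  have hhi : ∀ j, Function.Injective fun z => (h (j, z) : V) := by
    intro j z z' hz
    have := h.injective (Subtype.ext hz)
    simpa using this
  have h12 : ∀ x a b c d, R x ![a, b, c, d] → R x ![b, a, c, d] := by
    intro x a b c d h
    have := hperm x _ (Equiv.swap 0 1) h
    convert this using 1
    funext i; fin_cases i <;> rfl
  have h23 : ∀ x a b c d, R x ![a, b, c, d] → R x ![a, c, b, d] := by
    intro x a b c d h
    have := hperm x _ (Equiv.swap 1 2) h
    convert this using 1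
    funext i; fin_cases i <;> rfl
  have h34 : ∀ x a b c d, R x ![a, b, c, d] → R x ![a, b, d, c] := by
    intro x a b c d h
    have := hperm x _ (Equiv.swap 2 3) h
    convert this using 1
    funext i; fin_cases i <;> rfl
  obtain ⟨π, hπ⟩ := exists_perm_of_dense (ι := Fin M)
    (fun y => R (f (y 0)) ![(g (y 1) : V), h (0, y 2), h (1, y 3), h (2, y 4)])
    (d := 1 / 10 ^ 5 * (Fintype.card V : ℝ) ^ 4)
    (fun i z => (card_nonedges_le (r := fun x a b c d => R x ![a, b, c, d]) hX h12 h23 h34 hUW hlink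
      hout hin hC hCW hfi (fun z => by
        have := mem_compl.1 (f z).2
        by_contra hne
        exact this (hYs (mem_compl.2 hne)))
      hgi (hhi 0) (hhi 1) (hhi 2) (fun z => hZU (g z).2) (fun z => (h (0, z)).2)
      (fun z => (h (1, z)).2) (fun z => (h (2, z)).2) i z).trans' (le_of_eq (by congr!)))
    (by
      rw [Fintype.card_fin]
      have h1 : 6 / 25 * (Fintype.card V : ℝ) ≤ M := by
        have h2 : (#A : ℝ) + M = Fintype.card X := by exact_mod_cast hcA
        have h3 : 4 * (Fintype.card X : ℝ) = Fintype.card V := by exact_mod_cast hX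
        linarith
      have hlargeR : (10 : ℝ) ^ 17 ≤ Fintype.card V := by exact_mod_cast hlarge
      generalize (M : ℝ) = m at *
      generalize (Fintype.card V : ℝ) = n at *
      have hn : 0 < n := lt_of_lt_of_le (by positivity) hlargeR
      have h2 : (6 / 25 * n) ^ 4 ≤ m ^ 4 := pow_le_pow_left₀ (by positivity) h1 4
      have h3 : 0 ≤ m ^ 3 * (m / 2 - 20) := mul_nonneg (pow_nonneg (by linarith) 3) (by linarith)
      have h4 : m ^ 3 * (m / 2 - 20) = m ^ 4 / 2 - 20 * m ^ 3 := by ring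
      have h5 : (6 / 25 * n) ^ 4 = 1296 / 390625 * n ^ 4 := by ring
      have h6 : 0 < n ^ 4 := by positivity
      linarith)
  have hvals : ∀ z : Fin M, ∀ k : Fin 4,
      (![(g (π 1 z) : V), h (0, π 2 z), h (1, π 3 z), h (2, π 4 z)] k) ∈ Bᶜ := by
    intro z k
    fin_cases k
    exacts [hZB (g _).2, (mem_sdiff.1 (h _).2).1, (mem_sdiff.1 (h _).2).1, (mem_sdiff.1 (h _).2).1]
  have hne : ∀ z p, (g z : V) ≠ h p := fun z p he => (mem_sdiff.1 (h p).2).2 (he ▸ (g z).2)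
  have hhe : ∀ p p', (h p : V) = h p' → p = p' := fun p p' he => h.injective (Subtype.ext he)
  have hmatch := matchIn_of_family (R := R) (fun z : Fin M => (f (π 0 z) : X))
    (fun z => ![(g (π 1 z) : V), h (0, π 2 z), h (1, π 3 z), h (2, π 4 z)]) hπ (by
      have h0 : ∀ i j, (g (π 1 i) : V) = g (π 1 j) → i = j := fun i j he =>
        (π 1).injective (hgi he)
      have h1 : ∀ (a b : Fin 3) (ρ : Equiv.Perm (Fin M)) i j, (h (a, ρ i) : V) = h (b, ρ j) →
          i = j := fun a b ρ i j he => ρ.injective (Prod.ext_iff.1 (hhe _ _ he)).2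
      have h2 : ∀ (a b : Fin 3), a ≠ b → ∀ y y', (h (a, y) : V) ≠ h (b, y') :=
        fun a b hab y y' he => hab (Prod.ext_iff.1 (hhe _ _ he)).1
      intro i j k l hkl
      fin_cases k <;> fin_cases l
      exacts [h0 _ _ hkl, absurd hkl (hne _ _), absurd hkl (hne _ _), absurd hkl (hne _ _),
        absurd hkl.symm (hne _ _), h1 _ _ _ _ _ hkl, absurd hkl (h2 _ _ (by decide) _ _),
        absurd hkl (h2 _ _ (by decide) _ _),
        absurd hkl.symm (hne _ _), absurd hkl (h2 _ _ (by decide) _ _), h1 _ _ _ _ _ hkl,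
        absurd hkl (h2 _ _ (by decide) _ _),
        absurd hkl.symm (hne _ _), absurd hkl (h2 _ _ (by decide) _ _),
        absurd hkl (h2 _ _ (by decide) _ _), h1 _ _ _ _ _ hkl])
  have hmatch' : MatchIn R Aᶜ Bᶜ := by
    refine hmatch.mono ?_ ?_
    · intro x hx
      refine mem_image.2 ⟨(π 0).symm (f.symm ⟨x, hx⟩), mem_univ _, ?_⟩
      simp
    · intro v hv
      obtain ⟨z, -, hz⟩ := mem_biUnion.1 hv
      obtain ⟨k, -, rfl⟩ := mem_image.1 hz
      exact hvals z k
  have := hm.union hmatch' disjoint_compl_right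
  rwa [union_compl, union_compl] at this

open Classical in
lemma card_filter_fin_three (P : (Fin 3 → V) → Prop) :
    #{z : Fin 3 → V | P z} = #{q : V × V × V | P ![q.1, q.2.1, q.2.2]} := by
  refine card_nbij' (fun z => (z 0, z 1, z 2)) (fun q => ![q.1, q.2.1, q.2.2]) ?_ ?_ ?_ ?_
  · intro z hz
    have h : P z := (mem_filter.1 (mem_coe.1 hz)).2
    have h2 : ![z 0, z 1, z 2] = z := by funext i; fin_cases i <;> rfl
    exact mem_coe.2 (mem_filter.2 ⟨mem_univ _, by simpa only [h2] using h⟩)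
  · intro q hq
    exact mem_coe.2 (mem_filter.2 ⟨mem_univ _, (mem_filter.1 (mem_coe.1 hq)).2⟩)
  · intro z _; funext i; fin_cases i <;> rfl
  · intro q _; rfl

open Classical in
lemma edgesAvoiding_eq (R : X → (Fin 4 → V) → Prop) (W : Finset V) :
    #{q : X × V × V × V × V | (q.2.1 ∉ W ∧ q.2.2.1 ∉ W ∧ q.2.2.2.1 ∉ W ∧
      q.2.2.2.2 ∉ W) ∧ R q.1 ![q.2.1, q.2.2.1, q.2.2.2.1, q.2.2.2.2]} ≤ edgesAvoiding R W := by
  unfold edgesAvoiding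
  refine card_le_card_of_injOn
    (fun q => (q.1, ![q.2.1, q.2.2.1, q.2.2.2.1, q.2.2.2.2])) ?_ ?_
  · intro q hq
    obtain ⟨h1, h2⟩ := (mem_filter.1 (mem_coe.1 hq)).2
    refine mem_coe.2 (mem_filter.2 ⟨mem_univ _, h2, fun i => ?_⟩)
    fin_cases i
    exacts [h1.1, h1.2.1, h1.2.2.1, h1.2.2.2]
  · rintro ⟨x, a, b, c, d⟩ _ ⟨x', a', b', c', d'⟩ _ he
    obtain ⟨h1, h2⟩ := Prod.mk.inj he
    have e0 : a = a' := congrFun h2 0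
    have e1 : b = b' := congrFun h2 1
    have e2 : c = c' := congrFun h2 2
    have e3 : d = d' := congrFun h2 3
    have e4 : x = x' := h1
    subst e0 e1 e2 e3 e4
    rfl

open Classical in
/-- A hypergraph close to the extremal one has a perfect matching. -/
theorem matchIn_univ_of_extremal (hX : Fintype.card V = 4 * Fintype.card X)
    (hlarge : 10 ^ 17 ≤ Fintype.card V)
    (hinj : ∀ x w, R x w → Function.Injective w)
    (hperm : ∀ x w (σ : Equiv.Perm (Fin 4)), R x w → R x (w ∘ σ))
    (hdeg : ∀ x v, ((Fintype.card V : ℝ) - 1) * (Fintype.card V - 2) * (Fintype.card V - 3) -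
      (3 / 4 * (Fintype.card V : ℝ) * (3 / 4 * Fintype.card V - 1) *
        (3 / 4 * Fintype.card V - 2) - 1) ≤
      #{z : Fin 3 → V | R x (Fin.cons v z)})
    {W : Finset V} (hW : #W = Fintype.card X)
    (hext : (edgesAvoiding R W : ℝ) ≤ 1 / 10 ^ 16 * (Fintype.card V : ℝ) ^ 5) :
    MatchIn R univ univ := by
  have hdeg' : ∀ x v, ((Fintype.card V : ℝ) - 1) * (Fintype.card V - 2) * (Fintype.card V - 3) -
      (3 / 4 * (Fintype.card V : ℝ) * (3 / 4 * Fintype.card V - 1) *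
        (3 / 4 * Fintype.card V - 2) - 1) ≤
      #{q : V × V × V | R x ![v, q.1, q.2.1, q.2.2]} := by
    intro x v
    refine (hdeg x v).trans_eq ?_
    rw [card_filter_fin_three]
    rfl
  have hlargeR : (10 : ℝ) ^ 17 ≤ Fintype.card V := by exact_mod_cast hlarge
  have hdeg'' : ∀ x v, 37 / 64 * (Fintype.card V : ℝ) ^ 3 - 6 * (Fintype.card V : ℝ) ^ 2 ≤
      #{q : V × V × V | R x ![v, q.1, q.2.1, q.2.2]} := by
    intro x v
    refine le_trans ?_ (hdeg' x v)
    generalize (Fintype.card V : ℝ) = n at *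
    have h1 : 0 ≤ n ^ 2 := by positivity
    ring_nf
    linarith
  have h12 : ∀ x a b c d, R x ![a, b, c, d] → R x ![b, a, c, d] := by
    intro x a b c d h
    have := hperm x _ (Equiv.swap 0 1) h
    convert this using 1
    funext i; fin_cases i <;> rfl
  obtain ⟨Y, U, W', hY, hYl, hUW, hUW', hWU, hU, hW'W, hW'in, hW'out⟩ :=
    exists_extremal_classification (fun x a b c d => R x ![a, b, c, d]) W (by omega) (by omega)
      hlarge h12 (fun x v => (hdeg'' x v).trans_eq (by congr!))
      (le_trans ((Nat.cast_le (α := ℝ)).2 (edgesAvoiding_eq R W)) hext)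
  have hWW' : (#(W \ W') : ℝ) ≤ 1 / 10 ^ 9 * Fintype.card V :=
    le_trans (by exact_mod_cast card_le_card (sdiff_subset_sdiff subset_rfl hUW')) hWU
  obtain ⟨A, B, hA, hB, hBW, hm⟩ := exists_inner_matching R W W' Y (by omega) (by omega) hlarge
    hinj hperm hdeg' hY (fun x hx => (hYl x hx).1) hWW' (fun v hv => (hW'out v hv).1)
  have hfrugal : IsFrugal R W' (#W - #W') (A, B) := by
    refine ⟨hm, hB, ?_⟩
    change #(B ∩ W') + (#W - #W') ≤ #A
    rw [disjoint_iff_inter_eq_empty.1 hBW, card_empty, hA, zero_add]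
  have hAs : (#A : ℝ) ≤ 1 / 10 ^ 9 * Fintype.card V := by
    refine le_trans ?_ hWW'
    rw [hA]
    exact_mod_cast le_card_sdiff W' W
  obtain ⟨s, hs, hsA, hsY, hsU⟩ := exists_cover_exceptional (R := R) (by omega) hlarge (by omega)
    hinj hdeg'' hY hWU hW'W hW'in hfrugal hAs
  exact matchIn_univ_of_isFrugal (by omega) hlarge (by omega) hperm hUW
    (fun x hx => (hYl x hx).2) hU (fun v hv => (hW'out v hv).2) hs hsA hsY hsU

end Extremal

section Restriction

variable {X V : Type} {R : X → (Fin 4 → V) → Prop}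

open Classical in
/-- A matching of `S` uses exactly `4 * #S` vertices. -/
lemma MatchIn.exists_card_eq {S : Finset X} {B : Finset V} (h : MatchIn R S B)
    (hinj : ∀ x w, R x w → Function.Injective w) : ∃ U ⊆ B, #U = 4 * #S ∧ MatchIn R S U := by
  obtain ⟨v, h1, h2, h3⟩ := h
  refine ⟨(S ×ˢ (univ : Finset (Fin 4))).image fun p => v p.1 p.2, ?_, ?_, v, h1, ?_, h3⟩
  · intro u hu
    obtain ⟨p, hp, rfl⟩ := mem_image.1 hu
    exact h2 _ (mem_product.1 hp).1 _
  · rw [card_image_of_injOn, card_product, card_univ, Fintype.card_fin, mul_comm]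
    rintro ⟨x, i⟩ hp ⟨y, j⟩ hq hpq
    have hx := (mem_product.1 hp).1
    have hxy : x = y := h3 x hx y (mem_product.1 hq).1 i j hpq
    subst hxy
    exact Prod.ext rfl (hinj _ _ (h1 x hx) hpq)
  · exact fun x hx i => mem_image.2 ⟨(x, i), mem_product.2 ⟨hx, mem_univ _⟩, rfl⟩

/-- The system induced by `R` outside `A` and `B`. -/
def restrictSystem (R : X → (Fin 4 → V) → Prop) (A : Finset X) (B : Finset V)
    (x : {x // x ∉ A}) (w : Fin 4 → {v // v ∉ B}) : Prop :=
  R x fun i => w i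

lemma MatchIn.of_restrictSystem [Nonempty V] {A : Finset X} {B : Finset V}
    {S : Finset {x // x ∉ A}} {C : Finset {v // v ∉ B}} (h : MatchIn (restrictSystem R A B) S C) :
    MatchIn R (S.map (Function.Embedding.subtype _)) (C.map (Function.Embedding.subtype _)) := by
  classical
  obtain ⟨v, h1, h2, h3⟩ := h
  obtain ⟨g, hg⟩ : ∃ g : X → Fin 4 → V, ∀ y : {x // x ∉ A}, g y = fun i => (v y i : V) :=
    ⟨fun x i => if h : x ∉ A then v ⟨x, h⟩ i else Classical.arbitrary V,
      fun y => funext fun i => dif_pos y.2⟩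
  refine ⟨g, ?_, ?_, ?_⟩
  · intro x hx
    obtain ⟨y, hy, rfl⟩ := mem_map.1 hx
    rw [Function.Embedding.subtype_apply, hg]
    exact h1 y hy
  · intro x hx i
    obtain ⟨y, hy, rfl⟩ := mem_map.1 hx
    rw [Function.Embedding.subtype_apply, hg]
    exact mem_map.2 ⟨_, h2 y hy i, rfl⟩
  · intro x hx x' hx' i j hv
    obtain ⟨y, hy, rfl⟩ := mem_map.1 hx
    obtain ⟨y', hy', rfl⟩ := mem_map.1 hx'
    rw [Function.Embedding.subtype_apply, Function.Embedding.subtype_apply, hg, hg] at hv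
    exact congrArg Subtype.val (h3 y hy y' hy' i j (Subtype.ext hv))

variable [Fintype V]

open Classical in
lemma card_link_le_restrictSystem (A : Finset X) (B : Finset V) (x : {x // x ∉ A})
    (v : {v // v ∉ B}) :
    #{z : Fin 3 → V | R x (Fin.cons (v : V) z)} ≤
      #{z : Fin 3 → {v // v ∉ B} | restrictSystem R A B x (Fin.cons v z)} +
        #{z : Fin 3 → V | ∃ i, z i ∈ B} := by
  rw [← card_image_of_injective (univ.filter fun z : Fin 3 → {v // v ∉ B} =>
    restrictSystem R A B x (Fin.cons v z)) (f := fun z i => (z i : V))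
    (fun z z' h => funext fun i => Subtype.ext (congrFun h i))]
  refine (card_le_card fun z hz => ?_).trans (card_union_le _ _)
  by_cases hB : ∃ i, z i ∈ B
  · exact mem_union_right _ (mem_filter.2 ⟨mem_univ _, hB⟩)
  · push Not at hB
    refine mem_union_left _ (mem_image.2 ⟨fun i => ⟨z i, hB i⟩,
      mem_filter.2 ⟨mem_univ _, ?_⟩, rfl⟩)
    have hz' := (mem_filter.1 hz).2
    unfold restrictSystem
    convert hz' using 1
    funext i
    refine Fin.cases ?_ (fun i => ?_) i <;> rfl

open Classical in
lemma edgesAvoiding_le_restrictSystem [Fintype X] (A : Finset X) (B : Finset V)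
    (W : Finset {v // v ∉ B}) {W' : Finset V}
    (hW : W.map (Function.Embedding.subtype _) ⊆ W') :
    edgesAvoiding R W' ≤ edgesAvoiding (restrictSystem R A B) W +
      #A * Fintype.card V ^ 4 + Fintype.card X * #{w : Fin 4 → V | ∃ i, w i ∈ B} := by
  have h1 : #A * Fintype.card V ^ 4 = #(A ×ˢ (univ : Finset (Fin 4 → V))) := by
    rw [card_product, card_univ, Fintype.card_fun, Fintype.card_fin]
  have h2 : Fintype.card X * #{w : Fin 4 → V | ∃ i, w i ∈ B} =
      #((univ : Finset X) ×ˢ (univ.filter fun w : Fin 4 → V => ∃ i, w i ∈ B)) := by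
    rw [card_product, card_univ]
  have h3 : edgesAvoiding (restrictSystem R A B) W =
      #((univ.filter fun t : {x // x ∉ A} × (Fin 4 → {v // v ∉ B}) =>
        restrictSystem R A B t.1 t.2 ∧ ∀ i, t.2 i ∉ W).image
          fun t => ((t.1 : X), fun i => (t.2 i : V))) := by
    rw [card_image_of_injective _ fun t t' h => by
      obtain ⟨h1, h2⟩ := Prod.ext_iff.1 h
      exact Prod.ext (Subtype.ext h1) (funext fun i => Subtype.ext (congrFun h2 i))]
    unfold edgesAvoiding
    congr!
  rw [h1, h2, h3]
  unfold edgesAvoiding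
  refine (card_le_card fun t ht => ?_).trans
    ((card_union_le _ _).trans (Nat.add_le_add_right (card_union_le _ _) _))
  obtain ⟨hR, hW'⟩ := (mem_filter.1 ht).2
  by_cases hB : ∃ i, t.2 i ∈ B
  · exact mem_union_right _ (mem_product.2 ⟨mem_univ _, mem_filter.2 ⟨mem_univ _, hB⟩⟩)
  by_cases hA : t.1 ∈ A
  · exact mem_union_left _ (mem_union_right _ (mem_product.2 ⟨hA, mem_univ _⟩))
  push Not at hB
  refine mem_union_left _ (mem_union_left _ (mem_image.2 ⟨(⟨t.1, hA⟩, fun i => ⟨t.2 i, hB i⟩),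
    mem_filter.2 ⟨mem_univ _, hR, fun i hi => hW' i (hW (mem_map.2 ⟨_, hi, rfl⟩))⟩, rfl⟩))

open Classical in
/-- An almost perfect matching outside an absorbing pair `(A, B)` extends to a perfect one. -/
lemma matchIn_univ_of_absorber [Fintype X] [Nonempty V] (hX : Fintype.card V = 4 * Fintype.card X)
    (hinj : ∀ x w, R x w → Function.Injective w) {A : Finset X} {B : Finset V} {α : ℝ}
    (hAB : #B = 4 * #A)
    (habs : ∀ (S : Finset X) (T : Finset V), Disjoint B T → #T = 4 * #S →
      (#S : ℝ) ≤ α * Fintype.card X → MatchIn R (A ∪ S) (B ∪ T))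
    {S : Finset X} {C : Finset V} (hSA : Disjoint S A) (hCB : Disjoint C B) (hS : MatchIn R S C)
    (hcard : ((Fintype.card X : ℝ) - #A - #S) ≤ α * Fintype.card X) : MatchIn R univ univ := by
  obtain ⟨U, hUC, hU, hSU⟩ := hS.exists_card_eq hinj
  have hUB : Disjoint U B := hCB.mono_left hUC
  have h1 : #(A ∪ S) = #A + #S := card_union_of_disjoint hSA.symm
  have h2 : #(B ∪ U) = #B + #U := card_union_of_disjoint hUB.symm
  have h3 := card_compl_add_card (A ∪ S)
  have h4 := card_compl_add_card (B ∪ U)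
  have key := habs (A ∪ S)ᶜ (B ∪ U)ᶜ
    (disjoint_compl_right.mono_left subset_union_left) (by omega) (by
      have : (#(A ∪ S)ᶜ : ℝ) + (#A + #S) = Fintype.card X := by exact_mod_cast (by omega)
      linarith)
  refine (hSU.union key ?_).mono ?_ (subset_univ _)
  · rw [disjoint_union_right]
    exact ⟨hUB, disjoint_compl_right.mono_left subset_union_right⟩
  · intro x _
    simp only [mem_union, mem_compl]
    tauto

end Restriction

open Classical in
/-- A large symmetric system whose links satisfy the sharp minimum degree condition has a
perfect matching. -/
theorem exists_matchIn_univ : ∃ N₀ : ℕ, ∀ (X V : Type) [Fintype X] [Fintype V]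
    (R : X → (Fin 4 → V) → Prop), N₀ ≤ Fintype.card X → Fintype.card V = 4 * Fintype.card X →
    (∀ x w, R x w → Function.Injective w) →
    (∀ x w (σ : Equiv.Perm (Fin 4)), R x w → R x (w ∘ σ)) →
    (∀ x v, ((Fintype.card V : ℝ) - 1) * (Fintype.card V - 2) * (Fintype.card V - 3) -
      (3 / 4 * Fintype.card V * (3 / 4 * Fintype.card V - 1) * (3 / 4 * Fintype.card V - 2) - 1) ≤
        #{z : Fin 3 → V | R x (Fin.cons v z)}) → MatchIn R univ univ := by
  obtain ⟨γ₀, hγ₀, hmain⟩ := exists_matchIn_or_extremal (ε := 1 / 10 ^ 17) (by norm_num)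
  obtain ⟨γ, hγ⟩ : ∃ γ, γ = min γ₀ (1 / 10 ^ 17) := ⟨_, rfl⟩
  have hγ0 : 0 < γ := by rw [hγ]; positivity
  have hγ1 : γ ≤ 1 / 10 ^ 17 := by rw [hγ]; exact min_le_right _ _
  have hγγ : γ ≤ γ₀ := by rw [hγ]; exact min_le_left _ _
  obtain ⟨α, hα, N₁, habs⟩ := exists_absorber (β := γ / 6) (by positivity)
  obtain ⟨N₂, hN₂⟩ := hmain α hα
  obtain ⟨N₃, hN₃⟩ := exists_nat_ge (12 / γ)
  refine ⟨N₁ + 2 * N₂ + N₃ + 10 ^ 17, fun X V _ _ R hN hX hinj hperm hdeg => ?_⟩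
  have hK : (10 : ℝ) ^ 17 ≤ Fintype.card X := by
    exact_mod_cast (by omega : 10 ^ 17 ≤ Fintype.card X)
  have hn : (Fintype.card V : ℝ) = 4 * Fintype.card X := by exact_mod_cast hX
  have hnpos : (0 : ℝ) < Fintype.card V := by rw [hn]; linarith
  have : Nonempty V := Fintype.card_pos_iff.1 (by exact_mod_cast hnpos)
  have hlarge : 12 ≤ γ * Fintype.card V := by
    have h1 : (N₃ : ℝ) ≤ Fintype.card X := by exact_mod_cast (by omega : N₃ ≤ Fintype.card X)
    have h2 : 12 / γ ≤ Fintype.card V := by linarith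
    rw [div_le_iff₀ hγ0] at h2
    linarith
  have hdeg' : ∀ x v, (37 / 64 - γ / 2) * (Fintype.card V : ℝ) ^ 3 ≤
      #{z : Fin 3 → V | R x (Fin.cons v z)} := by
    intro x v
    refine le_trans ?_ (hdeg x v)
    have h1 : 12 * (Fintype.card V : ℝ) ^ 2 ≤ γ * Fintype.card V * (Fintype.card V : ℝ) ^ 2 :=
      mul_le_mul_of_nonneg_right hlarge (by positivity)
    nlinarith [sq_nonneg (Fintype.card V : ℝ)]
  obtain ⟨A, B, hAB, hA, hAbs⟩ := habs X V R (by omega) hX fun x v => by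
    refine le_trans ?_ (hdeg' x v)
    exact mul_le_mul_of_nonneg_right (by linarith) (by positivity)
  have hBn : (#B : ℝ) ≤ γ / 6 * Fintype.card V := by
    have : (#B : ℝ) = 4 * #A := by exact_mod_cast hAB
    rw [this, hn]; linarith
  have hAle : 2 * #A ≤ Fintype.card X := by
    have : (2 : ℝ) * #A ≤ Fintype.card X := by
      have := mul_le_mul_of_nonneg_right hγ1 (by positivity : (0 : ℝ) ≤ Fintype.card X)
      linarith
    exact_mod_cast this
  have hX' : Fintype.card {x // x ∉ A} = Fintype.card X - #A := by
    rw [Fintype.card_subtype_compl, Fintype.card_coe]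
  have hV' : Fintype.card {v // v ∉ B} = Fintype.card V - #B := by
    rw [Fintype.card_subtype_compl, Fintype.card_coe]
  have hV'n : (Fintype.card {v // v ∉ B} : ℝ) ≤ Fintype.card V := by
    exact_mod_cast (by omega : Fintype.card {v // v ∉ B} ≤ Fintype.card V)
  have hres := hN₂ {x // x ∉ A} {v // v ∉ B} (restrictSystem R A B) (by omega) (by omega)
    (fun x w hw i j hij => hinj _ _ hw (congrArg Subtype.val hij)) fun x v => by
    have h1 := hdeg' x v
    have h2 : (#{z : Fin 3 → V | R x (Fin.cons (v : V) z)} : ℝ) ≤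
      #{z : Fin 3 → {v // v ∉ B} | restrictSystem R A B x (Fin.cons v z)} +
        #{z : Fin 3 → V | ∃ i, z i ∈ B} := by
      exact_mod_cast card_link_le_restrictSystem A B x v
    have h3 : (#{z : Fin 3 → V | ∃ i, z i ∈ B} : ℝ) ≤ γ / 2 * (Fintype.card V : ℝ) ^ 3 := by
      have h4 := card_exists_mem_le (k := 3) B
      refine le_of_mul_le_mul_right (h4.trans ?_) hnpos
      have := mul_le_mul_of_nonneg_right hBn (by positivity : (0 : ℝ) ≤ (Fintype.card V : ℝ) ^ 3)
      push_cast
      linarith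
    have h5 : (Fintype.card {v // v ∉ B} : ℝ) ^ 3 ≤ (Fintype.card V : ℝ) ^ 3 :=
      pow_le_pow_left₀ (by positivity) hV'n 3
    have h6 : (37 / 64 - γ₀) * (Fintype.card {v // v ∉ B} : ℝ) ^ 3 ≤
        (37 / 64 - γ) * (Fintype.card {v // v ∉ B} : ℝ) ^ 3 :=
      mul_le_mul_of_nonneg_right (by linarith) (by positivity)
    have h7 := mul_le_mul_of_nonneg_left h5 (by linarith : (0 : ℝ) ≤ 37 / 64 - γ)
    linarith
  rcases hres with ⟨W, hW, hWe⟩ | ⟨S, hS, hSm⟩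
  · obtain ⟨W', hWW', -, hW'⟩ := exists_subsuperset_card_eq
      (subset_univ (W.map (Function.Embedding.subtype _))) (n := Fintype.card X)
      (by rw [card_map]; omega) (by rw [card_univ]; omega)
    refine matchIn_univ_of_extremal hX (by omega) hinj hperm hdeg hW' ?_
    have h1 : (edgesAvoiding R W' : ℝ) ≤ edgesAvoiding (restrictSystem R A B) W +
        #A * (Fintype.card V : ℝ) ^ 4 + Fintype.card X * #{w : Fin 4 → V | ∃ i, w i ∈ B} := by
      exact_mod_cast edgesAvoiding_le_restrictSystem A B W hWW'
    have h2 : (edgesAvoiding (restrictSystem R A B) W : ℝ) ≤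
        1 / 10 ^ 17 * (Fintype.card V : ℝ) ^ 5 :=
      hWe.trans (mul_le_mul_of_nonneg_left (pow_le_pow_left₀ (by positivity) hV'n 5) (by norm_num))
    have h3 : (#A : ℝ) * (Fintype.card V : ℝ) ^ 4 ≤ γ * (Fintype.card V : ℝ) ^ 5 := by
      have h4 : (#A : ℝ) ≤ γ * Fintype.card V := by
        rw [hn]
        have := mul_nonneg hγ0.le (by positivity : (0 : ℝ) ≤ Fintype.card X)
        linarith
      have := mul_le_mul_of_nonneg_right h4 (by positivity : (0 : ℝ) ≤ (Fintype.card V : ℝ) ^ 4)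
      linarith
    have h4 : (Fintype.card X : ℝ) * #{w : Fin 4 → V | ∃ i, w i ∈ B} ≤
        γ * (Fintype.card V : ℝ) ^ 5 := by
      have h5 := card_exists_mem_le (k := 4) B
      have h6 := mul_le_mul_of_nonneg_right hBn
        (by positivity : (0 : ℝ) ≤ (Fintype.card V : ℝ) ^ 4)
      have h7 : (Fintype.card X : ℝ) = Fintype.card V / 4 := by linarith
      have h8 : 0 ≤ γ * (Fintype.card V : ℝ) ^ 5 := by positivity
      rw [h7]
      push_cast at h5
      linarith
    have h5 := mul_le_mul_of_nonneg_right hγ1 (by positivity : (0 : ℝ) ≤ (Fintype.card V : ℝ) ^ 5)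
    have h6 : 0 ≤ (Fintype.card V : ℝ) ^ 5 := by positivity
    linarith
  · refine matchIn_univ_of_absorber hX hinj hAB hAbs ?_ ?_ hSm.of_restrictSystem ?_
    · rw [disjoint_left]
      intro x hx
      obtain ⟨y, -, rfl⟩ := mem_map.1 hx
      exact y.2
    · rw [disjoint_left]
      intro x hx
      obtain ⟨y, -, rfl⟩ := mem_map.1 hx
      exact y.2
    · rw [card_map]
      have h1 : (Fintype.card {x // x ∉ A} : ℝ) = Fintype.card X - #A := by
        rw [hX', Nat.cast_sub (by omega)]
      rw [h1] at hS
      have : 0 ≤ α * #A := by positivity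
      linarith

section Translation

variable {X V : Type} [DecidableEq X] [DecidableEq V]

/-- The edge with vertex `x` in the first class and the entries of `w` in the second class. -/
def partiteEdge (x : X) {k : ℕ} (w : Fin k → V) : Finset (X ⊕ V) :=
  insert (Sum.inl x) (univ.image fun i => Sum.inr (w i))

lemma inl_mem_partiteEdge {x y : X} {k : ℕ} {w : Fin k → V} :
    Sum.inl y ∈ partiteEdge x w ↔ y = x := by
  simp [partiteEdge]

lemma inr_mem_partiteEdge {x : X} {v : V} {k : ℕ} {w : Fin k → V} :
    Sum.inr v ∈ partiteEdge x w ↔ ∃ i, w i = v := by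
  simp [partiteEdge]

/-- The ordered version of a partite hypergraph. -/
def edgeSystem (H : Finset (Finset (X ⊕ V))) (x : X) (w : Fin 4 → V) : Prop :=
  Function.Injective w ∧ partiteEdge x w ∈ H

lemma edgeSystem.comp_perm {H : Finset (Finset (X ⊕ V))} {x : X} {w : Fin 4 → V}
    (h : edgeSystem H x w) (σ : Equiv.Perm (Fin 4)) : edgeSystem H x (w ∘ σ) := by
  refine ⟨h.1.comp σ.injective, ?_⟩
  convert h.2 using 1
  ext u
  rcases u with y | v
  · simp only [inl_mem_partiteEdge]
  · simp only [inr_mem_partiteEdge, Function.comp_apply]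
    exact ⟨fun ⟨i, hi⟩ => ⟨σ i, hi⟩, fun ⟨i, hi⟩ => ⟨σ.symm i, by simpa using hi⟩⟩

variable [Fintype V]

open Classical in
/-- Every edge through `x` and `v` has six orderings starting with `v`. -/
lemma six_mul_card_le_card_edgeSystem {H : Finset (Finset (X ⊕ V))}
    (hH : ∀ e ∈ H, ∃ (x : X) (s : Finset V), #s = 4 ∧ e = insert (Sum.inl x) (s.image Sum.inr))
    (x : X) (v : V) :
    6 * #{e ∈ H | Sum.inl x ∈ e ∧ Sum.inr v ∈ e} ≤
      #{z : Fin 3 → V | edgeSystem H x (Fin.cons v z)} := by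
  have hmaps : ∀ z ∈ (univ.filter fun z : Fin 3 → V => edgeSystem H x (Fin.cons v z)),
      partiteEdge x (Fin.cons v z : Fin 4 → V) ∈
        H.filter fun e => Sum.inl x ∈ e ∧ Sum.inr v ∈ e := fun z hz =>
    mem_filter.2 ⟨(mem_filter.1 hz).2.2, inl_mem_partiteEdge.2 rfl, inr_mem_partiteEdge.2 ⟨0, rfl⟩⟩
  rw [card_eq_sum_card_fiberwise hmaps, mul_comm, ← smul_eq_mul]
  refine card_nsmul_le_sum _ _ _ fun e he => ?_
  obtain ⟨heH, hxe, hve⟩ := mem_filter.1 he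
  obtain ⟨y, s, hs, rfl⟩ := hH e heH
  have hxy : x = y := by simpa using hxe
  subst hxy
  have hvs : v ∈ s := by simpa using hve
  have hs' : Fintype.card (s.erase v) = 3 := by
    rw [Fintype.card_coe, card_erase_of_mem hvs, hs]
  have hsix : #(univ : Finset (Fin 3 ≃ s.erase v)) = 6 := by
    rw [card_univ, Fintype.card_equiv (Fintype.equivOfCardEq (by rw [hs', Fintype.card_fin])),
      Fintype.card_fin]
    rfl
  rw [← hsix]
  refine card_le_card_of_injOn (fun f i => (f i : V)) ?_ ?_
  · intro f _
    have hedge : partiteEdge x (Fin.cons v fun i => (f i : V) : Fin 4 → V) =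
        insert (Sum.inl x) (s.image Sum.inr) := by
      ext u
      rcases u with y | u
      · simp [inl_mem_partiteEdge]
      · rw [inr_mem_partiteEdge]
        simp only [mem_insert, reduceCtorEq, mem_image, Sum.inr.injEq, exists_eq_right, false_or]
        constructor
        · rintro ⟨i, rfl⟩
          refine Fin.cases hvs (fun i => ?_) i
          exact mem_of_mem_erase (f i).2
        · intro hu
          by_cases huv : u = v
          · exact ⟨0, huv.symm⟩
          · exact ⟨(f.symm ⟨u, mem_erase.2 ⟨huv, hu⟩⟩).succ, by simp⟩
    refine mem_coe.2 (mem_filter.2 ⟨mem_filter.2 ⟨mem_univ _, ?_, ?_⟩, hedge⟩)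
    · rw [Fin.cons_injective_iff]
      refine ⟨?_, Subtype.val_injective.comp f.injective⟩
      rintro ⟨i, hi⟩
      exact ne_of_mem_erase (f i).2 hi
    · rw [hedge]; exact heH
  · intro f _ g _ hfg
    exact Equiv.ext fun i => Subtype.ext (congrFun hfg i)

/-- A matching of all of `X` in the ordered system is a perfect matching of the hypergraph. -/
lemma exists_perfect_matching_of_matchIn [Fintype X] (hX : Fintype.card V = 4 * Fintype.card X)
    {H : Finset (Finset (X ⊕ V))} (h : MatchIn (edgeSystem H) univ univ) :
    ∃ M ⊆ H, (M : Set (Finset (X ⊕ V))).Pairwise (fun a b => Disjoint a b) ∧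
      ∀ v : X ⊕ V, ∃ e ∈ M, v ∈ e := by
  obtain ⟨v, h1, -, h3⟩ := h
  refine ⟨univ.image fun x => partiteEdge x (v x), ?_, ?_, ?_⟩
  · intro e he
    obtain ⟨x, -, rfl⟩ := mem_image.1 he
    exact (h1 x (mem_univ _)).2
  · intro e he e' he' hee'
    obtain ⟨x, -, rfl⟩ := mem_image.1 (mem_coe.1 he)
    obtain ⟨y, -, rfl⟩ := mem_image.1 (mem_coe.1 he')
    have hxy : x ≠ y := fun hxy => hee' (by rw [hxy])
    rw [disjoint_left]
    rintro (z | u) hz hz'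
    · exact hxy ((inl_mem_partiteEdge.1 hz).symm.trans (inl_mem_partiteEdge.1 hz'))
    · obtain ⟨i, hi⟩ := inr_mem_partiteEdge.1 hz
      obtain ⟨j, hj⟩ := inr_mem_partiteEdge.1 hz'
      exact hxy (h3 x (mem_univ _) y (mem_univ _) i j (hi.trans hj.symm))
  · rintro (x | u)
    · exact ⟨_, mem_image.2 ⟨x, mem_univ _, rfl⟩, inl_mem_partiteEdge.2 rfl⟩
    · have hinj : Function.Injective fun p : X × Fin 4 => v p.1 p.2 := by
        rintro ⟨x, i⟩ ⟨y, j⟩ hxy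
        have hxy' : x = y := h3 x (mem_univ _) y (mem_univ _) i j hxy
        subst hxy'
        exact Prod.ext rfl ((h1 x (mem_univ _)).1 hxy)
      obtain ⟨p, hp⟩ := ((Fintype.bijective_iff_injective_and_card _).2 ⟨hinj, by
        rw [Fintype.card_prod, Fintype.card_fin, hX, mul_comm]⟩).2 u
      exact ⟨_, mem_image.2 ⟨p.1, mem_univ _, rfl⟩, inr_mem_partiteEdge.2 ⟨p.2, hp⟩⟩

end Translation

lemma six_mul_choose_three (n : ℕ) :
    6 * (n.choose 3 : ℝ) = (n : ℝ) * (n - 1) * (n - 2) := by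
  induction n with
  | zero => simp
  | succ n ih =>
    rw [Nat.choose_succ_succ' n 2, Nat.cast_add, Nat.cast_choose_two, mul_add, ih]
    push_cast
    ring

/-- For sufficiently large `n ≡ 0 (mod 4)`, every balanced
`(1,4)`-partite `5`-graph `H` with partition classes `X` (`|X| = n/4`) and `[n]`
such that `δ₁(N_H(x)) > C(n-1,3) - C(3n/4,3)` for all `x ∈ X` has a perfect
matching. Here the degree of `v ∈ [n]` in the link `N_H(x)` is the number of edges
of `H` containing both `x` and `v`. -/
theorem perfect_matching_partite_five_graph :
    ∃ N : ℕ, ∀ n : ℕ, N ≤ n → 4 ∣ n →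
    ∀ H : Finset (Finset (Fin (n / 4) ⊕ Fin n)),
      (∀ e ∈ H, ∃ (x : Fin (n / 4)) (s : Finset (Fin n)),
        s.card = 4 ∧ e = insert (Sum.inl x) (s.image Sum.inr)) →
      (∀ (x : Fin (n / 4)) (v : Fin n),
        Nat.choose (n - 1) 3 - Nat.choose (3 * n / 4) 3
          < (H.filter (fun e => Sum.inl x ∈ e ∧ Sum.inr v ∈ e)).card) →
      ∃ M ⊆ H, (M : Set (Finset (Fin (n / 4) ⊕ Fin n))).Pairwise (fun a b => Disjoint a b) ∧
        (∀ v : Fin (n / 4) ⊕ Fin n, ∃ e ∈ M, v ∈ e) := by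
  obtain ⟨N₀, hN₀⟩ := exists_matchIn_univ
  refine ⟨4 * N₀ + 4, fun n hn h4 H hH hdeg => ?_⟩
  have hcard : Fintype.card (Fin n) = 4 * Fintype.card (Fin (n / 4)) := by
    rw [Fintype.card_fin, Fintype.card_fin]; omega
  refine exists_perfect_matching_of_matchIn hcard (hN₀ _ _ _ (by rw [Fintype.card_fin]; omega)
    hcard (fun x w h => h.1) (fun x w σ h => h.comp_perm σ) fun x v => ?_)
  have h1 := six_mul_card_le_card_edgeSystem hH x v
  have h2 : (n - 1).choose 3 + 1 ≤
      #{e ∈ H | Sum.inl x ∈ e ∧ Sum.inr v ∈ e} + (3 * n / 4).choose 3 := by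
    have := hdeg x v
    omega
  obtain ⟨m, rfl⟩ := h4
  rw [show 3 * (4 * m) / 4 = 3 * m by omega] at h2
  have h3 : (((4 * m - 1).choose 3 : ℕ) : ℝ) + 1 ≤
      #{e ∈ H | Sum.inl x ∈ e ∧ Sum.inr v ∈ e} + ((3 * m).choose 3 : ℕ) := by exact_mod_cast h2
  have h4 := six_mul_choose_three (4 * m - 1)
  have h5 := six_mul_choose_three (3 * m)
  rw [Nat.cast_sub (by omega)] at h4
  push_cast at h4 h5
  refine le_trans ?_ (Nat.cast_le.2 h1)
  rw [Fintype.card_fin]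
  push_cast
  linarith
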